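/- Let k ≥ 1 and d ≥ 2 be integers. For every Π₁-computable real number h with 0 ≤ h ≤ log₂ k, there exists a nonempty d-dimensional SFT X ⊆ (Fin k)^{ℤ^d} with h(X) = h. -/

import Mathlib

open Filter

/-- Shift on one-dimensional configurations: `(shift1 p x) k = x (k - p)`. -/
def shift1 {A : Type*} (p : ℤ) (x : ℤ → A) : ℤ → A := fun k => x (k - p)

/-- Shift on two-dimensional configurations: `(shift2 v x) k = x (k - v)`. -/
def shift2 {A : Type*} (v : ℤ × ℤ) (x : ℤ × ℤ → A) : ℤ × ℤ → A := fun k => x (k - v)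

/-- The finite word `w` occurs in the bi-infinite sequence `x`. -/
def occursIn1 {A : Type*} (w : List A) (x : ℤ → A) : Prop :=
  ∃ i : ℤ, ∀ (n : ℕ) (h : n < w.length), x (i + n) = w.get ⟨n, h⟩

/-- The one-dimensional SFT avoiding the finite set `F` of forbidden words. -/
def SFT1 {A : Type*} (F : Finset (List A)) : Set (ℤ → A) :=
  {x | ∀ w ∈ F, ¬ occursIn1 w x}

/-- `H` is a one-dimensional subshift of finite type. -/
def IsSFT1 {A : Type*} (H : Set (ℤ → A)) : Prop :=
  ∃ F : Finset (List A), H = SFT1 F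

/-- A finite two-dimensional pattern: a finite support together with values. -/
structure Pattern2 (A : Type*) where
  support : Finset (ℤ × ℤ)
  val : ℤ × ℤ → A

/-- The pattern `p` occurs in the configuration `x`. -/
def Pattern2.OccursIn {A : Type*} (p : Pattern2 A) (x : ℤ × ℤ → A) : Prop :=
  ∃ v : ℤ × ℤ, ∀ u ∈ p.support, x (u + v) = p.val u

/-- The two-dimensional SFT avoiding the finite set `F` of forbidden patterns. -/
def SFT2 {A : Type*} (F : Finset (Pattern2 A)) : Set (ℤ × ℤ → A) :=
  {x | ∀ p ∈ F, ¬ p.OccursIn x}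

/-- The SFT `X_F` with added horizontal constraints from `H`: every row lies in `H`
and no pattern of `F` occurs. -/
def XHF {A : Type*} (H : Set (ℤ → A)) (F : Finset (Pattern2 A)) : Set (ℤ × ℤ → A) :=
  {x | (∀ j : ℤ, (fun k => x (k, j)) ∈ H) ∧ ∀ p ∈ F, ¬ p.OccursIn x}

/-- The combined subshift: rows in `H`, columns in `V`. -/
def XHV {A : Type*} (H V : Set (ℤ → A)) : Set (ℤ × ℤ → A) :=
  {x | (∀ j : ℤ, (fun k => x (k, j)) ∈ H) ∧ ∀ i : ℤ, (fun l => x (i, l)) ∈ V}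

/-- Number of restrictions of elements of `X` to `[0,m) × [0,n)`. -/
noncomputable def patCount2 {A : Type*} (X : Set (ℤ × ℤ → A)) (m n : ℕ) : ℕ :=
  Set.ncard {p : Fin m → Fin n → A |
    ∃ x ∈ X, ∀ (i : Fin m) (j : Fin n), x ((i : ℤ), (j : ℤ)) = p i j}

/-- Topological entropy of a two-dimensional subshift. -/
noncomputable def entropy2 {A : Type*} (X : Set (ℤ × ℤ → A)) : ℝ :=
  ⨅ n : ℕ, Real.logb 2 (patCount2 X (n + 1) (n + 1)) / ((n : ℝ) + 1) ^ 2

/-- The word `w` belongs to the language of `H`. -/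
def wordIn {A : Type*} (H : Set (ℤ → A)) (w : List A) : Prop :=
  ∃ x ∈ H, occursIn1 w x

/-- Number of length-`n` words in the language of `H`. -/
noncomputable def wordCount {A : Type*} (H : Set (ℤ → A)) (n : ℕ) : ℕ :=
  Set.ncard {w : List A | w.length = n ∧ wordIn H w}

/-- Topological entropy of a one-dimensional subshift. -/
noncomputable def entropy1 {A : Type*} (H : Set (ℤ → A)) : ℝ :=
  ⨅ n : ℕ, Real.logb 2 (wordCount H (n + 1)) / ((n : ℝ) + 1)

/-- `X` is a two-dimensional subshift (closed and shift-invariant). -/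
def IsSubshift2 {A : Type*} [TopologicalSpace A] (X : Set (ℤ × ℤ → A)) : Prop :=
  IsClosed X ∧ ∀ (v : ℤ × ℤ) (x : ℤ × ℤ → A), x ∈ X → shift2 v x ∈ X

/-- `X` is an `(m,n)`-th root of `Y`. -/
def IsRoot {A B : Type*} [TopologicalSpace A] [TopologicalSpace B]
    (X : Set (ℤ × ℤ → A)) (Y : Set (ℤ × ℤ → B)) (m n : ℕ) : Prop :=
  ∃ Z : Set (ℤ × ℤ → A), Z ⊆ X ∧ IsClopen {x : X | (x : ℤ × ℤ → A) ∈ Z} ∧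
    shift2 ((m : ℤ), 0) '' Z = Z ∧ shift2 (0, (n : ℤ)) '' Z = Z ∧
    (∃ φ : Z ≃ₜ Y,
      ∀ (x : Z) (k₁ k₂ : ℤ)
        (hx : shift2 (k₁ * (m : ℤ), k₂ * (n : ℤ)) (x : ℤ × ℤ → A) ∈ Z),
        (φ ⟨shift2 (k₁ * (m : ℤ), k₂ * (n : ℤ)) (x : ℤ × ℤ → A), hx⟩ : ℤ × ℤ → B) =
          shift2 (k₁, k₂) (φ x : ℤ × ℤ → B)) ∧
    (∀ i j : ℕ, i < m → j < n → shift2 ((i : ℤ), (j : ℤ)) '' Z ⊆ X) ∧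
    ∀ x ∈ X, ∃! q : Fin m × Fin n, x ∈ shift2 ((q.1 : ℤ), (q.2 : ℤ)) '' Z

/-- The vertex shift (nearest-neighbor SFT) of a directed graph on `A`. -/
def vertexShift {A : Type*} (E : A → A → Prop) : Set (ℤ → A) :=
  {x | ∀ i : ℤ, E (x i) (x (i + 1))}

/-- Strongly connected component: a maximal nonempty set whose vertices are pairwise
joined by nonempty directed paths. -/
def IsSCC {A : Type*} (E : A → A → Prop) (S : Set A) : Prop :=
  S.Nonempty ∧ (∀ a ∈ S, ∀ b ∈ S, Relation.TransGen E a b) ∧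
    ∀ T : Set A, S ⊆ T → (∀ a ∈ T, ∀ b ∈ T, Relation.TransGen E a b) → T = S

def ReflexiveType {A : Type*} (E : A → A → Prop) (S : Set A) : Prop :=
  ∀ v ∈ S, E v v

def SymmetricType {A : Type*} (E : A → A → Prop) (S : Set A) : Prop :=
  ∀ v ∈ S, ∀ w ∈ S, v ≠ w → E v w → E w v

def StateSplitType {A : Type*} (E : A → A → Prop) (S : Set A) : Prop :=
  ∃ p : ℕ, 0 < p ∧ ∃ f : A → ZMod p,
    (∀ i : ZMod p, ∃ v ∈ S, f v = i) ∧
    ∀ v ∈ S, ∀ w ∈ S, (E v w ↔ f w = f v + 1)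

/-- Condition D: all SCCs share one of the three types. -/
def ConditionD {A : Type*} (E : A → A → Prop) : Prop :=
  (∀ S : Set A, IsSCC E S → ReflexiveType E S) ∨
  (∀ S : Set A, IsSCC E S → SymmetricType E S) ∨
  (∀ S : Set A, IsSCC E S → StateSplitType E S)

/-- A real is Π₁-computable (right-recursively enumerable). -/
def Pi1Computable (x : ℝ) : Prop :=
  ∃ f : ℕ → ℚ, Computable f ∧ Antitone f ∧
    Tendsto (fun n => (f n : ℝ)) atTop (nhds x)

/-- A computable real number. -/
def IsComputableReal (x : ℝ) : Prop :=
  ∃ f : ℕ → ℚ, Computable f ∧ ∀ n : ℕ, |(f n : ℝ) - x| ≤ (2 : ℝ) ^ (-(n : ℤ))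

/-- `w` is a finite concatenation of copies of `w₁` and `w₂`. -/
def IsConcat {A : Type*} (w₁ w₂ w : List A) : Prop :=
  ∃ L : List (List A), (∀ v ∈ L, v = w₁ ∨ v = w₂) ∧ w = L.flatten

/-- Transitivity of a one-dimensional subshift. -/
def Transitive1 {A : Type*} (H : Set (ℤ → A)) : Prop :=
  ∀ u w : List A, wordIn H u → wordIn H w → ∃ v : List A, wordIn H (u ++ v ++ w)

/-- The subshift of elements of `H` avoiding the word `u`. -/
def avoidWord {A : Type*} (H : Set (ℤ → A)) (u : List A) : Set (ℤ → A) :=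
  {x ∈ H | ¬ occursIn1 u x}

/-- A finite `d`-dimensional pattern: a finite support together with values. -/
structure PatternD (d : ℕ) (A : Type*) where
  support : Finset (Fin d → ℤ)
  val : (Fin d → ℤ) → A

/-- The pattern `p` occurs in the `d`-dimensional configuration `x`. -/
def PatternD.OccursIn {d : ℕ} {A : Type*} (p : PatternD d A)
    (x : (Fin d → ℤ) → A) : Prop :=
  ∃ v : Fin d → ℤ, ∀ u ∈ p.support, x (u + v) = p.val u

/-- The `d`-dimensional SFT avoiding the finite set `F` of forbidden patterns. -/
def SFTD {d : ℕ} {A : Type*} (F : Finset (PatternD d A)) : Set ((Fin d → ℤ) → A) :=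
  {x | ∀ p ∈ F, ¬ p.OccursIn x}

/-- Number of restrictions of elements of `X` to `[0,n)^d`. -/
noncomputable def patCountD {d : ℕ} {A : Type*} (X : Set ((Fin d → ℤ) → A)) (n : ℕ) : ℕ :=
  Set.ncard {p : (Fin d → Fin n) → A |
    ∃ x ∈ X, ∀ u : Fin d → Fin n, x (fun i => (u i : ℤ)) = p u}

/-- Topological entropy of a `d`-dimensional subshift. -/
noncomputable def entropyD {d : ℕ} {A : Type*} (X : Set ((Fin d → ℤ) → A)) : ℝ :=
  ⨅ n : ℕ, Real.logb 2 (patCountD X (n + 1)) / ((n : ℝ) + 1) ^ d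

namespace SFTEntropy

/-- The type of a crossing of a column line and a row line. -/
inductive Ty
  | eq | row (b : Bool) | col (b : Bool)

/-- What a line sees at a crossing: an equal, a stronger or a weaker line. -/
inductive Ev
  | eq | sub (b : Bool) | dom (b : Bool)

structure Line where
  side : Bool
  red : Bool
  dig : Fin 4
  r : ZMod 4
  u : Bool

/-- A symbol of the hierarchical layer: parities, crossing type, the line carried by the edge
above the site and the line carried by the edge to its right. -/
structure Sym1 where
  pX : Bool
  pY : Bool
  t : Ty
  V : Line
  H : Line

def Ty.tr : Ty → Ty
  | .eq => .eq
  | .row b => .col b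
  | .col b => .row b

/-- The event seen by the column line. -/
def Ty.ev : Ty → Ev
  | .eq => .eq
  | .row b => .sub b
  | .col b => .dom b

/-- Transposition of symbols. -/
def Sym1.tr (s : Sym1) : Sym1 := ⟨s.pY, s.pX, s.t.tr, s.H, s.V⟩

theorem Ty.tr_tr (t : Ty) : t.tr.tr = t := by cases t <;> rfl

theorem Sym1.tr_tr (s : Sym1) : s.tr.tr = s := by
  simp [Sym1.tr, Ty.tr_tr]

structure Line.Same (s t : Line) : Prop where
  side : t.side = s.side
  red : t.red = s.red
  dig : t.dig = s.dig

/-- The evolution of the counters of a line through a crossing. -/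
def Line.Count (p o : Bool) : Ev → Line → Line → Prop
  | .eq, s, t => t.r = (if o then 0 else 2) ∧ s.r = t.r - 1 ∧ s.u = true ∧ t.u = p
  | .sub b, s, t => t.r = (if b then 1 else 3) ∧ s.r = t.r - 1 ∧ s.u = true ∧ t.u = p
  | .dom true, s, t => t.r = s.r ∧ s.u = false ∧ t.u = true
  | .dom false, s, t => t.r = s.r ∧ t.u = s.u

/-- The local rules for columns: `s` is a site, `r` its right and `u` its upper neighbour. -/
structure Half (s r u : Sym1) : Prop where
  px_r : r.pX = !s.pX
  px_u : u.pX = s.pX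
  same : Line.Same s.V u.V
  count : Line.Count u.pX u.H.side u.t.ev s.V u.V
  red0 : s.pX = true → s.V.red = false ∧ s.V.dig = 0
  odd_odd : s.pX = true → s.pY = true → s.t = .eq
  odd_even : s.pX = true → s.pY = false → ∃ b, s.t = .row b
  eq_pair : s.t = .eq → s.V.red = s.H.red ∧ s.V.dig = s.H.dig
  col_pair : s.t = .col true → s.H.red = !s.V.red ∧ (s.H.red = true → s.H.dig = s.V.dig)

/-- The local rule of the hierarchical layer. -/
def Rule1 (y : ℤ → ℤ → Sym1) : Prop :=
  ∀ i j, Half (y i j) (y (i + 1) j) (y i (j + 1)) ∧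
    Half (y i j).tr (y i (j + 1)).tr (y (i + 1) j).tr

/-- Transposition of configurations. -/
def trc (y : ℤ → ℤ → Sym1) : ℤ → ℤ → Sym1 := fun i j => (y j i).tr

theorem trc_trc (y : ℤ → ℤ → Sym1) : trc (trc y) = y := by
  funext i j; exact Sym1.tr_tr _

theorem Rule1.trc {y : ℤ → ℤ → Sym1} (h : Rule1 y) : Rule1 (trc y) := by
  intro i j
  refine ⟨(h j i).2, ?_⟩
  simp only [SFTEntropy.trc, Sym1.tr_tr]
  exact (h j i).1

/-- `a` has 2-adic level exactly `l`. -/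
def Lev (l : ℕ) (a : ℤ) : Prop := (2 : ℤ) ^ l ∣ a ∧ ¬ (2 : ℤ) ^ (l + 1) ∣ a

theorem exists_lev {n : ℕ} {a : ℤ} (h : ¬ (2 : ℤ) ^ n ∣ a) : ∃ l < n, Lev l a := by
  induction n with
  | zero => simp at h
  | succ n ih =>
    by_cases h' : (2 : ℤ) ^ n ∣ a
    · exact ⟨n, by omega, h', h⟩
    · obtain ⟨l, hl, hh⟩ := ih h'
      exact ⟨l, by omega, hh⟩

theorem Lev.unique {l m : ℕ} {a : ℤ} (h : Lev l a) (h' : Lev m a) : l = m := by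
  rcases lt_trichotomy l m with hh | hh | hh
  · exact absurd ((pow_dvd_pow 2 (show l + 1 ≤ m by omega)).trans h'.1) h.2
  · exact hh
  · exact absurd ((pow_dvd_pow 2 (show m + 1 ≤ l by omega)).trans h.1) h'.2

theorem Lev.add {l n : ℕ} {a b : ℤ} (h : Lev l a) (hl : l < n) (hb : (2 : ℤ) ^ n ∣ b) :
    Lev l (a + b) := by
  have h1 := (pow_dvd_pow (2 : ℤ) hl).trans hb
  have h2 := (pow_dvd_pow (2 : ℤ) hl.le).trans hb
  exact ⟨dvd_add h.1 h2, fun hh => h.2 ((Int.dvd_add_left h1).1 hh)⟩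

theorem Lev.add_self {l : ℕ} {a : ℤ} (h : Lev l a) : (2 : ℤ) ^ (l + 1) ∣ a + 2 ^ l := by
  obtain ⟨⟨c, rfl⟩, h2⟩ := h
  rw [pow_succ] at *
  rcases Int.even_or_odd' c with ⟨e, rfl | rfl⟩
  · exact absurd ⟨e, by ring⟩ h2
  · exact ⟨e + 1, by ring⟩

theorem lev_add_of_dvd {l : ℕ} {a : ℤ} (h : (2 : ℤ) ^ (l + 1) ∣ a) : Lev l (a + 2 ^ l) := by
  obtain ⟨c, rfl⟩ := h
  have hp : (2 : ℤ) ^ l ≠ 0 := by positivity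
  refine ⟨⟨2 * c + 1, by ring⟩, ?_⟩
  rintro ⟨e, he⟩
  have : (2 : ℤ) ^ l * (2 * c + 1) = 2 ^ l * (2 * e) := by rw [pow_succ] at he; linarith
  have := mul_left_cancel₀ hp this
  omega

theorem exists_lev_add {n : ℕ} {b : ℤ} (hb : (2 : ℤ) ^ n ∣ b) {s : ℕ} (h0 : 0 < s)
    (hs : s < 2 ^ n) : ∃ l < n, Lev l (b + s) := by
  apply exists_lev
  intro h
  have := (Int.dvd_add_right hb).1 h
  have := Int.le_of_dvd (by omega) this
  have : ((2 ^ n : ℕ) : ℤ) ≤ s := by exact_mod_cast this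
  omega

/-- The columns' half of the structure forced by the local rules on the first `n` levels. -/
structure HStr (y : ℤ → ℤ → Sym1) (n : ℕ) (x z : ℤ) : Prop where
  par : ∀ i j, (y i j).pX = true ↔ ¬ (2 : ℤ) ∣ i - x
  E : ∀ l < n, ∀ i j, Lev l (i - x) → Lev l (j - z) → (y i j).t = .eq
  C : ∀ l < n, ∀ i j, Lev l (j - z) → (2 : ℤ) ^ (l + 1) ∣ i - x →
    (y i j).t = .col (decide (¬ (2 : ℤ) ^ (l + 2) ∣ i - x))
  S : ∀ l < n, ∀ i j, Lev l (i - x) →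
    ((y i j).V.side = true ↔ (2 : ℤ) ^ (l + 2) ∣ i - x - 2 ^ l)

/-- The structure forced by the local rules on the first `n` levels. -/
structure Str (y : ℤ → ℤ → Sym1) (n : ℕ) (x z : ℤ) : Prop where
  hv : HStr y n x z
  hh : HStr (trc y) n z x

theorem Str.trc {y n x z} (h : Str y n x z) : Str (trc y) n z x :=
  ⟨h.hh, by rw [trc_trc]; exact h.hv⟩

section
variable {y : ℤ → ℤ → Sym1}

theorem Rule1.sideV (h : Rule1 y) (i j : ℤ) (s : ℕ) : Line.Same (y i j).V (y i (j + s)).V := by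
  induction s with
  | zero => simp; exact ⟨rfl, rfl, rfl⟩
  | succ s ih =>
    have := (h i (j + s)).1.same
    rw [show j + ((s + 1 : ℕ) : ℤ) = j + s + 1 by push_cast; ring]
    exact ⟨this.1.trans ih.1, this.2.trans ih.2, this.3.trans ih.3⟩

theorem Rule1.same (h : Rule1 y) (i j j' : ℤ) : Line.Same (y i j).V (y i j').V := by
  rcases le_total j j' with hj | hj
  · obtain ⟨s, rfl⟩ := Int.le.dest hj
    exact h.sideV i j s
  · obtain ⟨s, rfl⟩ := Int.le.dest hj
    have := h.sideV i j' s
    exact ⟨this.1.symm, this.2.symm, this.3.symm⟩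

theorem Rule1.str_zero (h : Rule1 y) : ∃ x z, Str y 0 x z := by
  have key : ∀ y : ℤ → ℤ → Sym1, Rule1 y → ∃ x : ℤ, ∀ i j,
      (y i j).pX = true ↔ ¬ (2 : ℤ) ∣ i - x := by
    intro y h
    have hc : ∀ i j, (y i j).pX = (y i 0).pX := by
      intro i j
      induction j using Int.induction_on with
      | zero => rfl
      | succ j ih => rw [(h i j).1.px_u, ih]
      | pred j ih => rw [← ih, ← (h i (-j - 1)).1.px_u]; simp
    obtain ⟨x, hx⟩ : ∃ x : ℤ, (y x 0).pX = false := by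
      by_cases h0 : (y 0 0).pX = false
      · exact ⟨0, h0⟩
      · refine ⟨0 + 1, ?_⟩
        rw [(h 0 0).1.px_r]; simpa using h0
    refine ⟨x, fun i j => ?_⟩
    rw [hc]
    have : ∀ k : ℤ, (y (x + k) 0).pX = true ↔ ¬ (2 : ℤ) ∣ k := by
      intro k
      induction k using Int.induction_on with
      | zero => simp [hx]
      | succ j ih =>
        rw [← add_assoc, (h _ 0).1.px_r]
        have : (y (x + j) 0).pX = false ↔ (2 : ℤ) ∣ j := by
          rw [← not_iff_not, ← ih]; simp
        simp only [Bool.not_eq_true', this]; omega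
      | pred j ih =>
        have h1 := (h (x + (-j - 1)) 0).1.px_r
        rw [show x + (-(j : ℤ) - 1) + 1 = x + -j by ring] at h1
        rw [h1] at ih
        have : (y (x + (-j - 1)) 0).pX = false ↔ ¬ (2 : ℤ) ∣ -j := by
          rw [← ih]; simp
        rw [← not_iff_not, Bool.not_eq_true, this]; omega
    have := this (i - x)
    rwa [add_sub_cancel] at this
  obtain ⟨x, hx⟩ := key y h
  obtain ⟨z, hz⟩ := key _ h.trc
  exact ⟨x, z, ⟨hx, by simp, by simp, by simp⟩, ⟨hz, by simp, by simp, by simp⟩⟩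

variable {n : ℕ} {x z : ℤ}

theorem Str.col_lt (hs : Str y n x z) {i j : ℤ} (hi : (2 : ℤ) ^ n ∣ i - x)
    (hj : (2 : ℤ) ^ n ∣ j - z) {s : ℕ} (h0 : 0 < s) (hsn : s < 2 ^ n) :
    ∃ b, (y i (j + s)).t = .col b := by
  obtain ⟨l, hl, h⟩ := exists_lev_add hj h0 hsn
  exact ⟨_, hs.hv.C l hl i _ (by convert h using 1; ring) ((pow_dvd_pow 2 hl).trans hi)⟩

theorem Str.walk_r (hs : Str y n x z) (h : Rule1 y) {i j : ℤ} (hi : (2 : ℤ) ^ n ∣ i - x)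
    (hj : (2 : ℤ) ^ n ∣ j - z) {s : ℕ} (hsn : s < 2 ^ n) :
    (y i (j + s)).V.r = (y i j).V.r := by
  induction s with
  | zero => simp
  | succ s ih =>
    have h1 := ih (by omega)
    obtain ⟨b, hb⟩ := hs.col_lt hi hj (s := s + 1) (by omega) hsn
    have h2 := (h i (j + s)).1.count
    rw [show j + ((s + 1 : ℕ) : ℤ) = j + s + 1 by push_cast; ring] at *
    rw [hb] at h2
    cases b <;> exact h2.1.trans h1

theorem Str.walk_u (hs : Str y (n + 1) x z) (h : Rule1 y) {i j : ℤ}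
    (hi : (2 : ℤ) ^ (n + 1) ∣ i - x) (hj : (2 : ℤ) ^ n ∣ j - z) {s : ℕ} (hsn : s < 2 ^ n) :
    (y i (j + s)).V.u = (y i j).V.u := by
  induction s with
  | zero => simp
  | succ s ih =>
    have h1 := ih (by omega)
    have h2 := (h i (j + s)).1.count
    obtain ⟨l, hl, hL⟩ := exists_lev_add hj (s := s + 1) (by omega) hsn
    rw [show j + ((s + 1 : ℕ) : ℤ) = j + s + 1 by push_cast; ring] at *
    have := hs.hv.C l (by omega) i (j + s + 1) (by convert hL using 1; push_cast; ring)
      ((pow_dvd_pow 2 (by omega)).trans hi)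
    rw [this, show decide (¬ (2 : ℤ) ^ (l + 2) ∣ i - x) = false by
      simpa using (pow_dvd_pow 2 (by omega)).trans hi] at h2
    exact h2.2.trans h1

/-- A column of level `n` is not dominant at rows of level at least `n`. -/
theorem Str.not_col (hs : Str y n x z) (h : Rule1 y) {i j : ℤ} (hi : Lev n (i - x))
    (hj : (2 : ℤ) ^ n ∣ j - z) (b : Bool) : (y i j).t ≠ .col b := by
  intro hb
  cases n with
  | zero =>
    have hx : (y i j).pX = true := (hs.hv.par i j).2 (by simpa [Lev] using hi)
    cases hy : (y i j).pY
    · obtain ⟨c, hc⟩ := (h i j).1.odd_even hx hy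
      rw [hc] at hb; cases hb
    · have := (h i j).1.odd_odd hx hy
      rw [this] at hb; cases hb
  | succ n =>
    have hp : (2 : ℤ) ^ (n + 1) = 2 ^ n + 2 ^ n := by ring
    have hpn : (1 : ℕ) ≤ 2 ^ n := Nat.one_le_two_pow
    have hc : ((2 ^ n - 1 : ℕ) : ℤ) = 2 ^ n - 1 := by push_cast [hpn]; ring
    have key : ∀ j : ℤ, (2 : ℤ) ^ (n + 1) ∣ j - z →
        (y i (j + 2 ^ n - 1)).V.u = false ∧ (y i (j + 2 ^ n)).V.u = true := by
      intro j hj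
      have h1 := hs.hv.C n (by omega) i (j + 2 ^ n)
        (by convert lev_add_of_dvd hj using 1; ring) hi.1
      rw [show decide (¬ (2 : ℤ) ^ (n + 2) ∣ i - x) = true by simpa using hi.2] at h1
      have h2 := (h i (j + 2 ^ n - 1)).1.count
      rw [sub_add_cancel, h1] at h2
      exact h2.2
    have hd1 : (2 : ℤ) ^ n ∣ j - z := (pow_dvd_pow 2 (by omega)).trans hj
    have u1 : (y i j).V.u = false := by
      have := hs.walk_u h hi.1 hd1 (s := 2 ^ n - 1) (by omega)
      rw [hc, ← add_sub_assoc] at this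
      rw [← this]; exact (key j hj).1
    have u2 : (y i (j - 1)).V.u = true := by
      have hj' : (2 : ℤ) ^ (n + 1) ∣ j - 2 ^ (n + 1) - z := by
        rw [sub_right_comm]; exact dvd_sub_self_right.2 hj
      have := hs.walk_u h hi.1 (j := j - 2 ^ n) (by
        rw [sub_right_comm]; exact dvd_sub_self_right.2 hd1) (s := 2 ^ n - 1) (by omega)
      rw [hc, show j - 2 ^ n + (2 ^ n - 1) = j - 1 by ring] at this
      rw [this, ← (key _ hj').2]
      congr 3; rw [hp]; ring
    have h2 := (h i (j - 1)).1.count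
    rw [sub_add_cancel, hb] at h2
    cases b
    · exact absurd (h2.2.symm.trans u1) (by simp [u2])
    · exact absurd h2.2.2 (by simp [u1])

theorem Str.not_row (hs : Str y n x z) (h : Rule1 y) {i j : ℤ} (hj : Lev n (j - z))
    (hi : (2 : ℤ) ^ n ∣ i - x) (b : Bool) : (y i j).t ≠ .row b := by
  intro hb
  refine hs.trc.not_col h.trc hj hi b ?_
  simp [SFTEntropy.trc, Sym1.tr, hb, Ty.tr]

theorem Str.eq_top (hs : Str y n x z) (h : Rule1 y) {i j : ℤ} (hi : Lev n (i - x))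
    (hj : Lev n (j - z)) : (y i j).t = .eq := by
  cases ht : (y i j).t with
  | eq => rfl
  | row b => exact absurd ht (hs.not_row h hj hi.1 b)
  | col b => exact absurd ht (hs.not_col h hi hj.1 b)

theorem Str.step_at (hs : Str y n x z) (h : Rule1 y) {i j : ℤ} (hi : Lev n (i - x))
    (hj : (2 : ℤ) ^ n ∣ j - z) :
    Line.Count (y i (j + 2 ^ n)).pX (y i (j + 2 ^ n)).H.side (y i (j + 2 ^ n)).t.ev
      ⟨(y i (j + 2 ^ n - 1)).V.side, (y i (j + 2 ^ n - 1)).V.red, (y i (j + 2 ^ n - 1)).V.dig,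
        (y i j).V.r, (y i (j + 2 ^ n - 1)).V.u⟩ (y i (j + 2 ^ n)).V := by
  have hpn : (1 : ℕ) ≤ 2 ^ n := Nat.one_le_two_pow
  have h2 := (h i (j + 2 ^ n - 1)).1.count
  rw [sub_add_cancel] at h2
  rw [← hs.walk_r h hi.1 hj (s := 2 ^ n - 1) (by omega)]
  have hc : ((2 ^ n - 1 : ℕ) : ℤ) = 2 ^ n - 1 := by push_cast [hpn]; ring
  rw [hc, ← add_sub_assoc]
  exact h2

theorem Str.alternate (hs : Str y n x z) (h : Rule1 y) {i j : ℤ} (hi : Lev n (i - x))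
    (hj : Lev n (j - z)) :
    (y i (j + 2 ^ n)).t = .row (y i j).H.side ∧
      (y i (j + 2 ^ (n + 1))).H.side = !(y i j).H.side := by
  have e0 := hs.eq_top h hi hj
  have hr0 : (y i j).V.r = if (y i j).H.side then 0 else 2 := by
    have := (h i (j - 1)).1.count
    rw [sub_add_cancel, e0] at this
    exact this.1
  have hj1 : (2 : ℤ) ^ n ∣ j + 2 ^ n - z := by
    rw [add_sub_right_comm]; exact dvd_add_self_right.2 hj.1
  have s1 := hs.step_at h hi hj.1
  have e2 : (y i (j + 2 ^ n + 2 ^ n)).t = .eq := by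
    apply hs.eq_top h hi
    have := hj.add (Nat.lt_succ_self n) dvd_rfl
    convert this using 1; rw [pow_succ]; ring
  have s2 := hs.step_at h hi hj1
  rw [show j + (2 : ℤ) ^ (n + 1) = j + 2 ^ n + 2 ^ n by ring]
  generalize y i (j + 2 ^ n + 2 ^ n) = w2 at *
  rw [e2] at s2
  have nc : ∀ b, (y i (j + 2 ^ n)).t ≠ .col b := hs.not_col h hi hj1
  generalize y i (j + 2 ^ n) = w1 at *
  generalize (y i j).H.side = o at *
  have hr := s2.2.1
  have hr' := s2.1
  dsimp only at hr
  rcases w1 with ⟨p1, p2, t1, V1, H1⟩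
  dsimp only at *
  rw [hr'] at hr
  cases t1 with
  | eq =>
    have := s1.1; have h3 := s1.2.1
    dsimp only at h3
    rw [hr0, this] at h3
    exfalso; revert h3; cases o <;> cases H1.side <;> decide
  | col b => exact absurd rfl (nc b)
  | row b =>
    have := s1.1; have h3 := s1.2.1
    dsimp only at h3
    rw [hr0, this] at h3
    rw [this] at hr
    revert h3 hr
    cases o <;> cases b <;> cases w2.H.side <;> simp <;> decide

theorem Str.pow_two_step (hs : Str y n x z) (h : Rule1 y) :
    ∃ z', (2 : ℤ) ^ (n + 1) ∣ z' - z ∧ (∀ i j, Lev n (j - z') →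
      ((y i j).H.side = true ↔ (2 : ℤ) ^ (n + 2) ∣ j - z' - 2 ^ n)) ∧
      ∀ i j, Lev n (i - x) → (2 : ℤ) ^ (n + 1) ∣ j - z' →
        (y i j).t = .row (decide (¬ (2 : ℤ) ^ (n + 2) ∣ j - z')) := by
  have hp : (2 : ℤ) ^ (n + 2) = 2 * 2 ^ (n + 1) := by ring
  have hp1 : (2 : ℤ) ^ (n + 1) = 2 * 2 ^ n := by ring
  have hp0 : (0 : ℤ) < 2 ^ n := by positivity
  have hcH : ∀ i i' j, (y i j).H.side = (y i' j).H.side := fun i i' j =>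
    (h.trc.same j i' i).side
  have hLx : Lev n (x + 2 ^ n - x) := by simpa using lev_add_of_dvd (l := n) (dvd_zero _)
  obtain ⟨z', hz', hside⟩ : ∃ z', (2 : ℤ) ^ (n + 1) ∣ z' - z ∧
      (y 0 (z' + 2 ^ n)).H.side = true := by
    by_cases h0 : (y 0 (z + 2 ^ n)).H.side = true
    · exact ⟨z, by simp, h0⟩
    · refine ⟨z + 2 ^ (n + 1), by simp, ?_⟩
      have := (hs.alternate h (j := z + 2 ^ n) hLx
        (by simpa using lev_add_of_dvd (l := n) (dvd_zero _))).2
      rw [hcH _ 0, hcH (x + 2 ^ n) 0, add_right_comm] at this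
      rw [this]; simpa using h0
  have hlev : ∀ k : ℤ, Lev n (z' + 2 ^ n + k * 2 ^ (n + 1) - z) := by
    intro k
    convert lev_add_of_dvd (l := n) (a := z' - z + k * 2 ^ (n + 1))
      (dvd_add hz' ⟨k, by ring⟩) using 1
    ring
  have halt : ∀ k : ℤ, (y 0 (z' + 2 ^ n + k * 2 ^ (n + 1))).H.side = true ↔ (2 : ℤ) ∣ k := by
    have hstep : ∀ k : ℤ, (y 0 (z' + 2 ^ n + (k + 1) * 2 ^ (n + 1))).H.side =
        !(y 0 (z' + 2 ^ n + k * 2 ^ (n + 1))).H.side := by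
      intro k
      have := (hs.alternate h hLx (hlev k)).2
      rw [hcH _ 0, hcH (x + 2 ^ n) 0] at this
      rw [← this]; congr 3; ring
    intro k
    induction k using Int.induction_on with
    | zero => simp [hside]
    | succ k ih =>
      rw [hstep]
      have : (y 0 (z' + 2 ^ n + k * 2 ^ (n + 1))).H.side = false ↔ ¬ (2 : ℤ) ∣ k := by
        rw [← ih]; simp
      rw [Bool.not_eq_true', this]; omega
    | pred k ih =>
      have := hstep (-k - 1)
      rw [sub_add_cancel] at this
      rw [this, Bool.not_eq_true', ← not_iff_not, Bool.not_eq_false] at ih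
      rw [ih]; omega
  refine ⟨z', hz', fun i j hj => ?_, fun i j hi hj => ?_⟩
  · obtain ⟨k, hk⟩ : (2 : ℤ) ^ (n + 1) ∣ j - z' - 2 ^ n := by
      have := dvd_sub hj.add_self (dvd_refl ((2 : ℤ) ^ (n + 1)))
      rwa [show j - z' + 2 ^ n - (2 : ℤ) ^ (n + 1) = j - z' - 2 ^ n by rw [hp1]; ring] at this
    have hjk : j = z' + 2 ^ n + k * 2 ^ (n + 1) := by linarith
    rw [hcH _ 0, hk, hp, mul_comm 2, mul_dvd_mul_iff_left (by positivity), hjk]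
    exact halt k
  · obtain ⟨k, hk⟩ := hj
    have hjk : j = z' + 2 ^ n + (k - 1) * 2 ^ (n + 1) + 2 ^ n := by
      rw [hp1] at hk ⊢; linarith
    have hd : (2 : ℤ) ^ (n + 2) ∣ j - z' ↔ 2 ∣ k := by
      rw [hk, hp, mul_comm 2, mul_dvd_mul_iff_left (by positivity)]
    simp only [hd]
    rw [hjk, (hs.alternate h hi (hlev _)).1, hcH _ 0]
    congr 1
    rw [Bool.eq_iff_iff, halt, decide_eq_true_iff]; omega

theorem lev_congr {l : ℕ} {a b : ℤ} (h : (2 : ℤ) ^ (l + 1) ∣ a - b) : Lev l a ↔ Lev l b := by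
  have h' : (2 : ℤ) ^ l ∣ a - b := (pow_dvd_pow 2 (by omega)).trans h
  unfold Lev
  rw [(Int.dvd_iff_dvd_of_dvd_sub h), (Int.dvd_iff_dvd_of_dvd_sub h')]

theorem HStr.congr {x' z' : ℤ} (hs : HStr y n x z) (hx : (2 : ℤ) ^ (n + 1) ∣ x' - x)
    (hz : (2 : ℤ) ^ (n + 1) ∣ z' - z) : HStr y n x' z' := by
  have hx' : ∀ i, (2 : ℤ) ^ (n + 1) ∣ (i - x') - (i - x) := fun i => by
    rw [sub_sub_sub_cancel_left]; exact (dvd_sub_comm.1 hx)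
  have hz' : ∀ i, (2 : ℤ) ^ (n + 1) ∣ (i - z') - (i - z) := fun i => by
    rw [sub_sub_sub_cancel_left]; exact (dvd_sub_comm.1 hz)
  have hl : ∀ l < n + 2, ∀ i, (2 : ℤ) ^ l ∣ i - x' ↔ (2 : ℤ) ^ l ∣ i - x := fun l hl i =>
    Int.dvd_iff_dvd_of_dvd_sub ((pow_dvd_pow 2 (by omega)).trans (hx' i))
  have hlx : ∀ l < n, ∀ i, Lev l (i - x') ↔ Lev l (i - x) := fun l hl i =>
    lev_congr ((pow_dvd_pow 2 (by omega)).trans (hx' i))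
  have hlz : ∀ l < n, ∀ i, Lev l (i - z') ↔ Lev l (i - z) := fun l hl i =>
    lev_congr ((pow_dvd_pow 2 (by omega)).trans (hz' i))
  refine ⟨fun i j => ?_, fun l hn i j h1 h2 => ?_, fun l hn i j h1 h2 => ?_, fun l hn i j h1 => ?_⟩
  · rw [hs.par i j]
    have := hl 1 (by omega) i
    rw [pow_one] at this; rw [this]
  · exact hs.E l hn i j ((hlx l hn i).1 h1) ((hlz l hn j).1 h2)
  · rw [hs.C l hn i j ((hlz l hn j).1 h1) ((hl _ (by omega) i).1 h2)]
    simp only [hl (l + 2) (by omega) i]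
  · rw [hs.S l hn i j ((hlx l hn i).1 h1)]
    exact (Int.dvd_iff_dvd_of_dvd_sub (by
      rw [sub_sub_sub_cancel_right]
      exact (pow_dvd_pow 2 (by omega)).trans (hx' i))).symm

theorem Str.succ (hs : Str y n x z) (h : Rule1 y) : ∃ x' z', Str y (n + 1) x' z' := by
  obtain ⟨z', hz, hz1, hz2⟩ := hs.pow_two_step h
  obtain ⟨x', hx, hx1, hx2⟩ := hs.trc.pow_two_step h.trc
  have hv := hs.hv.congr hx hz
  have hh := hs.hh.congr hz hx
  have hLx : ∀ i, Lev n (i - x') ↔ Lev n (i - x) := fun i =>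
    lev_congr (by rw [sub_sub_sub_cancel_left]; exact (dvd_sub_comm.1 hx))
  have hLz : ∀ i, Lev n (i - z') ↔ Lev n (i - z) := fun i =>
    lev_congr (by rw [sub_sub_sub_cancel_left]; exact (dvd_sub_comm.1 hz))
  have hE : ∀ i j, Lev n (i - x') → Lev n (j - z') → (y i j).t = .eq := fun i j h1 h2 =>
    hs.eq_top h ((hLx i).1 h1) ((hLz j).1 h2)
  refine ⟨x', z', ⟨hv.par, fun l hl i j h1 h2 => ?_, fun l hl i j h1 h2 => ?_,
    fun l hl i j h1 => ?_⟩, ⟨hh.par, fun l hl i j h1 h2 => ?_, fun l hl i j h1 h2 => ?_,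
    fun l hl i j h1 => ?_⟩⟩ <;> obtain hl | rfl := Nat.lt_succ_iff_lt_or_eq.1 hl
  · exact hv.E l hl i j h1 h2
  · exact hE i j h1 h2
  · exact hv.C l hl i j h1 h2
  · have := hx2 j i ((hLz j).1 h1) h2
    simp only [SFTEntropy.trc, Sym1.tr] at this
    rw [← Ty.tr_tr (y i j).t, this]; rfl
  · exact hv.S l hl i j h1
  · exact hx1 j i h1
  · exact hh.E l hl i j h1 h2
  · simp [SFTEntropy.trc, Sym1.tr, hE j i h2 h1, Ty.tr]
  · exact hh.C l hl i j h1 h2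
  · have := hz2 j i ((hLx j).1 h1) h2
    simp [SFTEntropy.trc, Sym1.tr, this, Ty.tr]
  · exact hh.S l hl i j h1
  · exact hz1 j i h1

theorem Rule1.exists_str (h : Rule1 y) (n : ℕ) : ∃ x z, Str y n x z := by
  induction n with
  | zero => exact h.str_zero
  | succ n ih => obtain ⟨x, z, hs⟩ := ih; exact hs.succ h

end

/-- The 2-adic level. -/
def lev (a : ℤ) : ℕ := padicValInt 2 a

theorem pow_dvd_iff_le_lev {a : ℤ} (ha : a ≠ 0) (n : ℕ) : (2 : ℤ) ^ n ∣ a ↔ n ≤ lev a := by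
  have := padicValInt_dvd_iff (p := 2) n a
  simp only [ha, false_or] at this
  exact_mod_cast this

theorem lev_spec {a : ℤ} (ha : a ≠ 0) : Lev (lev a) a := by
  simp [Lev, pow_dvd_iff_le_lev ha]

theorem Lev.ne_zero {l : ℕ} {a : ℤ} (h : Lev l a) : a ≠ 0 := by
  rintro rfl; exact h.2 (dvd_zero _)

theorem Lev.lev_eq {l : ℕ} {a : ℤ} (h : Lev l a) : lev a = l := (lev_spec h.ne_zero).unique h

/-- The digit carried by lines of level `l`. -/
def digOf (d : ℕ → Fin 4) : ℕ → Fin 4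
  | 0 => 0
  | l + 1 => d (l / 2)

/-- The line carried by the edge above the site `(a, b)` of the canonical configuration. -/
def lineAt (d : ℕ → Fin 4) (a b : ℤ) : Line :=
  if a = 0 then ⟨true, false, 0, if 0 ≤ b then 0 else 3, decide (b < 0)⟩
  else ⟨decide ((2 : ℤ) ^ (lev a + 2) ∣ a - 2 ^ lev a), decide (lev a % 2 = 1), digOf d (lev a),
    ((b / 2 ^ lev a : ℤ) : ZMod 4) - 1, decide (lev a = 0 ∨ ¬ (2 : ℤ) ∣ b / 2 ^ (lev a - 1))⟩

def tyAt (a b : ℤ) : Ty :=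
  if a = 0 then if b = 0 then .eq else .col false
  else if b = 0 then .row false
  else if lev a = lev b then .eq
  else if lev b < lev a then .col (decide (lev a = lev b + 1))
  else .row (decide (lev b = lev a + 1))

/-- The canonical configuration with digits `d`. -/
def canon (d : ℕ → Fin 4) (a b : ℤ) : Sym1 :=
  ⟨decide (¬ (2 : ℤ) ∣ a), decide (¬ (2 : ℤ) ∣ b), tyAt a b, lineAt d a b, lineAt d b a⟩

theorem tyAt_tr (a b : ℤ) : (tyAt a b).tr = tyAt b a := by
  unfold tyAt
  split_ifs <;> first | rfl | omega

theorem trc_canon (d : ℕ → Fin 4) : trc (canon d) = canon d := by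
  funext a b
  simp [trc, canon, Sym1.tr, tyAt_tr]

theorem lev_eq_zero_iff {a : ℤ} (ha : a ≠ 0) : lev a = 0 ↔ ¬ (2 : ℤ) ∣ a := by
  have := pow_dvd_iff_le_lev ha 1
  rw [pow_one] at this; rw [this]; omega

theorem pred_ediv {m : ℤ} (hm : 0 < m) (b : ℤ) :
    (b - 1) / m = if m ∣ b then b / m - 1 else b / m := by
  split_ifs with h
  · obtain ⟨c, rfl⟩ := h
    rw [Int.mul_ediv_cancel_left _ hm.ne', show m * c - 1 = (m - 1) + m * (c - 1) by ring,
      Int.add_mul_ediv_left _ _ hm.ne', Int.ediv_eq_zero_of_lt (by omega) (by omega)]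
    ring
  · have h1 := Int.emod_add_mul_ediv b m
    have h2 := Int.emod_nonneg b hm.ne'
    have h3 := Int.emod_lt_of_pos b hm
    have h4 : b % m ≠ 0 := fun h0 => h (Int.dvd_of_emod_eq_zero h0)
    conv_lhs => rw [show b - 1 = (b % m - 1) + m * (b / m) by linarith]
    rw [Int.add_mul_ediv_left _ _ hm.ne', Int.ediv_eq_zero_of_lt (by omega) (by omega), zero_add]

theorem zmod4_cases (q : ℤ) : ((q : ZMod 4) = 0 ∧ 4 ∣ q) ∨ ((q : ZMod 4) = 1 ∧ 4 ∣ q - 1) ∨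
    ((q : ZMod 4) = 2 ∧ 2 ∣ q ∧ ¬ 4 ∣ q) ∨ ((q : ZMod 4) = 3 ∧ ¬ 2 ∣ q ∧ ¬ 4 ∣ q - 1) := by
  have h4 : (4 : ZMod 4) = 0 := rfl
  obtain ⟨k, h⟩ : ∃ k, q = 4 * k ∨ q = 4 * k + 1 ∨ q = 4 * k + 2 ∨ q = 4 * k + 3 :=
    ⟨q / 4, by omega⟩
  rcases h with rfl | rfl | rfl | rfl
  · exact .inl ⟨by push_cast; rw [h4]; ring, by omega⟩
  · exact .inr (.inl ⟨by push_cast; rw [h4]; ring, by omega⟩)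
  · exact .inr (.inr (.inl ⟨by push_cast; rw [h4]; ring, by omega, by omega⟩))
  · exact .inr (.inr (.inr ⟨by push_cast; rw [h4]; ring, by omega, by omega⟩))

/-- Data at a multiple `2 ^ l * q`. -/
theorem mul_pow_dvd_iff {l : ℕ} {q : ℤ} :
    ((2 : ℤ) ^ (l + 1) ∣ 2 ^ l * q ↔ 2 ∣ q) ∧ ((2 : ℤ) ^ (l + 2) ∣ 2 ^ l * q ↔ 4 ∣ q) ∧
    ((2 : ℤ) ^ (l + 2) ∣ 2 ^ l * q - 2 ^ l ↔ 4 ∣ q - 1) := by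
  have hp : (2 : ℤ) ^ l ≠ 0 := by positivity
  refine ⟨?_, ?_, ?_⟩
  · rw [pow_succ, mul_dvd_mul_iff_left hp]
  · rw [pow_add, mul_dvd_mul_iff_left hp]; norm_num
  · rw [pow_add, ← mul_sub_one, mul_dvd_mul_iff_left hp]; norm_num

theorem canon_count (d : ℕ → Fin 4) (a b : ℤ) :
    Line.Count (decide (¬ (2 : ℤ) ∣ a)) (lineAt d b a).side (tyAt a b).ev
      (lineAt d a (b - 1)) (lineAt d a b) := by
  by_cases ha : a = 0
  · subst ha
    by_cases hb : b = 0
    · subst hb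
      simp [tyAt, Ty.ev, Line.Count, lineAt]; decide
    · have h1 : (0 ≤ b - 1) ↔ 0 ≤ b := by omega
      have h2 : (b - 1 < 0) ↔ b < 0 := by omega
      simp only [tyAt, hb, if_true, if_false, Ty.ev, Line.Count, lineAt, h1, true_and,
        decide_eq_decide]
      omega
  · have hL := lev_spec ha
    have hpar := lev_eq_zero_iff ha
    simp only [← hpar]
    have hpos : ∀ l : ℕ, (0 : ℤ) < 2 ^ l := fun l => by positivity
    -- the case of a row of level at least that of the column
    have main : ∀ q, b = 2 ^ lev a * q →
        ((b / 2 ^ lev a : ℤ)) = q ∧ (b - 1) / 2 ^ lev a = q - 1 ∧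
        decide (lev a = 0 ∨ ¬ (2 : ℤ) ∣ b / 2 ^ (lev a - 1)) = decide (lev a = 0) ∧
        decide (lev a = 0 ∨ ¬ (2 : ℤ) ∣ (b - 1) / 2 ^ (lev a - 1)) = true := by
      intro q hq
      have e1 : b / 2 ^ lev a = q := by rw [hq, Int.mul_ediv_cancel_left _ (hpos _).ne']
      refine ⟨e1, ?_, ?_⟩
      · rw [pred_ediv (hpos _), if_pos ⟨q, hq⟩, e1]
      · rcases Nat.eq_zero_or_pos (lev a) with h0 | h0
        · simp [h0]
        · obtain ⟨m, hm⟩ : ∃ m, lev a = m + 1 := ⟨lev a - 1, by omega⟩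
          rw [hm] at hq ⊢
          have hq' : b = 2 ^ m * (2 * q) := by rw [hq]; ring
          have e2 : b / 2 ^ m = 2 * q := by rw [hq', Int.mul_ediv_cancel_left _ (hpos _).ne']
          simp only [Nat.add_sub_cancel]
          rw [pred_ediv (hpos _), if_pos ⟨_, hq'⟩, e2]
          simp
    by_cases hb : b = 0
    · subst hb
      obtain ⟨h1, h2, h3, h4⟩ := main 0 (by simp)
      simp only [tyAt, ha, if_true, if_false, Ty.ev, Line.Count, lineAt, h1, h2, h3, h4]
      simp; decide
    · have hLb := lev_spec hb
      rcases lt_trichotomy (lev a) (lev b) with h | h | h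
      · obtain ⟨q, hq⟩ := (pow_dvd_iff_le_lev hb (lev a)).2 h.le
        obtain ⟨h1, h2, h3, h4⟩ := main q hq
        simp only [tyAt, ha, hb, if_false, h.ne, h.not_gt, Ty.ev, Line.Count, lineAt, h1, h2, h3,
          h4]
        have e1 := (pow_dvd_iff_le_lev hb (lev a + 1)).2 h
        have e2 := pow_dvd_iff_le_lev hb (lev a + 2)
        have hd := mul_pow_dvd_iff (l := lev a) (q := q)
        rw [← hq] at hd
        rw [hd.1] at e1
        rw [hd.2.1] at e2
        have e3 : lev b = lev a + 1 ↔ ¬ 4 ∣ q := by rw [e2]; omega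
        simp only [e3]
        rcases zmod4_cases q with ⟨e, e'⟩ | ⟨e, e'⟩ | ⟨e, e', e''⟩ | ⟨e, e', e''⟩
        · simp [e, e']; decide
        · omega
        · simp [e, e'']; decide
        · omega
      · obtain ⟨q, hq⟩ := (pow_dvd_iff_le_lev hb (lev a)).2 h.le
        obtain ⟨h1, h2, h3, h4⟩ := main q hq
        simp only [tyAt, ha, hb, if_false, h, if_true, Ty.ev, Line.Count, lineAt]
        rw [← h]
        simp only [h1, h2, h3, h4]
        have e1 := (pow_dvd_iff_le_lev hb (lev a + 1)).not.2 (by omega)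
        have hd := mul_pow_dvd_iff (l := lev a) (q := q)
        rw [← hq] at hd
        rw [hd.1] at e1
        simp only [hd.2.2]
        rcases zmod4_cases q with ⟨e, e'⟩ | ⟨e, e'⟩ | ⟨e, e', e''⟩ | ⟨e, e', e''⟩
        · omega
        · simp [e, e']
        · omega
        · simp [e, e'']; decide
      · have e1 : ¬ (2 : ℤ) ^ lev a ∣ b := (pow_dvd_iff_le_lev hb _).not.2 (by omega)
        have h0 : lev a ≠ 0 := by omega
        have e2 : (b - 1) / 2 ^ lev a = b / 2 ^ lev a := by rw [pred_ediv (hpos _), if_neg e1]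
        simp only [tyAt, ha, hb, if_false, h.ne', h, if_true, Ty.ev, lineAt, e2, h0, false_or]
        by_cases h1 : lev a = lev b + 1
        · obtain ⟨q, hq⟩ := hLb.1
          have hd := mul_pow_dvd_iff (l := lev b) (q := q)
          rw [← hq] at hd
          have hq2 : ¬ 2 ∣ q := by rw [← hd.1]; exact hLb.2
          have e3 : b / 2 ^ lev b = q := by
            exact Int.ediv_eq_of_eq_mul_right (hpos _).ne' hq
          simp only [h1, Nat.add_sub_cancel, decide_true, Line.Count, true_and]
          rw [pred_ediv (hpos _), if_pos hLb.1, e3]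
          simp; omega
        · have e4 : ¬ (2 : ℤ) ^ (lev a - 1) ∣ b := (pow_dvd_iff_le_lev hb _).not.2 (by omega)
          simp only [h1, decide_false, Line.Count, true_and]
          rw [pred_ediv (hpos _), if_neg e4]

theorem canon_half (d : ℕ → Fin 4) (a b : ℤ) :
    Half (canon d a b) (canon d (a + 1) b) (canon d a (b + 1)) where
  px_r := by simp [canon]; rw [← decide_not, decide_eq_decide]; omega
  px_u := rfl
  same := by simp only [canon, lineAt]; split_ifs <;> exact ⟨rfl, rfl, rfl⟩
  count := by
    have := canon_count d a (b + 1)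
    rwa [add_sub_cancel_right] at this
  red0 h := by
    have h : ¬ (2 : ℤ) ∣ a := by simpa [canon] using h
    have ha : a ≠ 0 := by rintro rfl; simp at h
    simp [canon, lineAt, ha, (lev_eq_zero_iff ha).2 h, digOf]
  odd_odd h h' := by
    have h : ¬ (2 : ℤ) ∣ a := by simpa [canon] using h
    have h' : ¬ (2 : ℤ) ∣ b := by simpa [canon] using h'
    have ha : a ≠ 0 := by rintro rfl; simp at h
    have hb : b ≠ 0 := by rintro rfl; simp at h'
    simp [canon, tyAt, ha, hb, (lev_eq_zero_iff ha).2 h, (lev_eq_zero_iff hb).2 h']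
  odd_even h h' := by
    have h : ¬ (2 : ℤ) ∣ a := by simpa [canon] using h
    have h' : (2 : ℤ) ∣ b := by simpa [canon] using h'
    have ha : a ≠ 0 := by rintro rfl; simp at h
    by_cases hb : b = 0
    · exact ⟨false, by simp [canon, tyAt, ha, hb]⟩
    · have := (lev_eq_zero_iff hb).not.2 (not_not.2 h')
      exact ⟨_, by simp [canon, tyAt, ha, hb, (lev_eq_zero_iff ha).2 h, Ne.symm this]; rfl⟩
  eq_pair h := by
    simp only [canon, tyAt] at h
    split_ifs at h with h1 h2 h3 h4
    · simp [canon, lineAt, h1, h2]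
    · simp [canon, lineAt, h1, h3, h4]
  col_pair h := by
    simp only [canon, tyAt] at h
    split_ifs at h with h1 h2 h3 h4 h5
    · simp at h
    · simp only [Ty.col.injEq, decide_eq_true_eq] at h
      simp only [canon, lineAt, h1, h3, if_false, h]
      have : (lev b + 1) % 2 = 1 ↔ ¬ lev b % 2 = 1 := by omega
      refine ⟨by rw [← decide_not, decide_eq_decide]; omega, fun h' => ?_⟩
      have h' : lev b % 2 = 1 := by simpa using h'
      obtain ⟨m, hm⟩ : ∃ m, lev b = m + 1 := ⟨lev b - 1, by omega⟩
      rw [hm, digOf, digOf]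
      congr 1; omega

theorem rule1_canon (d : ℕ → Fin 4) : Rule1 (canon d) := by
  intro a b
  refine ⟨canon_half d a b, ?_⟩
  have : ∀ a b, (canon d a b).tr = canon d b a := fun a b => congrFun₂ (trc_canon d) b a
  rw [this, this, this]
  exact canon_half d b a

section
variable {y : ℤ → ℤ → Sym1} {n : ℕ} {x z : ℤ}

theorem HStr.mono {m : ℕ} (hs : HStr y n x z) (hm : m ≤ n) : HStr y m x z :=
  ⟨hs.par, fun l hl => hs.E l (by omega), fun l hl => hs.C l (by omega),
    fun l hl => hs.S l (by omega)⟩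

theorem Str.mono {m : ℕ} (hs : Str y n x z) (hm : m ≤ n) : Str y m x z :=
  ⟨hs.hv.mono hm, hs.hh.mono hm⟩

theorem Str.row (hs : Str y n x z) {l : ℕ} (hl : l < n) {i j : ℤ} (hi : Lev l (i - x))
    (hj : (2 : ℤ) ^ (l + 1) ∣ j - z) :
    (y i j).t = .row (decide (¬ (2 : ℤ) ^ (l + 2) ∣ j - z)) := by
  have := hs.hh.C l hl j i hi hj
  simp only [SFTEntropy.trc, Sym1.tr] at this
  rw [← Ty.tr_tr (y i j).t, this]; rfl

/-- The counters of a column of level `l` just above a multiple of `2 ^ l`. -/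
theorem Str.count_mul (hs : Str y n x z) (h : Rule1 y) {l : ℕ} (hl : l < n) {i j q : ℤ}
    (hi : Lev l (i - x)) (hj : j - z = 2 ^ l * q) :
    (y i j).V.r = (q : ZMod 4) - 1 ∧ (y i j).V.u = decide (l = 0) := by
  have hp : (y i j).pX = decide (l = 0) := by
    have := hs.hv.par i j
    rw [← lev_eq_zero_iff hi.ne_zero, hi.lev_eq] at this
    rw [Bool.eq_iff_iff, this, decide_eq_true_iff]
  have hd := mul_pow_dvd_iff (l := l) (q := q)
  rw [← hj] at hd
  have hc := (h i (j - 1)).1.count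
  rw [sub_add_cancel, hp] at hc
  by_cases h2 : 2 ∣ q
  · rw [hs.row hl hi (hd.1.2 h2)] at hc
    refine ⟨hc.1.trans ?_, hc.2.2.2⟩
    simp only [hd.2.1]
    rcases zmod4_cases q with ⟨e, e'⟩ | ⟨e, e'⟩ | ⟨e, e', e''⟩ | ⟨e, e', e''⟩
    · simp [e, e']; decide
    · omega
    · simp [e, e'']; decide
    · omega
  · have hjl : Lev l (j - z) := ⟨⟨q, hj⟩, fun h' => h2 (hd.1.1 h')⟩
    rw [hs.hv.E l hl i j hi hjl] at hc
    refine ⟨hc.1.trans ?_, hc.2.2.2⟩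
    have hS := hs.hh.S l hl j i hjl
    rw [hd.2.2] at hS
    simp only [SFTEntropy.trc, Sym1.tr] at hS
    simp only [hS]
    rcases zmod4_cases q with ⟨e, e'⟩ | ⟨e, e'⟩ | ⟨e, e', e''⟩ | ⟨e, e', e''⟩
    · omega
    · simp [e, e']
    · omega
    · simp [e, e'']; decide

theorem Str.count_r (hs : Str y n x z) (h : Rule1 y) {l : ℕ} (hl : l < n) {i j : ℤ}
    (hi : Lev l (i - x)) : (y i j).V.r = (((j - z) / 2 ^ l : ℤ) : ZMod 4) - 1 := by
  have hpos : (0 : ℤ) < 2 ^ l := by positivity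
  have h1 := Int.emod_add_mul_ediv (j - z) (2 ^ l)
  have h2 := Int.emod_nonneg (j - z) hpos.ne'
  have h3 := Int.emod_lt_of_pos (j - z) hpos
  obtain ⟨s, hs'⟩ := Int.eq_ofNat_of_zero_le h2
  set q := (j - z) / 2 ^ l
  have hj : j = z + 2 ^ l * q + s := by linarith
  have h4 : s < 2 ^ l := by zify; omega
  rw [hj, (hs.mono hl.le).walk_r h hi.1 ⟨q, by ring⟩ h4,
    (hs.count_mul h hl hi (q := q) (by ring)).1]

theorem Str.count_u (hs : Str y n x z) (h : Rule1 y) {l : ℕ} (hl : l < n) {i j : ℤ}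
    (hi : Lev l (i - x)) :
    (y i j).V.u = decide (l = 0 ∨ ¬ (2 : ℤ) ∣ (j - z) / 2 ^ (l - 1)) := by
  cases l with
  | zero => simpa using (hs.count_mul h hl hi (q := j - z) (by ring)).2
  | succ m =>
    have hpos : (0 : ℤ) < 2 ^ m := by positivity
    have h1 := Int.emod_add_mul_ediv (j - z) (2 ^ m)
    have h2 := Int.emod_nonneg (j - z) hpos.ne'
    have h3 := Int.emod_lt_of_pos (j - z) hpos
    obtain ⟨s, hs'⟩ := Int.eq_ofNat_of_zero_le h2
    simp only [Nat.add_sub_cancel, Nat.succ_ne_zero, false_or]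
    set q := (j - z) / 2 ^ m
    have hj : j = z + 2 ^ m * q + s := by linarith
    have h4 : s < 2 ^ m := by zify; omega
    rw [hj, (hs.mono hl.le).walk_u h hi.1 ⟨q, by ring⟩ h4]
    have hd := mul_pow_dvd_iff (l := m) (q := q)
    by_cases hq : 2 ∣ q
    · obtain ⟨e, he⟩ := hq
      rw [(hs.count_mul h hl hi (q := e) (by rw [he]; ring)).2]
      simp; omega
    · have hL : Lev m (z + 2 ^ m * q - z) := by
        rw [add_sub_cancel_left]; exact ⟨⟨q, rfl⟩, by rwa [hd.1]⟩
      have hc := (h i (z + 2 ^ m * q - 1)).1.count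
      rw [sub_add_cancel, hs.hv.C m (by omega) i _ hL hi.1,
        show decide (¬ (2 : ℤ) ^ (m + 2) ∣ i - x) = true by simpa using hi.2] at hc
      rw [hc.2.2]; simpa using hq

theorem Rule1.sameH (h : Rule1 y) (i i' j : ℤ) : Line.Same (y i j).H (y i' j).H :=
  h.trc.same j i i'

theorem lev_pow_self (l : ℕ) (x : ℤ) : Lev l (x + 2 ^ l - x) := by
  simpa using lev_add_of_dvd (l := l) (dvd_zero _)

theorem Str.color (hs : Str y n x z) (h : Rule1 y) {l : ℕ} (hl : l < n) :
    (∀ i j, Lev l (i - x) → (y i j).V.red = decide (l % 2 = 1) ∧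
      (y i j).V.dig = (y (x + 2 ^ l) z).V.dig) ∧
    (∀ i j, Lev l (j - z) → (y i j).H.red = decide (l % 2 = 1) ∧
      (y i j).H.dig = (y (x + 2 ^ l) z).V.dig) := by
  have hV : ∀ i j, Lev l (i - x) → (y i j).V.red = (y (x + 2 ^ l) z).V.red ∧
      (y i j).V.dig = (y (x + 2 ^ l) z).V.dig := by
    intro i j hi
    have e1 := (h i (z + 2 ^ l)).1.eq_pair (hs.hv.E l hl _ _ hi (lev_pow_self l z))
    have e2 := (h (x + 2 ^ l) (z + 2 ^ l)).1.eq_pair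
      (hs.hv.E l hl _ _ (lev_pow_self l x) (lev_pow_self l z))
    have s1 := h.same i j (z + 2 ^ l)
    have s2 := h.same (x + 2 ^ l) z (z + 2 ^ l)
    have s3 := h.sameH i (x + 2 ^ l) (z + 2 ^ l)
    exact ⟨by rw [← s1.red, e1.1, ← s3.red, ← e2.1, s2.red],
      by rw [← s1.dig, e1.2, ← s3.dig, ← e2.2, s2.dig]⟩
  have hH : ∀ i j, Lev l (j - z) → (y i j).H.red = (y (x + 2 ^ l) z).V.red ∧
      (y i j).H.dig = (y (x + 2 ^ l) z).V.dig := by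
    intro i j hj
    have e1 := (h (x + 2 ^ l) j).1.eq_pair (hs.hv.E l hl _ _ (lev_pow_self l x) hj)
    have s3 := h.sameH i (x + 2 ^ l) j
    have s1 := h.same (x + 2 ^ l) j z
    exact ⟨by rw [← s3.red, ← e1.1, s1.red], by rw [← s3.dig, ← e1.2, s1.dig]⟩
  have hred : (y (x + 2 ^ l) z).V.red = decide (l % 2 = 1) := by
    clear hV hH
    induction l with
    | zero =>
      have : (y (x + 2 ^ 0) z).pX = true := by rw [hs.hv.par]; simp
      simpa using ((h _ _).1.red0 this).1
    | succ l ih =>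
      have hc := hs.hv.C l (by omega) (x + 2 ^ (l + 1)) (z + 2 ^ l) (lev_pow_self l z) (by simp)
      rw [show decide (¬ (2 : ℤ) ^ (l + 2) ∣ x + 2 ^ (l + 1) - x) = true by
        simpa using (lev_pow_self (l + 1) x).2] at hc
      have e1 := ((h (x + 2 ^ (l + 1)) (z + 2 ^ l)).1.col_pair hc).1
      have e2 := (h (x + 2 ^ l) (z + 2 ^ l)).1.eq_pair
        (hs.hv.E l (by omega) _ _ (lev_pow_self l x) (lev_pow_self l z))
      have s1 := (h.same (x + 2 ^ l) z (z + 2 ^ l)).red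
      have s2 := (h.same (x + 2 ^ (l + 1)) z (z + 2 ^ l)).red
      have s3 := (h.sameH (x + 2 ^ l) (x + 2 ^ (l + 1)) (z + 2 ^ l)).red
      rw [← s2]
      have : (y (x + 2 ^ (l + 1)) (z + 2 ^ l)).V.red =
          !(y (x + 2 ^ (l + 1)) (z + 2 ^ l)).H.red := by
        rw [e1]; simp
      rw [this, s3, ← e2.1, s1, ih (by omega), ← decide_not, decide_eq_decide]
      omega
  exact ⟨fun i j hi => by rw [← hred]; exact hV i j hi,
    fun i j hi => by rw [← hred]; exact hH i j hi⟩

/-- The digits carried by the lines of odd level. -/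
def digits (y : ℤ → ℤ → Sym1) (x z : ℤ) (t : ℕ) : Fin 4 := (y (x + 2 ^ (2 * t + 1)) z).V.dig

theorem Str.dig_eq (hs : Str y n x z) (h : Rule1 y) {l : ℕ} (hl : l < n) :
    (y (x + 2 ^ l) z).V.dig = digOf (digits y x z) l := by
  rcases l with _ | l
  · have : (y (x + 2 ^ 0) z).pX = true := by rw [hs.hv.par]; simp
    exact ((h _ _).1.red0 this).2
  · rcases Nat.even_or_odd' l with ⟨m, rfl | rfl⟩
    · simp [digOf, digits]
    · have e : (2 * m + 1) / 2 = m := by omega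
      rw [digOf, e, digits]
      have hc := hs.hv.C (2 * m + 1) (by omega) (x + 2 ^ (2 * m + 1 + 1)) (z + 2 ^ (2 * m + 1))
        (lev_pow_self _ z) (by simp)
      rw [show decide (¬ (2 : ℤ) ^ (2 * m + 1 + 2) ∣ x + 2 ^ (2 * m + 1 + 1) - x) = true by
        simpa using (lev_pow_self (2 * m + 1 + 1) x).2] at hc
      have e1 := ((h _ _).1.col_pair hc).2
      have e2 := (hs.color h (l := 2 * m + 1) (by omega)).2 (x + 2 ^ (2 * m + 1 + 1))
        (z + 2 ^ (2 * m + 1)) (lev_pow_self _ z)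
      rw [← e2.2, e1 (by rw [e2.1]; simp)]
      exact (h.same _ _ z).dig

theorem Str.lineV (hs : Str y n x z) (h : Rule1 y) {i j : ℤ} (hi : ¬ (2 : ℤ) ^ n ∣ i - x) :
    (y i j).V = lineAt (digits y x z) (i - x) (j - z) := by
  obtain ⟨l, hl, hL⟩ := exists_lev hi
  have hc := (hs.color h hl).1 i j hL
  have h1 := hs.count_r h hl (j := j) hL
  have h2 := hs.count_u h hl (j := j) hL
  have h3 := hs.hv.S l hl i j hL
  rw [hs.dig_eq h hl] at hc
  simp only [lineAt, hL.ne_zero, if_false, hL.lev_eq]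
  have h3' : (y i j).V.side = decide ((2 : ℤ) ^ (l + 2) ∣ i - x - 2 ^ l) := by
    rw [Bool.eq_iff_iff, h3, decide_eq_true_iff]
  rw [← h1, ← h2, ← hc.1, ← hc.2, ← h3']

theorem Str.digits_trc (hs : Str y n x z) (h : Rule1 y) {l : ℕ} (hl : l < n) :
    digOf (digits (SFTEntropy.trc y) z x) l = digOf (digits y x z) l := by
  rw [← hs.trc.dig_eq h.trc hl, ← hs.dig_eq h hl]
  have := (hs.color h hl).2 x (z + 2 ^ l) (lev_pow_self l z)
  simpa [SFTEntropy.trc, Sym1.tr] using this.2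

theorem Str.lineH (hs : Str y n x z) (h : Rule1 y) {i j : ℤ} (hj : ¬ (2 : ℤ) ^ n ∣ j - z) :
    (y i j).H = lineAt (digits y x z) (j - z) (i - x) := by
  obtain ⟨l, hl, hL⟩ := exists_lev hj
  have := hs.trc.lineV h.trc (i := j) (j := i) hj
  simp only [SFTEntropy.trc, Sym1.tr] at this
  rw [this]
  simp only [lineAt, hL.ne_zero, if_false, hL.lev_eq, hs.digits_trc h hl]

theorem Str.ty (hs : Str y n x z) {i j : ℤ} (hi : ¬ (2 : ℤ) ^ n ∣ i - x)
    (hj : ¬ (2 : ℤ) ^ n ∣ j - z) : (y i j).t = tyAt (i - x) (j - z) := by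
  obtain ⟨l, hl, hL⟩ := exists_lev hi
  obtain ⟨m, hm, hM⟩ := exists_lev hj
  simp only [tyAt, hL.ne_zero, hM.ne_zero, if_false, hL.lev_eq, hM.lev_eq]
  split_ifs with h1 h2
  · subst h1; exact hs.hv.E l hl i j hL hM
  · have : (2 : ℤ) ^ (m + 1) ∣ i - x := (pow_dvd_pow 2 h2).trans hL.1
    rw [hs.hv.C m hm i j hM this]
    congr 1
    rw [decide_eq_decide, pow_dvd_iff_le_lev hL.ne_zero, hL.lev_eq]; omega
  · have : (2 : ℤ) ^ (l + 1) ∣ j - z := (pow_dvd_pow 2 (by omega)).trans hM.1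
    rw [hs.row hl hL this]
    congr 1
    rw [decide_eq_decide, pow_dvd_iff_le_lev hM.ne_zero, hM.lev_eq]; omega

/-- Away from lines of high level, configurations are forced to be canonical. -/
theorem Str.eq_canon (hs : Str y n x z) (h : Rule1 y) {i j : ℤ} (hi : ¬ (2 : ℤ) ^ n ∣ i - x)
    (hj : ¬ (2 : ℤ) ^ n ∣ j - z) : y i j = canon (digits y x z) (i - x) (j - z) := by
  have h1 := hs.lineV h (j := j) hi
  have h2 := hs.lineH h (i := i) hj
  have h3 := hs.ty hi hj
  have h4 := hs.hv.par i j
  have h5 := hs.hh.par j i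
  simp only [SFTEntropy.trc, Sym1.tr] at h5
  have h4' : (y i j).pX = decide (¬ (2 : ℤ) ∣ i - x) := by
    rw [Bool.eq_iff_iff, h4, decide_eq_true_iff]
  have h5' : (y i j).pY = decide (¬ (2 : ℤ) ∣ j - z) := by
    rw [Bool.eq_iff_iff, h5, decide_eq_true_iff]
  unfold canon
  rw [← h1, ← h2, ← h3, ← h4', ← h5']

end

/-- The distance from the origin to the walls of level `t`. -/
def W (t : ℕ) : ℤ := 2 ^ (2 * t + 1)

theorem W_pos (t : ℕ) : 0 < W t := by unfold W; positivity

theorem W_two_le (t : ℕ) : 2 ≤ W t := by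
  unfold W; rw [pow_succ]; linarith [one_le_pow₀ (a := (2 : ℤ)) (by norm_num) (n := 2 * t)]

theorem W_dvd {s t : ℕ} (h : s < t) : 4 * W s ∣ W t := by
  unfold W
  rw [show (4 : ℤ) = 2 ^ 2 by norm_num, ← pow_add]
  exact pow_dvd_pow 2 (by omega)

/-- `a` lies in the range of a board of level `t`. -/
def Rng (t : ℕ) (a : ℤ) : Prop := W t ≤ a % (4 * W t) ∧ a % (4 * W t) ≤ 3 * W t

theorem emod_succ {M a : ℤ} (hM : 0 < M) (h : a % M + 1 < M) :
    (a + 1) % M = a % M + 1 ∧ (a + 1) / M = a / M := by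
  have h0 : 0 ≤ a % M := Int.emod_nonneg a hM.ne'
  have h1 := Int.emod_add_mul_ediv a M
  have h2 : (a + 1) / M = a / M := by
    conv_lhs => rw [show a + 1 = (a % M + 1) + M * (a / M) by linarith]
    rw [Int.add_mul_ediv_left _ _ hM.ne', Int.ediv_eq_zero_of_lt (by omega) h, zero_add]
  have h3 := Int.emod_add_mul_ediv (a + 1) M
  rw [h2] at h3
  exact ⟨by linarith, h2⟩

theorem emod_pred {M a : ℤ} (hM : 0 < M) (h : 0 < a % M) :
    (a - 1) % M = a % M - 1 ∧ (a - 1) / M = a / M := by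
  have h1 := Int.emod_lt_of_pos a hM
  have h2 := Int.emod_add_mul_ediv a M
  have h4 : (a - 1) / M = a / M := by
    conv_lhs => rw [show a - 1 = (a % M - 1) + M * (a / M) by linarith]
    rw [Int.add_mul_ediv_left _ _ hM.ne', Int.ediv_eq_zero_of_lt (by omega) (by omega), zero_add]
  have h3 := Int.emod_add_mul_ediv (a - 1) M
  rw [h4] at h3
  exact ⟨by linarith, h4⟩

/-- No multiple of `4 * W t` lies in the range of a board of level `t`. -/
theorem not_rng_of_dvd {t : ℕ} {a : ℤ} (h : 4 * W t ∣ a) : ¬ Rng t a := by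
  intro hr
  have := Int.emod_eq_zero_of_dvd h
  have h1 := W_pos t
  unfold Rng at hr; omega

theorem W_dvd_of_emod {t : ℕ} {a : ℤ} (h : a % (4 * W t) = W t ∨ a % (4 * W t) = 3 * W t) :
    W t ∣ a := by
  have := Int.emod_add_mul_ediv a (4 * W t)
  rcases h with h | h <;> rw [h] at this
  · exact ⟨1 + 4 * (a / (4 * W t)), by linarith⟩
  · exact ⟨3 + 4 * (a / (4 * W t)), by linarith⟩

theorem rng_of_emod {t : ℕ} {a : ℤ} (h : a % (4 * W t) = W t ∨ a % (4 * W t) = 3 * W t) :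
    Rng t a := by
  have := W_pos t
  unfold Rng; omega

open scoped Classical in
/-- The wall of the canonical configuration on the column `a` at height `b`. -/
noncomputable def wall (a b : ℤ) : Option Bool :=
  if ∃ t, a % (4 * W t) = W t ∧ Rng t b then some true
  else if ∃ t, a % (4 * W t) = 3 * W t ∧ Rng t b then some false
  else none

theorem wall_level_unique {s t : ℕ} {a : ℤ} (hs : a % (4 * W s) = W s ∨ a % (4 * W s) = 3 * W s)
    (ht : a % (4 * W t) = W t ∨ a % (4 * W t) = 3 * W t) : s = t := by
  rcases lt_trichotomy s t with h | h | h
  · exact absurd (rng_of_emod hs) (not_rng_of_dvd ((W_dvd h).trans (W_dvd_of_emod ht)))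
  · exact h
  · exact absurd (rng_of_emod ht) (not_rng_of_dvd ((W_dvd h).trans (W_dvd_of_emod hs)))

theorem wall_eq_true {a b : ℤ} : wall a b = some true ↔ ∃ t, a % (4 * W t) = W t ∧ Rng t b := by
  unfold wall
  split_ifs with h1 h2 <;> simp [h1]

theorem wall_eq_false {a b : ℤ} :
    wall a b = some false ↔ ∃ t, a % (4 * W t) = 3 * W t ∧ Rng t b := by
  unfold wall
  split_ifs with h1 h2
  · refine iff_of_false (by simp) ?_
    rintro ⟨t, ht, -⟩
    obtain ⟨s, hs, -⟩ := h1
    obtain rfl := wall_level_unique (.inl hs) (.inr ht)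
    have := W_pos s
    omega
  · simpa using h2
  · simpa using h2

theorem wall_eq_none {a b : ℤ} : wall a b = none ↔
    ∀ t, (a % (4 * W t) = W t ∨ a % (4 * W t) = 3 * W t) → ¬ Rng t b := by
  have h1 := @wall_eq_true a b
  have h2 := @wall_eq_false a b
  constructor
  · intro h t ht hr
    rw [h] at h1 h2
    rcases ht with ht | ht
    · exact absurd (h1.2 ⟨t, ht, hr⟩) (by simp)
    · exact absurd (h2.2 ⟨t, ht, hr⟩) (by simp)
  · intro h
    cases hw : wall a b with
    | none => rfl
    | some c =>
      rw [hw] at h1 h2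
      cases c
      · obtain ⟨t, ht, hr⟩ := h2.1 rfl
        exact absurd hr (h t (.inr ht))
      · obtain ⟨t, ht, hr⟩ := h1.1 rfl
        exact absurd hr (h t (.inl ht))

/-- The row `b` is free for boards of level `k`: it meets no smaller board. -/
def FreeLine (k : ℕ) (b : ℤ) : Prop := ∀ t < k, ¬ Rng t b

/-- The edge to the right of `(a, b)` lies in a free row of a board of level `k`. -/
structure FreeRow (k : ℕ) (a b : ℤ) : Prop where
  le : W k ≤ a % (4 * W k)
  lt : a % (4 * W k) < 3 * W k
  lo : W k < b % (4 * W k)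
  hi : b % (4 * W k) < 3 * W k
  free : FreeLine k b

theorem FreeRow.rng {k : ℕ} {a b : ℤ} (h : FreeRow k a b) : Rng k b := ⟨h.lo.le, h.hi.le⟩

theorem FreeRow.unique {k m : ℕ} {a b a' : ℤ} (h : FreeRow k a b) (h' : FreeRow m a' b) :
    k = m := by
  rcases lt_trichotomy k m with hh | hh | hh
  · exact absurd h.rng (h'.free k hh)
  · exact hh
  · exact absurd h'.rng (h.free m hh)

/-- Walking inside a range: a number strictly inside is not a multiple of `W`. -/
theorem wall_level_le {k t : ℕ} {a : ℤ} (hk : Rng k a)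
    (ht : a % (4 * W t) = W t ∨ a % (4 * W t) = 3 * W t) : t ≤ k := by
  by_contra h
  exact not_rng_of_dvd ((W_dvd (by omega)).trans (W_dvd_of_emod ht)) hk

theorem wall_emod_iff {k : ℕ} {a : ℤ} (h1 : W k < a % (4 * W k)) (h2 : a % (4 * W k) < 3 * W k)
    {t : ℕ} (ht : a % (4 * W t) = W t ∨ a % (4 * W t) = 3 * W t) : t < k := by
  rcases (wall_level_le ⟨h1.le, h2.le⟩ ht).lt_or_eq with h | rfl
  · exact h
  · omega

/-- In a free row there are no vertical walls strictly inside the board. -/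
theorem FreeRow.wall_none {k : ℕ} {a b : ℤ} (h : FreeRow k a b) (h1 : W k < a % (4 * W k)) :
    wall a b = none :=
  wall_eq_none.2 fun t ht => h.free t (wall_emod_iff h1 h.lt ht)

/-- In a free row there are no horizontal walls. -/
theorem FreeRow.hwall_none {k : ℕ} {a b : ℤ} (h : FreeRow k a b) (a' : ℤ) : wall b a' = none :=
  wall_eq_none.2 fun t ht => absurd (rng_of_emod ht) (h.free t (wall_emod_iff h.lo h.hi ht))

/-- The last wall at or before `(a, b)` is a left wall. -/
def InL (a b : ℤ) : Prop := ∃ a' ≤ a, wall a' b = some true ∧ ∀ c, a' < c → c ≤ a → wall c b = none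

/-- The first wall after `(a, b)` is a right wall. -/
def InR (a b : ℤ) : Prop := ∃ a' > a, wall a' b = some false ∧ ∀ c, a < c → c < a' → wall c b = none

theorem inL_iff (a b : ℤ) : InL a b ↔ wall a b = some true ∨ wall a b = none ∧ InL (a - 1) b := by
  constructor
  · rintro ⟨a', h1, h2, h3⟩
    rcases h1.lt_or_eq with h | rfl
    · exact .inr ⟨h3 a h le_rfl, a', by omega, h2, fun c hc hc' => h3 c hc (by omega)⟩
    · exact .inl h2
  · rintro (h | ⟨h, a', h1, h2, h3⟩)
    · exact ⟨a, le_rfl, h, fun c _ _ => by omega⟩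
    · refine ⟨a', by omega, h2, fun c hc hc' => ?_⟩
      rcases hc'.lt_or_eq with h' | rfl
      · exact h3 c hc (by omega)
      · exact h

theorem inR_iff (a b : ℤ) :
    InR (a - 1) b ↔ wall a b = some false ∨ wall a b = none ∧ InR a b := by
  constructor
  · rintro ⟨a', h1, h2, h3⟩
    rcases (show a ≤ a' by omega).lt_or_eq with h | rfl
    · exact .inr ⟨h3 a (by omega) h, a', h, h2, fun c hc hc' => h3 c (by omega) hc'⟩
    · exact .inl h2
  · rintro (h | ⟨h, a', h1, h2, h3⟩)
    · exact ⟨a, by omega, h, fun c _ _ => by omega⟩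
    · refine ⟨a', by omega, h2, fun c hc hc' => ?_⟩
      rcases (show a ≤ c by omega).lt_or_eq with h' | rfl
      · exact h3 c h' hc'
      · exact h

theorem emod_of_eq {M q r : ℤ} (h0 : 0 ≤ r) (h1 : r < M) : (M * q + r) % M = r := by
  rw [add_comm, Int.add_mul_emod_self_left, Int.emod_eq_of_lt h0 h1]

theorem FreeRow.inside {k : ℕ} {a b : ℤ} (h : FreeRow k a b) : InL a b ∧ InR a b := by
  have hW := W_pos k
  have e := Int.emod_add_mul_ediv a (4 * W k)
  have h1 := h.le
  have h2 := h.lt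
  set q := a / (4 * W k)
  have hwn : ∀ r, W k < r → r < 3 * W k → wall (4 * W k * q + r) b = none := by
    intro r hr hr'
    have e' : (4 * W k * q + r) % (4 * W k) = r := emod_of_eq (by omega) (by omega)
    exact wall_eq_none.2 fun t ht =>
      h.free t (wall_emod_iff (by rw [e']; exact hr) (by rw [e']; exact hr') ht)
  refine ⟨⟨4 * W k * q + W k, by linarith, wall_eq_true.2 ⟨k, emod_of_eq (by omega) (by omega),
    h.rng⟩, fun c hc hc' => ?_⟩, ⟨4 * W k * q + 3 * W k, by linarith,
    wall_eq_false.2 ⟨k, emod_of_eq (by omega) (by omega), h.rng⟩, fun c hc hc' => ?_⟩⟩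
  · have := hwn (c - 4 * W k * q) (by linarith) (by linarith)
    rwa [add_sub_cancel] at this
  · have := hwn (c - 4 * W k * q) (by linarith) (by linarith)
    rwa [add_sub_cancel] at this

theorem no_dvd_between {M a q : ℤ} (hd : M ∣ a) (h1 : M * q < a) (h2 : a < M * q + M) : False := by
  obtain ⟨e, rfl⟩ := hd
  have h3 : M * q < M * (q + 1) := by linarith
  have hM : 0 < M := by linarith
  have := lt_of_mul_lt_mul_left h1 hM.le
  have := lt_of_mul_lt_mul_left (show M * e < M * (q + 1) by linarith) hM.le
  omega

theorem inside_iff {a a' b : ℤ} (ha : a' = a ∨ a' = a + 1) :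
    (InL a b ∧ InR a b) ∧ wall b a' = none ↔ ∃ k, FreeRow k a b := by
  constructor
  · rintro ⟨⟨⟨l, hl1, hl2, hl3⟩, ⟨r, hr1, hr2, hr3⟩⟩, hn⟩
    obtain ⟨t, ht1, ht2⟩ := wall_eq_true.1 hl2
    obtain ⟨s, hs1, hs2⟩ := wall_eq_false.1 hr2
    have hWs := W_pos s
    have hWt := W_pos t
    have el := Int.emod_add_mul_ediv l (4 * W t)
    have er := Int.emod_add_mul_ediv r (4 * W s)
    rw [ht1] at el
    rw [hs1] at er
    set p := l / (4 * W t)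
    set q := r / (4 * W s)
    have hno : ∀ c, l < c → c < r → wall c b = none := fun c h1 h2 => by
      rcases le_or_gt c a with h | h
      · exact hl3 c h1 h
      · exact hr3 c h h2
    have hrt : r ≤ 4 * W t * p + 3 * W t := by
      by_contra hlt
      have := hno (4 * W t * p + 3 * W t) (by linarith) (by linarith)
      rw [wall_eq_false.2 ⟨t, emod_of_eq (by omega) (by omega), ht2⟩] at this
      exact absurd this (by simp)
    have hls : 4 * W s * q + W s ≤ l := by
      by_contra hlt
      have := hno (4 * W s * q + W s) (by linarith) (by linarith)
      rw [wall_eq_true.2 ⟨s, emod_of_eq (by omega) (by omega), hs2⟩] at this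
      exact absurd this (by simp)
    have hst : s = t := by
      rcases lt_trichotomy s t with h | h | h
      · exact (no_dvd_between ((W_dvd h).trans (W_dvd_of_emod (.inl ht1))) (q := q)
          (by linarith) (by linarith)).elim
      · exact h
      · exact (no_dvd_between ((W_dvd h).trans (W_dvd_of_emod (.inr hs1))) (q := p)
          (by linarith) (by linarith)).elim
    subst hst
    have hpq : p = q := by
      have h1 : 4 * W s * p < 4 * W s * (q + 1) := by linarith
      have h2 : 4 * W s * q < 4 * W s * (p + 1) := by linarith
      have := lt_of_mul_lt_mul_left h1 (by linarith)
      have := lt_of_mul_lt_mul_left h2 (by linarith)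
      omega
    rw [← hpq] at er
    have ea : a % (4 * W s) = a - 4 * W s * p := by
      have : (4 * W s * p + (a - 4 * W s * p)) % (4 * W s) = a - 4 * W s * p :=
        emod_of_eq (by linarith) (by linarith)
      rwa [add_sub_cancel] at this
    have ea' : a' % (4 * W s) = a' - 4 * W s * p := by
      have : (4 * W s * p + (a' - 4 * W s * p)) % (4 * W s) = a' - 4 * W s * p :=
        emod_of_eq (by rcases ha with rfl | rfl <;> linarith)
          (by rcases ha with rfl | rfl <;> linarith)
      rwa [add_sub_cancel] at this
    have hra : Rng s a' := by
      unfold Rng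
      rw [ea']
      constructor <;> rcases ha with rfl | rfl <;> linarith
    have hb := wall_eq_none.1 hn s
    refine ⟨s, ⟨by linarith, by linarith, ht2.1.lt_of_ne fun h => hb (.inl h.symm) hra,
      ht2.2.lt_of_ne fun h => hb (.inr h) hra, fun u hu hub => ?_⟩⟩
    have hWu := W_pos u
    obtain ⟨m, hm⟩ := (W_dvd hu).trans (W_dvd_of_emod (.inl ht1))
    have hle := Int.le_of_dvd hWs (W_dvd hu)
    have h3 := hno (l + W u) (by linarith) (by linarith)
    rw [wall_eq_true.2 ⟨u, by rw [hm]; exact emod_of_eq hWu.le (by linarith), hub⟩] at h3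
    exact absurd h3 (by simp)
  · rintro ⟨k, h⟩
    exact ⟨h.inside, h.hwall_none a'⟩

/-- The wall carried by a column line at a site, given the lines above and below the site. -/
def wallOf (A B : Line) : Option Bool :=
  if A.red = true ∧ (A.r = 0 ∨ A.r = 1 ∨ B.r = 0 ∨ B.r = 1) then some A.side else none

theorem zmod4_sub_one (q : ℤ) :
    ((q : ZMod 4) - 1 = 0 ∨ (q : ZMod 4) - 1 = 1) ↔ q % 4 = 1 ∨ q % 4 = 2 := by
  rcases zmod4_cases q with ⟨e, e'⟩ | ⟨e, e'⟩ | ⟨e, e', e''⟩ | ⟨e, e', e''⟩ <;> rw [e]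
  · exact iff_of_false (by decide) (by omega)
  · exact iff_of_true (by decide) (by omega)
  · exact iff_of_true (by decide) (by omega)
  · exact iff_of_false (by decide) (by omega)

theorem rng_iff_ediv (t : ℕ) (b : ℤ) : Rng t b ↔
    (b / W t % 4 = 1 ∨ b / W t % 4 = 2) ∨ ((b - 1) / W t % 4 = 1 ∨ (b - 1) / W t % 4 = 2) := by
  have hW := W_pos t
  have e := Int.emod_add_mul_ediv b (W t)
  have h0 := Int.emod_nonneg b hW.ne'
  have h1 := Int.emod_lt_of_pos b hW
  rw [pred_ediv hW, Rng]
  simp only [Int.dvd_iff_emod_eq_zero]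
  set q := b / W t
  set s := b % W t
  have h4 := Int.emod_add_mul_ediv q 4
  have hq : q % 4 = 0 ∨ q % 4 = 1 ∨ q % 4 = 2 ∨ q % 4 = 3 := by omega
  have hb : b % (4 * W t) = W t * (q % 4) + s := by
    have : b = 4 * W t * (q / 4) + (W t * (q % 4) + s) := by
      rw [← e]; linear_combination (- W t) * h4
    conv_lhs => rw [this]
    refine emod_of_eq ?_ ?_ <;> rcases hq with h | h | h | h <;> rw [h] <;> linarith
  rw [hb]
  rcases hq with h | h | h | h <;> rw [h] <;> split_ifs with hs <;> omega

theorem lev_of_emod {t : ℕ} {a : ℤ} (h : a % (4 * W t) = W t ∨ a % (4 * W t) = 3 * W t) :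
    Lev (2 * t + 1) a := by
  refine ⟨W_dvd_of_emod h, fun hd => ?_⟩
  have hW := W_pos t
  have e := Int.emod_add_mul_ediv a (4 * W t)
  obtain ⟨c, hc⟩ := hd
  rw [pow_succ, show (2 : ℤ) ^ (2 * t + 1) = W t from rfl] at hc
  rcases h with h | h <;> rw [h, hc] at e
  · have : W t * (1 + 4 * (W t * 2 * c / (4 * W t))) = W t * (2 * c) := by linarith
    have := mul_left_cancel₀ hW.ne' this
    omega
  · have : W t * (3 + 4 * (W t * 2 * c / (4 * W t))) = W t * (2 * c) := by linarith
    have := mul_left_cancel₀ hW.ne' this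
    omega

theorem emod_of_lev {t : ℕ} {a : ℤ} (h : Lev (2 * t + 1) a) :
    if (2 : ℤ) ^ (2 * t + 1 + 2) ∣ a - 2 ^ (2 * t + 1) then a % (4 * W t) = W t
    else a % (4 * W t) = 3 * W t := by
  have hW := W_pos t
  obtain ⟨q, hq⟩ := h.1
  have hd := mul_pow_dvd_iff (l := 2 * t + 1) (q := q)
  rw [← hq] at hd
  have h2 : ¬ 2 ∣ q := by rw [← hd.1]; exact h.2
  simp only [hd.2.2]
  rw [show (2 : ℤ) ^ (2 * t + 1) = W t from rfl] at hq
  have h4 := Int.emod_add_mul_ediv q 4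
  have key : ∀ r, q % 4 = r → 0 ≤ W t * r → W t * r < 4 * W t → a % (4 * W t) = W t * r := by
    intro r hr h0 h1
    have : a = 4 * W t * (q / 4) + W t * r := by rw [hq, ← hr]; linear_combination (- W t) * h4
    conv_lhs => rw [this]
    exact emod_of_eq h0 h1
  split_ifs with h1
  · rw [key 1 (by omega) (by linarith) (by linarith)]; ring
  · rw [key 3 (by omega) (by linarith) (by linarith)]; ring

theorem wallOf_lineAt (d : ℕ → Fin 4) (a b : ℤ) :
    wallOf (lineAt d a b) (lineAt d a (b - 1)) = wall a b := by
  by_cases ha : a = 0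
  · subst ha
    rw [wall_eq_none.2]
    · simp [wallOf, lineAt]
    · intro t ht
      have := W_pos t
      simp at ht; omega
  · by_cases hl : lev a % 2 = 1
    · obtain ⟨t, ht⟩ : ∃ t, lev a = 2 * t + 1 := ⟨lev a / 2, by omega⟩
      have hL := lev_spec ha
      rw [ht] at hL
      have he := emod_of_lev hL
      simp only [wallOf, lineAt, ha, if_false, ht, ← or_assoc]
      have hiff : (((((b / 2 ^ (2 * t + 1) : ℤ) : ZMod 4) - 1 = 0 ∨
          ((b / 2 ^ (2 * t + 1) : ℤ) : ZMod 4) - 1 = 1) ∨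
          (((b - 1) / 2 ^ (2 * t + 1) : ℤ) : ZMod 4) - 1 = 0) ∨
          (((b - 1) / 2 ^ (2 * t + 1) : ℤ) : ZMod 4) - 1 = 1) ↔ Rng t b := by
        rw [or_assoc, zmod4_sub_one, zmod4_sub_one, rng_iff_ediv]; rfl
      by_cases hr : Rng t b
      · rw [if_pos ⟨by simp, hiff.2 hr⟩]
        split_ifs at he with h
        · rw [wall_eq_true.2 ⟨t, he, hr⟩]; simpa using h
        · rw [wall_eq_false.2 ⟨t, he, hr⟩]; simpa using h
      · rw [if_neg (fun hc => hr (hiff.1 hc.2)), wall_eq_none.2]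
        intro s hs
        have := (lev_of_emod hs).unique hL
        obtain rfl : s = t := by omega
        exact hr
    · rw [wall_eq_none.2]
      · simp [wallOf, lineAt, ha, hl]
      · intro t ht
        have := (lev_of_emod ht).lev_eq
        omega

/-- A machine processing the free rows and columns of a board. -/
structure Mach where
  Q : Type
  C : Type
  V : Type
  finQ : Finite Q
  finC : Finite C
  finV : Finite V
  q0 : Q
  v0 : V
  entry : Q → C
  stepC : Q → C → V → Fin 4 → C
  stepV : Q → C → V → Fin 4 → V
  fin : Q → C → Q
  halt : Q → Prop

attribute [instance] Mach.finQ Mach.finC Mach.finV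

/-- Labels of an edge to the right of a site. -/
@[ext] structure HEdge (M : Mach) where
  tL : Prop
  tR : Prop
  q : M.Q
  c : M.C

/-- Labels of an edge above a site. -/
@[ext] structure VEdge (M : Mach) where
  tD : Prop
  tU : Prop
  v : M.V
  lane : M.Q

def HEdge.Free {M : Mach} (e : HEdge M) : Prop := e.tL ∧ e.tR

def VEdge.Free {M : Mach} (f : VEdge M) : Prop := f.tD ∧ f.tU

open scoped Classical in
/-- The local rule of the computation layer at a site with left, right, lower and upper edges
`L`, `R`, `B`, `A`, vertical wall `vw`, horizontal wall `hw`, and digit `w`. -/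
structure Rule2 {M : Mach} (vw hw : Option Bool) (w : Fin 4) (L R : HEdge M) (B A : VEdge M) :
    Prop where
  tL : R.tL ↔ vw = some true ∨ vw = none ∧ L.tL
  tR : L.tR ↔ vw = some false ∨ vw = none ∧ R.tR
  tD : A.tD ↔ hw = some true ∨ hw = none ∧ B.tD
  tU : B.tU ↔ hw = some false ∨ hw = none ∧ A.tU
  c : R.c = if R.Free ∧ hw = none then
      if vw = some true then M.entry R.q else if B.Free then M.stepC L.q L.c B.v w else L.c
    else M.entry M.q0
  q : L.q = if L.Free ∧ hw = none then if vw = some false then B.lane else R.q else M.q0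
  v : A.v = if A.Free ∧ vw = none then
      if hw = some true then M.v0 else if L.Free then M.stepV L.q L.c B.v w else B.v
    else M.v0
  lane : A.lane = if vw = some false ∧ hw = none then
      if L.Free then M.fin B.lane L.c else B.lane
    else M.q0

theorem ite_agree {α : Type*} {p q : Prop} {_ : Decidable p} {_ : Decidable q} {x y u v : α}
    (h : p ↔ q) (h1 : p → x = y) (h2 : ¬ p → u = v) : ite p x u = ite q y v := by
  split_ifs with a b b
  · exact h1 a
  · exact absurd (h.1 a) b
  · exact absurd (h.2 b) a
  · exact h2 a

section rigidity
variable {M : Mach} {vw hw : ℤ → ℤ → Option Bool} {w : ℤ → ℤ → Fin 4}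
  {e e' : ℤ → ℤ → HEdge M} {f f' : ℤ → ℤ → VEdge M} {a b : ℤ} {n m : ℕ}

/-- A board: the rectangle `[a, a + n] × [b, b + m]` is surrounded by walls. -/
structure Board (vw hw : ℤ → ℤ → Option Bool) (a b : ℤ) (n m : ℕ) : Prop where
  left : ∀ s ≤ m, vw a (b + s) = some true
  right : ∀ s ≤ m, vw (a + n) (b + s) = some false
  down : ∀ s ≤ n, hw (a + s) b = some true
  up : ∀ s ≤ n, hw (a + s) (b + m) = some false

/-- The rules of the computation layer hold on a rectangle. -/
def RulesOn (vw hw : ℤ → ℤ → Option Bool) (w : ℤ → ℤ → Fin 4) (e : ℤ → ℤ → HEdge M)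
    (f : ℤ → ℤ → VEdge M) (a b : ℤ) (n m : ℕ) : Prop :=
  ∀ s ≤ n, ∀ r ≤ m, Rule2 (vw (a + s) (b + r)) (hw (a + s) (b + r)) (w (a + s) (b + r))
    (e (a + s - 1) (b + r)) (e (a + s) (b + r)) (f (a + s) (b + r - 1)) (f (a + s) (b + r))

theorem ind_up {n : ℕ} {P : ℕ → Prop} (h0 : P 0) (hs : ∀ s < n, P s → P (s + 1)) :
    ∀ s ≤ n, P s := by
  intro s hsn
  induction s with
  | zero => exact h0
  | succ s ih => exact hs s (by omega) (ih (by omega))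

theorem ind_down {n : ℕ} {P : ℕ → Prop} (h0 : P n) (hs : ∀ s < n, P (s + 1) → P s) :
    ∀ s ≤ n, P s := by
  intro s hsn
  obtain ⟨k, rfl⟩ := Nat.exists_eq_add_of_le hsn
  clear hsn
  induction k with
  | zero => exact h0
  | succ k ih =>
    refine ih ?_ (fun r hr => hs r (by omega))
    exact hs _ (by omega) h0

/-- The rules determine the labels inside a board. -/
theorem Board.rigid (hB : Board vw hw a b n m) (h : RulesOn vw hw w e f a b n m)
    (h' : RulesOn vw hw w e' f' a b n m) :
    (∀ s < n, ∀ r ≤ m, e (a + s) (b + r) = e' (a + s) (b + r)) ∧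
    (∀ s ≤ n, ∀ r < m, f (a + s) (b + r) = f' (a + s) (b + r)) := by
  have cast1 : ∀ (c : ℤ) (s : ℕ), c + ((s + 1 : ℕ) : ℤ) - 1 = c + s := fun c s => by
    push_cast; ring
  have tL : ∀ r ≤ m, ∀ s ≤ n, ((e (a + s) (b + r)).tL ↔ (e' (a + s) (b + r)).tL) := by
    intro r hr
    apply ind_up
    · have h1 := (h 0 (by omega) r hr).tL
      have h2 := (h' 0 (by omega) r hr).tL
      have := hB.left r hr
      simp [this] at h1 h2 ⊢; tauto
    · intro s hs ih
      have h1 := (h (s + 1) (by omega) r hr).tL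
      have h2 := (h' (s + 1) (by omega) r hr).tL
      rw [cast1] at h1 h2
      rw [h1, h2, ih]
  have tR : ∀ r ≤ m, ∀ s ≤ n, ((e (a + s - 1) (b + r)).tR ↔ (e' (a + s - 1) (b + r)).tR) := by
    intro r hr
    apply ind_down
    · have h1 := (h n le_rfl r hr).tR
      have h2 := (h' n le_rfl r hr).tR
      have := hB.right r hr
      simp only [this, true_or, iff_true] at h1 h2 ⊢; tauto
    · intro s hs ih
      have h1 := (h s hs.le r hr).tR
      have h2 := (h' s hs.le r hr).tR
      rw [cast1] at ih
      rw [h1, h2, ih]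
  have tD : ∀ s ≤ n, ∀ r ≤ m, ((f (a + s) (b + r)).tD ↔ (f' (a + s) (b + r)).tD) := by
    intro s hs
    apply ind_up
    · have h1 := (h s hs 0 (by omega)).tD
      have h2 := (h' s hs 0 (by omega)).tD
      have := hB.down s hs
      simp [this] at h1 h2 ⊢; tauto
    · intro r hr ih
      have h1 := (h s hs (r + 1) (by omega)).tD
      have h2 := (h' s hs (r + 1) (by omega)).tD
      rw [cast1] at h1 h2
      rw [h1, h2, ih]
  have tU : ∀ s ≤ n, ∀ r ≤ m, ((f (a + s) (b + r - 1)).tU ↔ (f' (a + s) (b + r - 1)).tU) := by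
    intro s hs
    apply ind_down
    · have h1 := (h s hs m le_rfl).tU
      have h2 := (h' s hs m le_rfl).tU
      have := hB.up s hs
      simp only [this, true_or, iff_true] at h1 h2 ⊢; tauto
    · intro r hr ih
      have h1 := (h s hs r hr.le).tU
      have h2 := (h' s hs r hr.le).tU
      rw [cast1] at ih
      rw [h1, h2, ih]
  have eF : ∀ s < n, ∀ r ≤ m, ((e (a + s) (b + r)).Free ↔ (e' (a + s) (b + r)).Free) := by
    intro s hs r hr
    have := tR r hr (s + 1) (by omega)
    rw [cast1] at this
    exact and_congr (tL r hr s hs.le) this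
  have fF : ∀ s ≤ n, ∀ r < m, ((f (a + s) (b + r)).Free ↔ (f' (a + s) (b + r)).Free) := by
    intro s hs r hr
    have := tU s hs (r + 1) (by omega)
    rw [cast1] at this
    exact and_congr (tD s hs r hr.le) this
  -- one row, assuming the edges below agree
  have row : ∀ r ≤ m, (0 < r → ∀ s ≤ n, (f (a + s) (b + r - 1)).v = (f' (a + s) (b + r - 1)).v ∧
      (f (a + s) (b + r - 1)).lane = (f' (a + s) (b + r - 1)).lane ∧
      ((f (a + s) (b + r - 1)).Free ↔ (f' (a + s) (b + r - 1)).Free)) →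
      (∀ s < n, (e (a + s) (b + r)).q = (e' (a + s) (b + r)).q ∧
        (e (a + s) (b + r)).c = (e' (a + s) (b + r)).c) ∧
      (r < m → ∀ s ≤ n, (f (a + s) (b + r)).v = (f' (a + s) (b + r)).v ∧
        (f (a + s) (b + r)).lane = (f' (a + s) (b + r)).lane) := by
    intro r hr hf
    have hhw : ∀ s ≤ n, hw (a + s) (b + r) = none → 0 < r := by
      intro s hs h0
      rcases Nat.eq_zero_or_pos r with rfl | h
      · have := hB.down s hs
        simp [this] at h0
      · exact h
    have hvL := hB.left r hr
    have hvR := hB.right r hr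
    have q : ∀ s < n, (e (a + s) (b + r)).q = (e' (a + s) (b + r)).q := by
      have : ∀ s ≤ n, 0 < s → (e (a + s - 1) (b + r)).q = (e' (a + s - 1) (b + r)).q := by
        apply ind_down
        · intro h0
          obtain ⟨n', rfl⟩ : ∃ n', n = n' + 1 := ⟨n - 1, by omega⟩
          have h1 := (h (n' + 1) le_rfl r hr).q
          have h2 := (h' (n' + 1) le_rfl r hr).q
          rw [h1, h2, hvR, cast1]
          refine ite_agree (and_congr_left' (eF n' (by omega) r hr)) (fun hh => ?_) fun _ => rfl
          rw [if_pos rfl, if_pos rfl]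
          exact (hf (hhw _ le_rfl hh.2) _ le_rfl).2.1
        · intro s hs ih h0
          obtain ⟨s', rfl⟩ : ∃ s', s = s' + 1 := ⟨s - 1, by omega⟩
          have h1 := (h (s' + 1) hs.le r hr).q
          have h2 := (h' (s' + 1) hs.le r hr).q
          have ih := ih (by omega)
          rw [cast1] at ih
          rw [h1, h2, cast1, ih]
          refine ite_agree (and_congr_left' (eF s' (by omega) r hr)) (fun hh => ?_) fun _ => rfl
          rw [(hf (hhw _ hs.le hh.2) _ hs.le).2.1]
      intro s hs
      have := this (s + 1) hs (by omega)
      rwa [cast1] at this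
    have c : ∀ s < n, (e (a + s) (b + r)).c = (e' (a + s) (b + r)).c := by
      intro s hs
      induction s with
      | zero =>
        have h1 := (h 0 (by omega) r hr).c
        have h2 := (h' 0 (by omega) r hr).c
        rw [h1, h2, ← q 0 hs]
        refine ite_agree (and_congr_left' (eF 0 hs r hr)) (fun hh => ?_) fun _ => rfl
        simp [hvL]
      | succ s ih =>
        have ih := ih (by omega)
        have h1 := (h (s + 1) (by omega) r hr).c
        have h2 := (h' (s + 1) (by omega) r hr).c
        rw [cast1] at h1 h2
        rw [h1, h2, ← q _ hs, ← q s (by omega), ih]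
        refine ite_agree (and_congr_left' (eF (s + 1) hs r hr)) (fun hh => ?_) fun _ => rfl
        have hf := hf (hhw _ hs.le hh.2) _ hs.le
        refine ite_agree Iff.rfl (fun _ => rfl) fun _ => ite_agree hf.2.2 (fun _ => ?_) fun _ => rfl
        rw [hf.1]
    refine ⟨fun s hs => ⟨q s hs, c s hs⟩, fun hrm s hs => ?_⟩
    have h1 := h s hs r hr
    have h2 := h' s hs r hr
    rw [h1.v, h2.v, h1.lane, h2.lane]
    cases s with
    | zero => simp [hvL]
    | succ s =>
      rw [cast1, q s (by omega), c s (by omega)]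
      constructor
      · refine ite_agree (and_congr_left' (fF _ hs r hrm)) (fun hF => ?_) fun _ => rfl
        refine ite_agree Iff.rfl (fun _ => rfl) fun h3 => ?_
        have h5 : hw (a + ((s + 1 : ℕ) : ℤ)) (b + r) = none := by
          rcases h1.tD.1 hF.1.1 with h5 | h5
          · exact absurd h5 h3
          · exact h5.1
        rw [(hf (hhw _ hs h5) _ hs).1]
        exact ite_agree (eF s (by omega) r hr) (fun _ => rfl) fun _ => rfl
      · refine ite_agree Iff.rfl (fun hh => ?_) fun _ => rfl
        rw [(hf (hhw _ hs hh.2) _ hs).2.1]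
        exact ite_agree (eF s (by omega) r hr) (fun _ => rfl) fun _ => rfl
  have rows : ∀ r ≤ m, (∀ s < n, (e (a + s) (b + r)).q = (e' (a + s) (b + r)).q ∧
        (e (a + s) (b + r)).c = (e' (a + s) (b + r)).c) ∧
      (r < m → ∀ s ≤ n, (f (a + s) (b + r)).v = (f' (a + s) (b + r)).v ∧
        (f (a + s) (b + r)).lane = (f' (a + s) (b + r)).lane) := by
    apply ind_up
    · exact row 0 (by omega) (fun h => absurd h (by omega))
    · intro r hr ih
      refine row (r + 1) hr fun _ s hs => ?_
      rw [cast1]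
      exact ⟨(ih.2 hr s hs).1, (ih.2 hr s hs).2, fF s hs r hr⟩
  constructor
  · intro s hs r hr
    have := tR r hr (s + 1) (by omega)
    rw [cast1] at this
    exact HEdge.ext (propext (tL r hr s hs.le)) (propext this) ((rows r hr).1 s hs).1
      ((rows r hr).1 s hs).2
  · intro s hs r hr
    have := tU s hs (r + 1) (by omega)
    rw [cast1] at this
    exact VEdge.ext (propext (tD s hs r hr.le)) (propext this) ((rows r hr.le).2 hr s hs).1
      ((rows r hr.le).2 hr s hs).2
end rigidity

section labels
variable (M : Mach) (w : ℤ → Fin 4)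

/-- The lower left corner coordinate of the board of level `k` around `a`. -/
def corner (k : ℕ) (a : ℤ) : ℤ := 4 * W k * (a / (4 * W k)) + W k

open scoped Classical in
/-- The column state along a row of a board. -/
noncomputable def rowC (k : ℕ) (x : ℤ) (q : M.Q) (v : ℤ → M.V) : ℕ → M.C
  | 0 => M.entry q
  | m + 1 => if FreeLine k (x + m + 1) then
      M.stepC q (rowC k x q v m) (v (x + m + 1)) (w (x + m + 1)) else rowC k x q v m

open scoped Classical in
/-- The state of the board of level `k` with lower left corner `(x, y)` before its row `n + 1`. -/
noncomputable def run (k : ℕ) (x y : ℤ) : ℕ → M.Q × (ℤ → M.V)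
  | 0 => (M.q0, fun _ => M.v0)
  | n + 1 => if FreeLine k (y + n + 1) then
      (M.fin (run k x y n).1
          (rowC M w k x (run k x y n).1 (run k x y n).2 (2 * W k - 1).toNat),
        fun i => if FreeLine k i then
          M.stepV (run k x y n).1
            (rowC M w k x (run k x y n).1 (run k x y n).2 (i - 1 - x).toNat)
            ((run k x y n).2 i) (w i)
          else (run k x y n).2 i)
    else run k x y n

open scoped Classical in
noncomputable def labelH (i j : ℤ) : HEdge M :=
  if h : ∃ k, FreeRow k i j then
    let r := run M w h.choose (corner h.choose i) (corner h.choose j)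
      (j - corner h.choose j - 1).toNat
    ⟨InL i j, InR i j, r.1,
      rowC M w h.choose (corner h.choose i) r.1 r.2 (i - corner h.choose i).toNat⟩
  else ⟨InL i j, InR i j, M.q0, M.entry M.q0⟩

/-- The edge above `(i, j)` lies in the right wall of a board of level `k`. -/
def Lane (k : ℕ) (i j : ℤ) : Prop :=
  i % (4 * W k) = 3 * W k ∧ W k ≤ j % (4 * W k) ∧ j % (4 * W k) < 3 * W k

open scoped Classical in
noncomputable def labelV (i j : ℤ) : VEdge M where
  tD := InL j i
  tU := InR j i
  v := if h : ∃ k, FreeRow k j i then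
      (run M w h.choose (corner h.choose i) (corner h.choose j)
        (j - corner h.choose j).toNat).2 i
    else M.v0
  lane := if h : ∃ k, Lane k i j then
      (run M w h.choose (corner h.choose i) (corner h.choose j)
        (j - corner h.choose j).toNat).1
    else M.q0

variable {M w}

theorem labelH_free (i j : ℤ) : (labelH M w i j).tL = InL i j ∧ (labelH M w i j).tR = InR i j := by
  unfold labelH
  split_ifs <;> exact ⟨rfl, rfl⟩

theorem labelH_of {k : ℕ} {i j : ℤ} (h : FreeRow k i j) :
    (labelH M w i j).q = (run M w k (corner k i) (corner k j) (j - corner k j - 1).toNat).1 ∧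
    (labelH M w i j).c = rowC M w k (corner k i)
      (run M w k (corner k i) (corner k j) (j - corner k j - 1).toNat).1
      (run M w k (corner k i) (corner k j) (j - corner k j - 1).toNat).2
      (i - corner k i).toNat := by
  have h' : ∃ k, FreeRow k i j := ⟨k, h⟩
  have e : h'.choose = k := h'.choose_spec.unique h
  rw [labelH, dif_pos h']
  simp only [e, true_and]

theorem labelH_default {i j : ℤ} (h : ¬ ∃ k, FreeRow k i j) :
    (labelH M w i j).q = M.q0 ∧ (labelH M w i j).c = M.entry M.q0 := by
  simp [labelH, dif_neg h]

theorem labelV_of {k : ℕ} {i j : ℤ} (h : FreeRow k j i) :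
    (labelV M w i j).v = (run M w k (corner k i) (corner k j) (j - corner k j).toNat).2 i := by
  have h' : ∃ k, FreeRow k j i := ⟨k, h⟩
  have e : h'.choose = k := h'.choose_spec.unique h
  simp only [labelV, dif_pos h', e]

theorem labelV_lane_of {k : ℕ} {i j : ℤ} (h : Lane k i j) :
    (labelV M w i j).lane = (run M w k (corner k i) (corner k j) (j - corner k j).toNat).1 := by
  have h' : ∃ k, Lane k i j := ⟨k, h⟩
  have e : h'.choose = k := wall_level_unique (Or.inr h'.choose_spec.1) (Or.inr h.1)
  simp only [labelV, dif_pos h', e]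

theorem sub_corner (k : ℕ) (a : ℤ) : a - corner k a = a % (4 * W k) - W k := by
  have := Int.emod_add_mul_ediv a (4 * W k)
  unfold corner; linarith

theorem corner_pred {k : ℕ} {a : ℤ} (h : W k < a % (4 * W k)) : corner k (a - 1) = corner k a := by
  have := W_pos k
  rw [corner, corner, (emod_pred (by linarith) (by linarith)).2]

theorem emod_pred_W {k : ℕ} {a : ℤ} (h : W k < a % (4 * W k)) :
    (a - 1) % (4 * W k) = a % (4 * W k) - 1 := by
  have := W_pos k
  exact (emod_pred (by linarith) (by linarith)).1

theorem FreeRow.pred {k : ℕ} {i j : ℤ} (h : FreeRow k i j) (h1 : W k < i % (4 * W k)) :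
    FreeRow k (i - 1) j := by
  have e := emod_pred_W h1
  have := h.lt
  exact ⟨by omega, by omega, h.lo, h.hi, h.free⟩

theorem emod_succ_W {k : ℕ} {a : ℤ} (h : a % (4 * W k) < 3 * W k) :
    (a + 1) % (4 * W k) = a % (4 * W k) + 1 ∧ (a + 1) / (4 * W k) = a / (4 * W k) := by
  have := W_pos k
  exact emod_succ (by linarith) (by linarith)

/-- Inside a free row, the column edge below is free exactly at free columns. -/
theorem FreeRow.below {k : ℕ} {i j : ℤ} (h : FreeRow k i j) (h1 : W k < i % (4 * W k)) :
    (InL (j - 1) i ∧ InR (j - 1) i) ↔ FreeLine k i := by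
  have e := emod_pred_W h.lo
  have hv := h.wall_none h1
  have key := inside_iff (a := j - 1) (a' := j) (b := i) (Or.inr (by ring))
  rw [hv] at key
  simp only [and_true] at key
  rw [key]
  constructor
  · rintro ⟨m, hm⟩
    have : m = k := by
      rcases lt_trichotomy m k with hmk | hmk | hmk
      · refine absurd ?_ (h.free m hmk)
        have := emod_succ_W hm.lt
        have h1 := hm.le
        have h2 := hm.lt
        rw [sub_add_cancel] at this
        exact ⟨by omega, by omega⟩
      · exact hmk
      · exact absurd ⟨h.le, h.lt.le⟩ (hm.free k hmk)
    exact this ▸ hm.free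
  · intro hf
    have := h.lo
    have := h.hi
    exact ⟨k, by omega, by omega, h1, h.lt, hf⟩

theorem Lane.freeRow {k : ℕ} {i j : ℤ} (h : i % (4 * W k) = 3 * W k) (hj : W k < j % (4 * W k))
    (hj' : j % (4 * W k) < 3 * W k) : (∃ m, FreeRow m (i - 1) j) ↔ FreeLine k j := by
  have hW := W_pos k
  have e := emod_pred_W (k := k) (a := i) (by omega)
  constructor
  · rintro ⟨m, hm⟩
    have : m = k := by
      rcases lt_trichotomy m k with hmk | hmk | hmk
      · have h1 := emod_succ_W hm.lt
        rw [sub_add_cancel] at h1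
        have h2 := hm.le
        have h3 := hm.lt
        exact absurd ⟨by omega, by omega⟩
          (not_rng_of_dvd ((W_dvd hmk).trans (W_dvd_of_emod (Or.inr h))))
      · exact hmk
      · exact absurd ⟨hj.le, hj'.le⟩ (hm.free k hmk)
    exact this ▸ hm.free
  · intro hf
    exact ⟨k, by omega, by omega, hj, hj', hf⟩

/-- At the right end of a board, horizontal walls stop the lane only at its bottom and top. -/
theorem lane_hwall {k : ℕ} {i j : ℤ} (h : i % (4 * W k) = 3 * W k) (hj : W k < j % (4 * W k))
    (hj' : j % (4 * W k) < 3 * W k) : wall j i = none :=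
  wall_eq_none.2 fun _ ht => not_rng_of_dvd
    ((W_dvd (wall_emod_iff hj hj' ht)).trans (W_dvd_of_emod (Or.inr h)))

theorem FreeRow.lower {k : ℕ} {i j : ℤ} (h : FreeRow k i j) (h1 : W k < i % (4 * W k))
    (hf : FreeLine k i) : FreeRow k (j - 1) i := by
  have e := emod_pred_W h.lo
  have := h.lo
  have := h.hi
  exact ⟨by omega, by omega, h1, h.lt, hf⟩

theorem labelH_free_iff (i j : ℤ) :
    ((labelH M w i j).Free ∧ wall j i = none) ↔ ∃ k, FreeRow k i j := by
  rw [HEdge.Free, (labelH_free _ _).1, (labelH_free _ _).2]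
  exact inside_iff (Or.inl rfl)

theorem labelH_free_iff' (i j : ℤ) :
    ((labelH M w (i - 1) j).Free ∧ wall j i = none) ↔ ∃ k, FreeRow k (i - 1) j := by
  rw [HEdge.Free, (labelH_free _ _).1, (labelH_free _ _).2]
  exact inside_iff (Or.inr (by ring))

theorem labelV_free_iff (i j : ℤ) :
    ((labelV M w i j).Free ∧ wall i j = none) ↔ ∃ k, FreeRow k j i :=
  inside_iff (Or.inl rfl)

theorem toNat_pred {a : ℤ} {s : ℕ} (h : a.toNat = s + 1) : (a - 1).toNat = s := by omega

/-- Inside a free column, the row edge to the left is free exactly at free rows. -/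
theorem FreeRow.before {k : ℕ} {i j : ℤ} (h : FreeRow k j i) (h1 : W k < j % (4 * W k)) :
    (labelH M w (i - 1) j).Free ↔ FreeLine k j := by
  rw [HEdge.Free, (labelH_free _ _).1, (labelH_free _ _).2]
  exact h.below h1

open scoped Classical in
theorem rule2_c (i j : ℤ) : (labelH M w i j).c =
    if (labelH M w i j).Free ∧ wall j i = none then
      if wall i j = some true then M.entry (labelH M w i j).q
      else if (labelV M w i (j - 1)).Free then
        M.stepC (labelH M w (i - 1) j).q (labelH M w (i - 1) j).c (labelV M w i (j - 1)).v (w i)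
      else (labelH M w (i - 1) j).c
    else M.entry M.q0 := by
  by_cases h : ∃ k, FreeRow k i j
  · rw [if_pos ((labelH_free_iff i j).2 h)]
    obtain ⟨k, h⟩ := h
    obtain ⟨hq, hc⟩ := labelH_of (M := M) (w := w) h
    have ei := sub_corner k i
    have ej := sub_corner k j
    rw [hc, hq]
    rcases h.le.eq_or_lt with h1 | h1
    · rw [if_pos (wall_eq_true.2 ⟨k, h1.symm, h.rng⟩), show i - corner k i = 0 by omega]
      rfl
    · rw [if_neg (by rw [h.wall_none h1]; simp)]
      obtain ⟨s, hs⟩ : ∃ s, (i - corner k i).toNat = s + 1 :=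
        Nat.exists_eq_succ_of_ne_zero (by omega)
      have es : corner k i + s + 1 = i := by omega
      obtain ⟨hq', hc'⟩ := labelH_of (M := M) (w := w) (h.pred h1)
      rw [corner_pred h1, sub_right_comm i, toNat_pred hs] at hc'
      rw [corner_pred h1] at hq'
      rw [hs, rowC, es]
      refine ite_agree (h.below h1).symm (fun hf => ?_) fun hf => hc'.symm
      have hV := labelV_of (M := M) (w := w) (h.lower h1 hf)
      rw [corner_pred h.lo, sub_right_comm] at hV
      rw [hq', hc', hV]
  · rw [if_neg (fun hh => h ((labelH_free_iff i j).1 hh))]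
    exact (labelH_default h).2

open scoped Classical in
theorem rule2_q (i j : ℤ) : (labelH M w (i - 1) j).q =
    if (labelH M w (i - 1) j).Free ∧ wall j i = none then
      if wall i j = some false then (labelV M w i (j - 1)).lane else (labelH M w i j).q
    else M.q0 := by
  by_cases h : ∃ k, FreeRow k (i - 1) j
  · rw [if_pos ((labelH_free_iff' i j).2 h)]
    obtain ⟨k, h⟩ := h
    obtain ⟨hq, -⟩ := labelH_of (M := M) (w := w) h
    have e1 := (emod_succ_W h.lt).1
    rw [sub_add_cancel] at e1
    have h0 := h.le
    have h1 : W k < i % (4 * W k) := by omega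
    have hlt := h.lt
    have ej := sub_corner k j
    rw [hq, corner_pred h1]
    by_cases h3 : i % (4 * W k) = 3 * W k
    · rw [if_pos (wall_eq_false.2 ⟨k, h3, h.rng⟩)]
      have e := emod_pred_W h.lo
      have := h.lo
      have := h.hi
      rw [labelV_lane_of ⟨h3, by omega, by omega⟩, corner_pred h.lo, sub_right_comm]
    · have h' : FreeRow k i j := ⟨by omega, by omega, h.lo, h.hi, h.free⟩
      rw [if_neg (by rw [h'.wall_none h1]; simp), (labelH_of h').1]
  · rw [if_neg (fun hh => h ((labelH_free_iff' i j).1 hh))]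
    exact (labelH_default h).1

open scoped Classical in
theorem rule2_v (i j : ℤ) : (labelV M w i j).v =
    if (labelV M w i j).Free ∧ wall i j = none then
      if wall j i = some true then M.v0
      else if (labelH M w (i - 1) j).Free then
        M.stepV (labelH M w (i - 1) j).q (labelH M w (i - 1) j).c (labelV M w i (j - 1)).v (w i)
      else (labelV M w i (j - 1)).v
    else M.v0 := by
  by_cases h : ∃ k, FreeRow k j i
  · rw [if_pos ((labelV_free_iff i j).2 h)]
    obtain ⟨k, h⟩ := h
    have hv := labelV_of (M := M) (w := w) h
    have ei := sub_corner k i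
    have ej := sub_corner k j
    have hlo := h.lo
    have hle := h.le
    rw [hv]
    rcases h.le.eq_or_lt with h1 | h1
    · rw [if_pos (wall_eq_true.2 ⟨k, h1.symm, h.rng⟩), show j - corner k j = 0 by omega]
      rfl
    · rw [if_neg (by rw [h.wall_none h1]; simp)]
      obtain ⟨s, hs⟩ : ∃ s, (j - corner k j).toNat = s + 1 :=
        Nat.exists_eq_succ_of_ne_zero (by omega)
      have es : corner k j + s + 1 = j := by omega
      have hV := labelV_of (M := M) (w := w) (h.pred h1)
      rw [corner_pred h1, sub_right_comm, toNat_pred hs] at hV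
      rw [hs, run, es, hV]
      have key : ∀ (p : Prop) [Decidable p] (a b : M.Q × (ℤ → M.V)),
          (if p then a else b).2 i = if p then a.2 i else b.2 i := by
        intro p _ a b; split_ifs <;> rfl
      rw [key]
      refine ite_agree (h.before h1).symm (fun hf => ?_) fun hf => rfl
      have e := emod_pred_W hlo
      obtain ⟨hq', hc'⟩ := labelH_of (M := M) (w := w) (h.lower h1 hf)
      have hs' := toNat_pred hs
      rw [corner_pred hlo, hs'] at hc'
      rw [corner_pred hlo, hs'] at hq'
      dsimp only
      rw [if_pos h.free, hq', hc']
  · rw [if_neg (fun hh => h ((labelV_free_iff i j).1 hh))]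
    simp [labelV, dif_neg h]

open scoped Classical in
theorem rule2_lane (i j : ℤ) : (labelV M w i j).lane =
    if wall i j = some false ∧ wall j i = none then
      if (labelH M w (i - 1) j).Free then
        M.fin (labelV M w i (j - 1)).lane (labelH M w (i - 1) j).c
      else (labelV M w i (j - 1)).lane
    else M.q0 := by
  by_cases h : wall i j = some false ∧ wall j i = none
  · rw [if_pos h]
    have hn := h.2
    obtain ⟨k, hi, hj⟩ := wall_eq_false.1 h.1
    have hj1 : j % (4 * W k) ≠ W k := fun he => (wall_eq_none.1 hn) k (Or.inl he)
      (rng_of_emod (Or.inr hi))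
    have hj2 : j % (4 * W k) ≠ 3 * W k := fun he => (wall_eq_none.1 hn) k (Or.inr he)
      (rng_of_emod (Or.inr hi))
    have hlo : W k < j % (4 * W k) := lt_of_le_of_ne hj.1 (Ne.symm hj1)
    have hhi : j % (4 * W k) < 3 * W k := lt_of_le_of_ne hj.2 hj2
    have hF : (labelH M w (i - 1) j).Free ↔ FreeLine k j := by
      rw [← Lane.freeRow hi hlo hhi, ← labelH_free_iff' (M := M) (w := w), and_iff_left hn]
    have ei := sub_corner k i
    have ej := sub_corner k j
    have hW := W_pos k
    obtain ⟨s, hs⟩ : ∃ s, (j - corner k j).toNat = s + 1 :=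
      Nat.exists_eq_succ_of_ne_zero (by omega)
    have es : corner k j + s + 1 = j := by omega
    have e := emod_pred_W hlo
    have hl := labelV_lane_of (M := M) (w := w) (k := k) (i := i) (j := j - 1)
      ⟨hi, by omega, by omega⟩
    rw [corner_pred hlo, sub_right_comm, toNat_pred hs] at hl
    rw [labelV_lane_of ⟨hi, hlo.le, hhi⟩, hs, run, es, hl]
    have key : ∀ (p : Prop) [Decidable p] (a b : M.Q × (ℤ → M.V)),
        (if p then a else b).1 = if p then a.1 else b.1 := by
      intro p _ a b; split_ifs <;> rfl
    rw [key]
    refine ite_agree hF.symm (fun hf => ?_) fun hf => rfl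
    have hi1 : W k < i % (4 * W k) := by omega
    have e' := emod_pred_W hi1
    have hc' := (labelH_of (M := M) (w := w) (k := k) (i := i - 1) (j := j)
      ⟨by omega, by omega, hlo, hhi, hf⟩).2
    rw [corner_pred hi1, sub_right_comm j, show j - 1 - corner k j = j - corner k j - 1 by ring,
      toNat_pred hs, sub_right_comm i, show i - corner k i - 1 = 2 * W k - 1 by omega] at hc'
    rw [hc']
  · rw [if_neg h]
    by_cases hl : ∃ k, Lane k i j
    · obtain ⟨k, hl⟩ := hl
      have hw : wall i j = some false := wall_eq_false.2 ⟨k, hl.1, hl.2.1, hl.2.2.le⟩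
      have ej := sub_corner k j
      rcases hl.2.1.eq_or_lt with h1 | h1
      · rw [labelV_lane_of hl, show j - corner k j = 0 by omega]
        rfl
      · exact absurd ⟨hw, lane_hwall hl.1 h1 hl.2.2⟩ h
    · simp [labelV, dif_neg hl]

theorem rule2_labels (i j : ℤ) : Rule2 (wall i j) (wall j i) (w i) (labelH M w (i - 1) j)
    (labelH M w i j) (labelV M w i (j - 1)) (labelV M w i j) where
  tL := by rw [(labelH_free _ _).1, (labelH_free _ _).1]; exact inL_iff i j
  tR := by rw [(labelH_free _ _).2, (labelH_free _ _).2]; exact inR_iff i j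
  tD := inL_iff j i
  tU := inR_iff j i
  c := rule2_c i j
  q := rule2_q i j
  v := rule2_v i j
  lane := rule2_lane i j
end labels

/-- Symbols of the full marking system. -/
structure Sym (M : Mach) where
  s : Sym1
  e : HEdge M
  f : VEdge M

instance : Finite Ty :=
  Finite.of_injective (β := Option Bool × Bool)
    (fun | .eq => (none, false) | .row b => (some b, false) | .col b => (some b, true))
    (by rintro (_ | a | a) (_ | b | b) <;> simp)

instance : Finite Line :=
  Finite.of_injective (β := Bool × Bool × Fin 4 × ZMod 4 × Bool)
    (fun l => (l.side, l.red, l.dig, l.r, l.u)) (by rintro ⟨⟩ ⟨⟩; simp)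

instance : Finite Sym1 :=
  Finite.of_injective (β := Bool × Bool × Ty × Line × Line)
    (fun l => (l.pX, l.pY, l.t, l.V, l.H)) (by rintro ⟨⟩ ⟨⟩; simp)

instance (M : Mach) : Finite (HEdge M) :=
  Finite.of_injective (β := Prop × Prop × M.Q × M.C)
    (fun l => (l.tL, l.tR, l.q, l.c)) (by rintro ⟨⟩ ⟨⟩; simp)

instance (M : Mach) : Finite (VEdge M) :=
  Finite.of_injective (β := Prop × Prop × M.V × M.Q)
    (fun l => (l.tD, l.tU, l.v, l.lane)) (by rintro ⟨⟩ ⟨⟩; simp)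

instance (M : Mach) : Finite (Sym M) :=
  Finite.of_injective (β := Sym1 × HEdge M × VEdge M)
    (fun l => (l.s, l.e, l.f)) (by rintro ⟨⟩ ⟨⟩; simp)

section
variable {M : Mach}

/-- The local rule at the site `(i, j)`. -/
structure RuleAt (y : ℤ → ℤ → Sym M) (i j : ℤ) : Prop where
  half : Half (y i j).s (y (i + 1) j).s (y i (j + 1)).s
  half' : Half (y i j).s.tr (y i (j + 1)).s.tr (y (i + 1) j).s.tr
  comp : Rule2 (wallOf (y i j).s.V (y i (j - 1)).s.V) (wallOf (y i j).s.H (y (i - 1) j).s.H)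
    (y (i + 1) j).s.V.dig (y (i - 1) j).e (y i j).e (y i (j - 1)).f (y i j).f
  run : ¬ M.halt (y i j).f.lane

/-- The marking system. -/
def Valid (y : ℤ → ℤ → Sym M) : Prop := ∀ i j, RuleAt y i j

theorem Valid.rule1 {y : ℤ → ℤ → Sym M} (h : Valid y) : Rule1 (fun i j => (y i j).s) :=
  fun i j => ⟨(h i j).half, (h i j).half'⟩

/-- The digit attached to a column: the one of the line on its right. -/
def colDig (d : ℕ → Fin 4) (i : ℤ) : Fin 4 := (lineAt d (i + 1) 0).dig

theorem lineAt_dig (d : ℕ → Fin 4) (a b : ℤ) : (lineAt d a b).dig = (lineAt d a 0).dig := by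
  unfold lineAt; split_ifs <;> rfl

/-- The canonical element of the marking system. -/
noncomputable def canonY (M : Mach) (d : ℕ → Fin 4) (i j : ℤ) : Sym M :=
  ⟨canon d i j, labelH M (colDig d) i j, labelV M (colDig d) i j⟩

theorem corner_emod (k : ℕ) (a : ℤ) : corner k a % (4 * W k) = W k := by
  have := W_pos k
  exact emod_of_eq (by linarith) (by linarith)

theorem valid_canonY (d : ℕ → Fin 4)
    (h : ∀ k x y, x % (4 * W k) = W k → y % (4 * W k) = W k → ∀ n : ℕ, n < 2 * W k →
      ¬ M.halt (run M (colDig d) k x y n).1) (h0 : ¬ M.halt M.q0) : Valid (canonY M d) := by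
  intro i j
  refine ⟨(rule1_canon d i j).1, (rule1_canon d i j).2, ?_, ?_⟩
  · have := rule2_labels (M := M) (w := colDig d) i j
    simp only [canonY, canon, wallOf_lineAt]
    rwa [lineAt_dig]
  · by_cases hl : ∃ k, Lane k i j
    · obtain ⟨k, hl⟩ := hl
      have ej := sub_corner k j
      have := hl.2
      simp only [canonY]
      rw [labelV_lane_of hl]
      exact h k _ _ (corner_emod k i) (corner_emod k j) _ (by omega)
    · simpa [canonY, labelV, dif_neg hl] using h0

theorem lineAt_congr {d d' : ℕ → Fin 4} {n : ℕ} (hd : ∀ t, 2 * t + 1 < n → d t = d' t) {a : ℤ}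
    (ha : ¬ (2 : ℤ) ^ n ∣ a) (b : ℤ) : lineAt d a b = lineAt d' a b := by
  obtain ⟨l, hl, hL⟩ := exists_lev ha
  have : digOf d (lev a) = digOf d' (lev a) := by
    rw [hL.lev_eq]
    rcases l with _ | l
    · rfl
    · exact hd _ (by omega)
  rw [lineAt, lineAt, this]

theorem not_two_pow_dvd (k : ℕ) {n : ℕ} (hn : 2 * k + 3 ≤ n) {a p : ℤ} (h0 : 4 * W k * p < a)
    (h1 : a < 4 * W k * p + 4 * W k) : ¬ (2 : ℤ) ^ n ∣ a := by
  intro h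
  have e : (2 : ℤ) ^ (2 * k + 3) = 4 * W k := by unfold W; ring
  exact no_dvd_between (e ▸ (pow_dvd_pow 2 hn).trans h) h0 h1

/-- The labels in a board of a valid configuration are the canonical ones. -/
theorem Valid.labels {y : ℤ → ℤ → Sym M} (h : Valid y) {n : ℕ} {x z : ℤ}
    (hs : Str (fun i j => (y i j).s) n x z) {k : ℕ} (hk : 2 * k + 3 ≤ n) {d : ℕ → Fin 4}
    (hd : ∀ t, 2 * t + 1 < n → digits (fun i j => (y i j).s) x z t = d t) {p q A B : ℤ}
    (hA : A = 4 * W k * p + W k) (hB : B = 4 * W k * q + W k) :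
    (∀ s r : ℕ, s < 2 * W k → r ≤ 2 * W k →
      (y (x + (A + s)) (z + (B + r))).e = labelH M (colDig d) (A + s) (B + r)) ∧
    ∀ s r : ℕ, s ≤ 2 * W k → r < 2 * W k →
      (y (x + (A + s)) (z + (B + r))).f = labelV M (colDig d) (A + s) (B + r) := by
  have hW := W_pos k
  have hW2 := W_two_le k
  obtain ⟨N, hN⟩ : ∃ N : ℕ, (N : ℤ) = 2 * W k := ⟨(2 * W k).toNat, by omega⟩
  have hm : ∀ c p r : ℤ, c = 4 * W k * p + r → 0 ≤ r → r < 4 * W k → c % (4 * W k) = r :=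
    fun c p r hc h0 h1 => hc ▸ emod_of_eq h0 h1
  have em : ∀ (C p : ℤ) (s : ℕ), C = 4 * W k * p + W k → s ≤ N →
      (C + s) % (4 * W k) = W k + s := fun C p s hC hs =>
    hm _ p _ (by rw [hC]; ring) (by omega) (by omega)
  have rng : ∀ (C p : ℤ) (s : ℕ), C = 4 * W k * p + W k → s ≤ N → Rng k (C + s) :=
    fun C p s hC hs => by unfold Rng; rw [em C p s hC hs]; omega
  have e0 : ∀ C p : ℤ, C = 4 * W k * p + W k → C % (4 * W k) = W k := fun C p hC =>
    hm _ p _ hC (by omega) (by omega)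
  have e1 : ∀ C p : ℤ, C = 4 * W k * p + W k → (C + N) % (4 * W k) = 3 * W k := fun C p hC => by
    rw [em C p N hC le_rfl]; omega
  have hBd : Board (fun i j => wall i j) (fun i j => wall j i) A B N N :=
    ⟨fun s hs => wall_eq_true.2 ⟨k, e0 _ _ hA, rng B q s hB hs⟩,
      fun s hs => wall_eq_false.2 ⟨k, e1 _ _ hA, rng B q s hB hs⟩,
      fun s hs => wall_eq_true.2 ⟨k, e0 _ _ hB, rng A p s hA hs⟩,
      fun s hs => wall_eq_false.2 ⟨k, e1 _ _ hB, rng A p s hA hs⟩⟩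
  have hV : ∀ i j, 4 * W k * p < i → i < 4 * W k * p + 4 * W k →
      (y (x + i) (z + j)).s.V = lineAt d i j := by
    intro i j h0 h1
    have hi := not_two_pow_dvd k hk h0 h1
    have := hs.lineV h.rule1 (i := x + i) (j := z + j) (by rwa [add_sub_cancel_left])
    rw [← lineAt_congr hd hi]
    simpa using this
  have hH : ∀ i j, 4 * W k * q < j → j < 4 * W k * q + 4 * W k →
      (y (x + i) (z + j)).s.H = lineAt d j i := by
    intro i j h0 h1
    have hj := not_two_pow_dvd k hk h0 h1
    have := hs.lineH h.rule1 (i := x + i) (j := z + j) (by rwa [add_sub_cancel_left])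
    rw [← lineAt_congr hd hj]
    simpa using this
  have h1 : RulesOn (fun i j => wall i j) (fun i j => wall j i) (fun i _ => colDig d i)
      (fun i j => (y (x + i) (z + j)).e) (fun i j => (y (x + i) (z + j)).f) A B N N := by
    intro s hsN t htN
    have := (h (x + (A + s)) (z + (B + t))).comp
    rw [show z + (B + (t : ℤ)) - 1 = z + (B + t - 1) by ring,
      show x + (A + (s : ℤ)) - 1 = x + (A + s - 1) by ring,
      show x + (A + (s : ℤ)) + 1 = x + (A + s + 1) by ring,
      hV _ _ (by omega) (by omega), hV _ _ (by omega) (by omega), hV _ _ (by omega) (by omega),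
      hH _ _ (by omega) (by omega), hH _ _ (by omega) (by omega), wallOf_lineAt, wallOf_lineAt,
      lineAt_dig] at this
    exact this
  have h2 : RulesOn (fun i j => wall i j) (fun i j => wall j i) (fun i _ => colDig d i)
      (labelH M (colDig d)) (labelV M (colDig d)) A B N N :=
    fun s _ t _ => rule2_labels _ _
  have key := hBd.rigid h1 h2
  exact ⟨fun s r hs hr => key.1 s (by omega) r (by omega),
    fun s r hs hr => key.2 s (by omega) r (by omega)⟩

/-- The machine does not halt on the boards of a valid configuration. -/
theorem Valid.not_halt {y : ℤ → ℤ → Sym M} (h : Valid y) {n : ℕ} {x z : ℤ}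
    (hs : Str (fun i j => (y i j).s) n x z) {k : ℕ} (hk : 2 * k + 3 ≤ n) (r : ℕ)
    (hr : r < 2 * W k) : ¬ M.halt (run M (colDig (digits (fun i j => (y i j).s) x z)) k (W k) (W k)
      r).1 := by
  have hW := W_pos k
  obtain ⟨N, hN⟩ : ∃ N : ℕ, (N : ℤ) = 2 * W k := ⟨(2 * W k).toNat, by omega⟩
  have key := (h.labels hs hk (fun _ _ => rfl) (p := 0) (q := 0) (A := W k) (B := W k) (by ring)
    (by ring)).2 N r hN.le hr
  have hm : ∀ c : ℤ, 0 ≤ c → c < 4 * W k → c % (4 * W k) = c := fun c h0 h1 =>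
    Int.emod_eq_of_lt h0 h1
  have hl : Lane k (W k + N) (W k + r) := by
    refine ⟨?_, ?_, ?_⟩ <;> rw [hm _ (by omega) (by omega)] <;> omega
  have hc : ∀ c : ℤ, 0 ≤ c → c < 4 * W k → corner k c = W k := fun c h0 h1 => by
    rw [corner, Int.ediv_eq_zero_of_lt h0 h1]; ring
  have := labelV_lane_of (M := M) (w := colDig (digits (fun i j => (y i j).s) x z)) hl
  rw [← key, hc _ (by omega) (by omega), hc _ (by omega) (by omega), add_sub_cancel_left,
    Int.toNat_natCast] at this
  rw [← this]
  exact (h _ _).run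

theorem RuleAt.congr {y y' : ℤ → ℤ → Sym M} {i j i' j' : ℤ} (h : RuleAt y i j)
    (he : ∀ a b, -1 ≤ a → a ≤ 1 → -1 ≤ b → b ≤ 1 → y (i + a) (j + b) = y' (i' + a) (j' + b)) :
    RuleAt y' i' j' := by
  have e0 := he 0 0 (by omega) (by omega) (by omega) (by omega)
  have e1 := he 1 0 (by omega) (by omega) (by omega) (by omega)
  have e2 := he 0 1 (by omega) (by omega) (by omega) (by omega)
  have e3 := he (-1) 0 (by omega) (by omega) (by omega) (by omega)
  have e4 := he 0 (-1) (by omega) (by omega) (by omega) (by omega)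
  simp only [add_zero, ← sub_eq_add_neg] at e0 e1 e2 e3 e4
  obtain ⟨h1, h2, h3, h4⟩ := h
  rw [e0, e1, e2] at h1 h2
  rw [e0, e1, e3, e4] at h3
  rw [e0] at h4
  exact ⟨h1, h2, h3, h4⟩

end

/-- A register machine with an oracle. In state `s` it compares two registers, queries the oracle,
and updates all registers in parallel. -/
structure Prog where
  S : Type
  finS : Finite S
  R : Type
  finR : Finite R
  start : S
  tA : S → R
  tB : S → R
  oA : S → R
  upd : S → R → Option (R × Bool)
  nxt : S → Bool → Fin 4 → S
  halt : S → Prop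

attribute [instance] Prog.finS Prog.finR

namespace Prog
variable (P : Prog)

abbrev Conf := P.S × (P.R → ℕ)

/-- The new value of a register. -/
def val {R : Type} (r : R → ℕ) : Option (R × Bool) → ℕ
  | none => 0
  | some (b, i) => r b + i.toNat

variable {P} in
def step (O : ℕ → Fin 4) (c : P.Conf) : P.Conf :=
  (P.nxt c.1 (decide (c.2 (P.tA c.1) = c.2 (P.tB c.1))) (O (c.2 (P.oA c.1))),
    fun a => val c.2 (P.upd c.1 a))

/-- The configuration after `n` steps. -/
def conf (O : ℕ → Fin 4) (n : ℕ) : P.Conf := (step O)^[n] (P.start, fun _ => 0)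

theorem conf_succ (O : ℕ → Fin 4) (n : ℕ) : P.conf O (n + 1) = step O (P.conf O n) :=
  Function.iterate_succ_apply' _ _ _

theorem conf_le (O : ℕ → Fin 4) (n : ℕ) (a : P.R) : (P.conf O n).2 a ≤ n := by
  induction n generalizing a with
  | zero => rfl
  | succ n ih =>
    rw [conf_succ, step]
    dsimp only
    rcases P.upd (P.conf O n).1 a with _ | ⟨b, i⟩
    · simp [val]
    · have := ih b
      have : i.toNat ≤ 1 := by cases i <;> simp
      simp only [val]; omega

/-- The board machine executing a program, one step every second free row. -/
abbrev toMach : Mach where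
  Q := P.S × Bool
  C := (P.R → Bool) × Bool × Fin 4
  V := P.R → Bool
  finQ := inferInstance
  finC := inferInstance
  finV := inferInstance
  q0 := (P.start, false)
  v0 := fun _ => true
  entry := fun _ => (fun _ => false, false, 0)
  stepC := fun q c v w => (v, c.2.1 || v (P.tA q.1) != v (P.tB q.1),
    if c.1 (P.oA q.1) = false ∧ v (P.oA q.1) = true then w else c.2.2)
  stepV := fun q c v _ => if q.2 then fun a => match P.upd q.1 a with
      | none => true
      | some (b, true) => c.1 b
      | some (b, false) => v b
    else v
  fin := fun q c => if q.2 then (P.nxt q.1 (!c.2.1) c.2.2, false) else (q.1, true)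
  halt := fun q => P.halt q.1

section simulation
variable (w : ℤ → Fin 4) (k : ℕ) (x y : ℤ)

open scoped Classical in
/-- The number of free lines among the first `n` lines after `x`. -/
noncomputable def rank (n : ℕ) : ℕ := Nat.count (fun j : ℕ => FreeLine k (x + j + 1)) n

theorem rank_succ_of {n : ℕ} (h : FreeLine k (x + n + 1)) : rank k x (n + 1) = rank k x n + 1 := by
  simp [rank, Nat.count_succ, h]

theorem rank_succ_of_not {n : ℕ} (h : ¬ FreeLine k (x + n + 1)) :
    rank k x (n + 1) = rank k x n := by
  simp [rank, Nat.count_succ, h]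

/-- The digits attached to free columns. -/
noncomputable def oracle (n : ℕ) : Fin 4 :=
  w (x + Nat.nth (fun j : ℕ => FreeLine k (x + j + 1)) n + 1)

theorem oracle_rank {n : ℕ} (h : FreeLine k (x + n + 1)) :
    oracle w k x (rank k x n) = w (x + n + 1) := by
  classical
  rw [oracle, rank, Nat.nth_count (p := fun j : ℕ => FreeLine k (x + j + 1)) h]

variable {w k x y}

theorem rowC_toMach {q : P.S × Bool} {v : ℤ → P.R → Bool} {r : P.R → ℕ}
    (hv : ∀ j : ℕ, FreeLine k (x + j + 1) →
      v (x + j + 1) = fun a => decide (r a ≤ rank k x j)) (n : ℕ) :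
    rowC P.toMach w k x q v n = (fun a => decide (r a < rank k x n),
      decide (r (P.tA q.1) ≠ r (P.tB q.1) ∧
        (r (P.tA q.1) < rank k x n ∨ r (P.tB q.1) < rank k x n)),
      if r (P.oA q.1) < rank k x n then oracle w k x (r (P.oA q.1)) else 0) := by
  induction n with
  | zero => simp [rowC, rank, toMach]
  | succ n ih =>
    rw [rowC, ih]
    by_cases h : FreeLine k (x + n + 1)
    · rw [if_pos h, rank_succ_of _ _ h, hv n h, ← oracle_rank w k x h]
      simp only [toMach]
      refine Prod.ext ?_ (Prod.ext ?_ ?_)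
      · funext a; simp
      · rw [Bool.eq_iff_iff]
        simp only [Bool.or_eq_true, decide_eq_true_eq, bne_iff_ne, ne_eq, decide_eq_decide]
        omega
      · simp only [decide_eq_false_iff_not, decide_eq_true_eq]
        split_ifs with h1 h2 h3 h4 h5
        · rw [show r (P.oA q.1) = rank k x n by omega]
        · omega
        · rfl
        · omega
        · omega
        · rfl
    · rw [if_neg h, rank_succ_of_not _ _ h]

theorem run_toMach {N : ℕ} (hN : (N : ℤ) = 2 * W k - 1) {n : ℕ}
    (hn : rank k y n ≤ rank k x N) :
    (run P.toMach w k x y n).1 =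
      ((P.conf (oracle w k x) (rank k y n / 2)).1, decide (rank k y n % 2 = 1)) ∧
    ∀ j : ℕ, FreeLine k (x + j + 1) → (run P.toMach w k x y n).2 (x + j + 1) =
      fun a => decide ((P.conf (oracle w k x) (rank k y n / 2)).2 a ≤ rank k x j) := by
  induction n with
  | zero => exact ⟨by simp [run, rank, conf, toMach], fun j _ => by
      simp [run, rank, conf, toMach]⟩
  | succ n ih =>
    by_cases h : FreeLine k (y + n + 1)
    · rw [rank_succ_of _ _ h] at hn ⊢
      obtain ⟨h1, h2⟩ := ih (by omega)
      set c := P.conf (oracle w k x) (rank k y n / 2) with hc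
      have hle : ∀ a, c.2 a < rank k x N := fun a =>
        (P.conf_le (oracle w k x) (rank k y n / 2) a).trans_lt (by omega)
      have hrow := fun m => P.rowC_toMach (w := w) (q := (run P.toMach w k x y n).1) h2 m
      have e1 : (2 * W k - 1).toNat = N := by omega
      have e2 : ∀ j : ℕ, (x + j + 1 - 1 - x).toNat = j := fun j => by omega
      rcases Nat.mod_two_eq_zero_or_one (rank k y n) with h0 | h0
      · have e3 : (rank k y n + 1) / 2 = rank k y n / 2 := by omega
        have e4 : (rank k y n + 1) % 2 = 1 := by omega
        rw [e3, e4, ← hc]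
        simp only [h0] at h1
        constructor
        · simp only [run, if_pos h]
          rw [h1]; rfl
        · intro j hj
          simp only [run, if_pos h, if_pos hj]
          rw [← h2 j hj, h1]; rfl
      · have e3 : (rank k y n + 1) / 2 = rank k y n / 2 + 1 := by omega
        have e4 : (rank k y n + 1) % 2 = 0 := by omega
        rw [e3, e4, conf_succ, ← hc]
        simp only [h0] at h1
        rw [h1] at hrow
        dsimp only at hrow
        constructor
        · simp only [run, if_pos h]
          rw [h1, e1, hrow]
          simp only [step]
          simp [hle]
        · intro j hj
          simp only [run, if_pos h, if_pos hj]
          rw [e2, h1, hrow, h2 j hj]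
          simp only [step]
          funext a
          simp only [decide_true, if_true]
          split <;> rename_i hu <;> simp only [hu]
          · simp [val]
          · simp [val]
          · simp [val]
    · rw [rank_succ_of_not _ _ h] at hn ⊢
      obtain ⟨h1, h2⟩ := ih hn
      rw [← h1]
      constructor
      · simp only [run, if_neg h]
      · intro j hj
        simp only [run, if_neg h]
        exact h2 j hj

end simulation
end Prog

theorem rng_add (t : ℕ) {a p : ℤ} (h : 4 * W t ∣ p) : Rng t (p + a) ↔ Rng t a := by
  obtain ⟨c, rfl⟩ := h
  rw [Rng, Rng, Int.mul_add_emod_self_left]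

theorem freeLine_add (k : ℕ) {a p : ℤ} (h : W k ∣ p) : FreeLine k (p + a) ↔ FreeLine k a :=
  forall₂_congr fun _ ht => not_congr (rng_add _ ((W_dvd ht).trans h))

open scoped Classical in
/-- The number of free lines of order `k` among the first `n` integers. -/
noncomputable def freeCount (k n : ℕ) : ℕ := Nat.count (fun j : ℕ => FreeLine k j) n

theorem natCast_two_pow (k : ℕ) : ((2 ^ (2 * k + 1) : ℕ) : ℤ) = W k := by
  unfold W; push_cast; rfl

theorem freeLine_succ (k : ℕ) (b : ℤ) : FreeLine (k + 1) b ↔ FreeLine k b ∧ ¬ Rng k b := by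
  unfold FreeLine
  constructor
  · exact fun h => ⟨fun t ht => h t (by omega), h k (by omega)⟩
  · rintro ⟨h, h'⟩ t ht
    rcases Nat.lt_succ_iff_lt_or_eq.1 ht with h1 | rfl
    · exact h t h1
    · exact h'

theorem freeCount_W (k : ℕ) : freeCount k (2 ^ (2 * k + 1)) = 2 ^ k + 1 := by
  classical
  induction k with
  | zero =>
    unfold freeCount
    rw [(Nat.count_iff_forall (p := fun j : ℕ => FreeLine 0 (j : ℤ))).2 (fun _ _ t ht => by omega)]
    norm_num
  | succ k ih =>
    have hW := W_pos k
    set w := 2 ^ (2 * k + 1) with hw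
    have hwW : (w : ℤ) = W k := natCast_two_pow k
    have hw1 : 1 ≤ w := Nat.one_le_two_pow
    have e : 2 ^ (2 * (k + 1) + 1) = w + ((2 * w + 1) + (w - 1)) := by
      rw [show 2 * (k + 1) + 1 = 2 * k + 1 + 2 by ring, pow_add, ← hw]; omega
    have hr : ∀ j : ℕ, j < 4 * w → (Rng k j ↔ w ≤ j ∧ j ≤ 3 * w) := fun j hj => by
      rw [Rng, Int.emod_eq_of_lt (by omega) (by omega)]; omega
    rw [e, freeCount, Nat.count_add, Nat.count_add]
    have h1 : Nat.count (fun j : ℕ => FreeLine (k + 1) (j : ℤ)) w = 2 ^ k + 1 := by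
      rw [← ih, freeCount]
      simp only [Nat.count_eq_card_filter_range]
      congr 1
      refine Finset.filter_congr fun j hj => ?_
      rw [Finset.mem_range] at hj
      rw [freeLine_succ, hr j (by omega)]
      exact and_iff_left (by omega)
    have h2 : Nat.count (fun j : ℕ => FreeLine (k + 1) ((w + j : ℕ) : ℤ)) (2 * w + 1) = 0 := by
      rw [Nat.count_iff_forall_not]
      intro j hj
      rw [freeLine_succ, hr _ (by omega)]
      rintro ⟨-, h⟩
      exact h (by omega)
    have h3 : Nat.count (fun j : ℕ => FreeLine (k + 1) ((w + (2 * w + 1 + j) : ℕ) : ℤ)) (w - 1)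
        = 2 ^ k := by
      have h4 : freeCount k (1 + (w - 1)) = 2 ^ k + 1 := by
        rw [← ih]; congr 1; omega
      rw [freeCount, Nat.count_add] at h4
      have h5 : Nat.count (fun j : ℕ => FreeLine k (j : ℤ)) 1 = 1 := by
        rw [Nat.count_iff_forall]
        intro j hj
        obtain rfl : j = 0 := by omega
        exact fun t _ => not_rng_of_dvd (dvd_zero _)
      rw [h5, add_comm, Nat.add_right_cancel_iff] at h4
      rw [← h4]
      simp only [Nat.count_eq_card_filter_range]
      congr 1
      refine Finset.filter_congr fun j hj => ?_
      rw [Finset.mem_range] at hj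
      rw [freeLine_succ, hr _ (by omega), and_iff_left (by omega),
        ← freeLine_add k (p := 3 * W k) (a := ((1 + j : ℕ) : ℤ)) (Dvd.intro_left _ rfl), ← hwW]
      push_cast
      ring_nf
    rw [h1]
    have h2' := h2
    have h3' := h3
    simp only [Nat.add_assoc] at h2' h3' ⊢
    rw [h2', h3']
    ring

namespace Prog

theorem rank_eq {k : ℕ} {x : ℤ} (hx : W k ∣ x) (n : ℕ) :
    rank k x n + 1 = freeCount k (n + 1) := by
  classical
  rw [freeCount, add_comm n 1, Nat.count_add]
  have h5 : Nat.count (fun j : ℕ => FreeLine k (j : ℤ)) 1 = 1 := by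
    rw [Nat.count_iff_forall]
    intro j hj
    obtain rfl : j = 0 := by omega
    exact fun t _ => not_rng_of_dvd (dvd_zero _)
  rw [h5, add_comm, rank]
  congr 1
  simp only [Nat.count_eq_card_filter_range]
  congr 1
  refine Finset.filter_congr fun j hj => ?_
  rw [add_assoc, freeLine_add k hx]
  push_cast
  rw [add_comm]

theorem rank_total {k : ℕ} {x : ℤ} (hx : W k ∣ x) {N : ℕ} (hN : (N : ℤ) = 2 * W k - 1) :
    rank k x N = 2 ^ (k + 1) + 1 := by
  classical
  have h := rank_eq hx N
  have e : N + 1 = 2 ^ (2 * k + 1) + 2 ^ (2 * k + 1) := by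
    have := natCast_two_pow k; omega
  have h2 : Nat.count (fun j : ℕ => FreeLine k ((2 ^ (2 * k + 1) + j : ℕ) : ℤ)) (2 ^ (2 * k + 1))
      = 2 ^ k + 1 := by
    rw [← freeCount_W k, freeCount]
    simp only [Nat.count_eq_card_filter_range]
    congr 1
    refine Finset.filter_congr fun j hj => ?_
    rw [Nat.cast_add, natCast_two_pow, freeLine_add k dvd_rfl]
  rw [e, freeCount, Nat.count_add, h2, ← freeCount, freeCount_W] at h
  rw [pow_succ]; omega

theorem freeLine_W_sub_one {k t : ℕ} : FreeLine k (W t - 1) := by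
  have hWt := W_pos t
  intro s hs hr
  have hWs := W_pos s
  rcases lt_or_ge s t with h | h
  · rw [sub_eq_add_neg, rng_add s (W_dvd h)] at hr
    have : (-1 : ℤ) % (4 * W s) = 4 * W s - 1 := by
      have := emod_of_eq (M := 4 * W s) (q := -1) (r := 4 * W s - 1) (by linarith) (by linarith)
      rw [← this]; congr 1; ring
    rw [Rng, this] at hr
    have := W_two_le s
    omega
  · have : W t ≤ W s := by
      unfold W; exact pow_le_pow_right₀ (by norm_num) (by omega)
    rw [Rng, Int.emod_eq_of_lt (by linarith) (by linarith)] at hr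
    linarith [hr.1]

theorem rank_pow {k t : ℕ} (ht : t ≤ k) {x : ℤ} (hx : W k ∣ x) {n : ℕ} (hn : (n : ℤ) = W t - 2) :
    rank k x n = 2 ^ t - 1 := by
  classical
  have h := rank_eq hx n
  have e := freeCount_W t
  have e' : 2 ^ (2 * t + 1) = n + 1 + 1 := by
    have := natCast_two_pow t; omega
  have h2 : freeCount k (n + 1) = freeCount t (n + 1) := by
    simp only [freeCount, Nat.count_eq_card_filter_range]
    congr 1
    refine Finset.filter_congr fun j hj => ?_
    rw [Finset.mem_range] at hj
    refine ⟨fun hf s hs => hf s (by omega), fun hf s hs => ?_⟩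
    rcases lt_or_ge s t with h | h
    · exact hf s h
    · have : W t ≤ W s := by
        unfold W; exact pow_le_pow_right₀ (by norm_num) (by omega)
      rw [Rng, Int.emod_eq_of_lt (by omega) (by omega)]
      omega
  have h3 : freeCount t (n + 1 + 1) = freeCount t (n + 1) + 1 := by
    have : FreeLine t ((n + 1 : ℕ) : ℤ) := by
      rw [show ((n + 1 : ℕ) : ℤ) = W t - 1 by push_cast; omega]
      exact freeLine_W_sub_one
    simp only [freeCount]
    rw [Nat.count_succ, if_pos this]
  rw [e', h3] at e
  omega

theorem lev_add_W {k t : ℕ} (ht : t ≤ k) {x : ℤ} (hx : x % (4 * W k) = W k) :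
    digOf d (lev (x + W t)) = d t := by
  have hW := W_pos k
  rcases ht.eq_or_lt with rfl | h
  · have : Lev (2 * t + 2) (x + W t) := by
      have e := Int.emod_add_mul_ediv x (4 * W t)
      rw [hx] at e
      rw [show x + W t = W t * (2 + 4 * (x / (4 * W t))) by linear_combination -e]
      unfold Lev
      rw [show (2 : ℤ) ^ (2 * t + 2 + 1) = W t * 4 by unfold W; ring,
        show (2 : ℤ) ^ (2 * t + 2) = W t * 2 by unfold W; ring,
        Int.mul_dvd_mul_iff_left hW.ne', Int.mul_dvd_mul_iff_left hW.ne']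
      omega
    rw [this.lev_eq, digOf, show (2 * t + 1) / 2 = t by omega]
  · have : Lev (2 * t + 1) (x + W t) := by
      apply lev_of_emod
      left
      have : 4 * W t ∣ x := (W_dvd h).trans (W_dvd_of_emod (Or.inl hx))
      obtain ⟨c, rfl⟩ := this
      have := W_pos t
      rw [emod_of_eq (by linarith) (by linarith)]
    rw [this.lev_eq, digOf, show (2 * t) / 2 = t by omega]

theorem oracle_pow (d : ℕ → Fin 4) {k t : ℕ} (ht : t ≤ k) {x : ℤ} (hx : x % (4 * W k) = W k) :
    oracle (colDig d) k x (2 ^ t - 1) = d t := by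
  have h2 := W_two_le t
  obtain ⟨n, hn⟩ : ∃ n : ℕ, (n : ℤ) = W t - 2 := ⟨(W t - 2).toNat, by omega⟩
  have hd : W k ∣ x := W_dvd_of_emod (Or.inl hx)
  have hf : FreeLine k (x + n + 1) := by
    rw [add_assoc, freeLine_add k hd, hn, show W t - 2 + 1 = W t - 1 by ring]
    exact freeLine_W_sub_one
  rw [← rank_pow ht hd hn, oracle_rank _ _ _ hf, hn, colDig, lineAt,
    show x + (W t - 2) + 1 + 1 = x + W t by ring]
  have hne : x + W t ≠ 0 := by
    intro h0
    have h1 := W_pos t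
    have h4 := W_pos k
    have h3 : W t ≤ W k := by unfold W; exact pow_le_pow_right₀ (by norm_num) (by omega)
    have e := Int.emod_add_mul_ediv x (4 * W k)
    rw [hx] at e
    rcases le_or_gt 0 (x / (4 * W k)) with h5 | h5
    · nlinarith
    · nlinarith
  rw [if_neg hne]
  exact lev_add_W ht hx

variable (P : Prog)

theorem conf_congr {O O' : ℕ → Fin 4} {n : ℕ} (h : ∀ X < n, O X = O' X) :
    P.conf O n = P.conf O' n := by
  induction n with
  | zero => rfl
  | succ n ih =>
    rw [conf_succ, conf_succ, ← ih fun X hX => h X (by omega)]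
    rw [step, step, h _ ((P.conf_le O n _).trans_lt (by omega))]

/-- A board of level `k` simulates `2 ^ k` steps of the program. -/
theorem board_halt (d : ℕ → Fin 4) {k : ℕ} {x y : ℤ} (hx : x % (4 * W k) = W k)
    (hy : y % (4 * W k) = W k) : ∃ O : ℕ → Fin 4, (∀ t, O (2 ^ t - 1) = d t) ∧
    ((∀ n : ℕ, n < 2 * W k → ¬ P.toMach.halt (run P.toMach (colDig d) k x y n).1) ↔
      ∀ n ≤ 2 ^ k, ¬ P.halt (P.conf O n).1) := by
  have hdx : W k ∣ x := W_dvd_of_emod (Or.inl hx)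
  have hdy : W k ∣ y := W_dvd_of_emod (Or.inl hy)
  have hW := W_two_le k
  obtain ⟨N, hN⟩ : ∃ N : ℕ, (N : ℤ) = 2 * W k - 1 := ⟨(2 * W k - 1).toNat, by omega⟩
  set O := oracle (colDig d) k x with hO
  have hinj : ∀ t s, 2 ^ t - 1 = 2 ^ s - 1 → t = s := fun t s h => by
    have h1 := Nat.one_le_two_pow (n := t)
    have h2 := Nat.one_le_two_pow (n := s)
    exact Nat.pow_right_injective le_rfl (show 2 ^ t = 2 ^ s by omega)
  classical
  refine ⟨fun X => if h : ∃ t, X = 2 ^ t - 1 then d h.choose else O X, fun t => ?_, ?_⟩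
  · have h : ∃ s, 2 ^ t - 1 = 2 ^ s - 1 := ⟨t, rfl⟩
    exact (dif_pos h).trans (congrArg d (hinj _ _ h.choose_spec).symm)
  · have hmono : Monotone (rank k y) := fun a b h => Nat.count_monotone _ h
    have htot := rank_total hdy hN
    have hconf : ∀ n ≤ 2 ^ k, P.conf (fun X => if h : ∃ t, X = 2 ^ t - 1 then d h.choose else O X) n
        = P.conf O n := by
      intro n hn
      apply conf_congr
      intro X hX
      split_ifs with h
      · have h1 := h.choose_spec
        have hle : h.choose ≤ k := by
          by_contra hc
          have : 2 ^ (k + 1) ≤ 2 ^ h.choose := Nat.pow_le_pow_right (by norm_num) (by omega)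
          have := Nat.one_le_two_pow (n := k)
          rw [pow_succ] at *
          omega
        rw [← oracle_pow d hle hx, ← h1]
      · rfl
    have hrun : ∀ n ≤ N, (run P.toMach (colDig d) k x y n).1 =
        ((P.conf O (rank k y n / 2)).1, decide (rank k y n % 2 = 1)) := fun n hn =>
      (P.run_toMach hN ((hmono hn).trans (by rw [htot, rank_total hdx hN]))).1
    have hlast : ∀ n ≤ N, rank k y n / 2 ≤ 2 ^ k := fun n hn => by
      have := hmono hn
      rw [htot, pow_succ] at this
      omega
    have key : ∀ τ ≤ rank k y N, ∃ n ≤ N, rank k y n = τ := by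
      clear htot hrun hlast hN
      induction N with
      | zero => intro τ hτ; exact ⟨0, le_rfl, by simp [rank] at hτ ⊢; omega⟩
      | succ N ih =>
        intro τ hτ
        by_cases h : τ ≤ rank k y N
        · obtain ⟨n, hn, h⟩ := ih τ h
          exact ⟨n, by omega, h⟩
        · refine ⟨N + 1, le_rfl, ?_⟩
          by_cases hf : FreeLine k (y + N + 1)
          · rw [rank_succ_of _ _ hf] at hτ ⊢; omega
          · rw [rank_succ_of_not _ _ hf] at hτ; omega
    constructor
    · intro h n hn
      rw [hconf n hn]
      obtain ⟨i, hi, he⟩ := key (2 * n) (by rw [htot, pow_succ]; omega)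
      have := h i (by omega)
      rw [hrun i hi, he, Nat.mul_div_cancel_left _ (by norm_num)] at this
      exact this
    · intro h n hn
      have hn' : n ≤ N := by omega
      rw [hrun n hn']
      have := h _ (hlast n hn')
      rwa [hconf _ (hlast n hn')] at this

end Prog

/-- The instructions of a register machine; control leaves the table at `none`. -/
structure Table (S R : Type) where
  tA : S → R
  tB : S → R
  oA : S → R
  upd : S → R → Option (R × Bool)
  nxt : S → Bool → Fin 4 → Option S

namespace Table
variable {S R S' R' : Type}

/-- Execution of a given number of steps. -/
inductive Exec (T : Table S R) (O : ℕ → Fin 4) :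
    ℕ → Option S → (R → ℕ) → Option S → (R → ℕ) → Prop
  | refl (s r) : Exec T O 0 s r s r
  | step {n s r s' r'} : Exec T O n (T.nxt s (decide (r (T.tA s) = r (T.tB s))) (O (r (T.oA s))))
      (fun a => Prog.val r (T.upd s a)) s' r' → Exec T O (n + 1) (some s) r s' r'

variable {T : Table S R} {T' : Table S' R'} {O : ℕ → Fin 4}

theorem Exec.trans {m n : ℕ} {s s' s'' : Option S} {r r' r'' : R → ℕ} (h : T.Exec O m s r s' r')
    (h' : T.Exec O n s' r' s'' r'') : T.Exec O (m + n) s r s'' r'' := by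
  induction h with
  | refl => rwa [zero_add]
  | step _ ih => rw [add_right_comm]; exact .step (ih h')

/-- `T'` contains a copy of `T` that leaves to `X`. -/
structure Emb (T : Table S R) (T' : Table S' R') (eS : S → S') (eR : R → R') (X : Option S') :
    Prop where
  inj : Function.Injective eR
  tA : ∀ s, T'.tA (eS s) = eR (T.tA s)
  tB : ∀ s, T'.tB (eS s) = eR (T.tB s)
  oA : ∀ s, T'.oA (eS s) = eR (T.oA s)
  upd : ∀ s a, T'.upd (eS s) (eR a) = (T.upd s a).map (Prod.map eR id)
  keep : ∀ s b, (∀ a, eR a ≠ b) → T'.upd (eS s) b = some (b, false)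
  nxt : ∀ s β o, T'.nxt (eS s) β o = (T.nxt s β o).elim X (fun s => some (eS s))

theorem Emb.exec {eS : S → S'} {eR : R → R'} {X : Option S'} (h : T.Emb T' eS eR X) {n : ℕ}
    {s : Option S} {r r' : R → ℕ} (he : T.Exec O n s r none r') (ρ : R' → ℕ) :
    T'.Exec O n (s.elim X (fun s => some (eS s))) (Function.extend eR r ρ) X
      (Function.extend eR r' ρ) := by
  generalize hs : (none : Option S) = s' at he
  induction he with
  | refl => subst hs; exact .refl _ _
  | @step n s r s' r' _ ih =>
    have := ih hs
    refine .step ?_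
    simp only [h.tA, h.tB, h.oA, h.inj.extend_apply, h.nxt]
    convert this using 1
    funext b
    by_cases hb : ∃ a, eR a = b
    · obtain ⟨a, rfl⟩ := hb
      rw [h.inj.extend_apply, h.upd]
      rcases T.upd s a with _ | ⟨c, i⟩
      · rfl
      · simp [Prog.val, h.inj.extend_apply]
    · rw [h.keep s b (fun a ha => hb ⟨a, ha⟩)]
      simp [Prog.val, Function.extend_apply' _ _ _ hb]

end Table

/-- A table computing a function of several registers. -/
structure Frag (ι : Type) (f : (ι → ℕ) → ℕ) where
  S : Type
  R : Type
  finS : Finite S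
  finR : Finite R
  T : Table S R
  start : S
  inp : ι → R
  inj : Function.Injective inp
  out : R
  spec : ∀ r : R → ℕ, ∃ n r', r' out = f (fun i => r (inp i)) ∧
    ∀ O, T.Exec O n (some start) r none r'

attribute [instance] Frag.finS Frag.finR

/-- Execution of an embedded fragment. -/
theorem Frag.call {ι S' R' : Type} {f : (ι → ℕ) → ℕ} (F : Frag ι f) {T' : Table S' R'}
    {eS : F.S → S'} {eR : F.R → R'} {X : Option S'} (h : F.T.Emb T' eS eR X) (ρ : R' → ℕ) :
    ∃ n ρ', ρ' (eR F.out) = f (fun i => ρ (eR (F.inp i))) ∧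
      (∀ b, (∀ a, eR a ≠ b) → ρ' b = ρ b) ∧ ∀ O, T'.Exec O n (some (eS F.start)) ρ X ρ' := by
  obtain ⟨n, r', h1, h2⟩ := F.spec (fun a => ρ (eR a))
  have e : Function.extend eR (fun a => ρ (eR a)) ρ = ρ := by
    funext b
    by_cases hb : ∃ a, eR a = b
    · obtain ⟨a, rfl⟩ := hb
      rw [h.inj.extend_apply]
    · rw [Function.extend_apply' _ _ _ hb]
  have h3 := fun O => h.exec (h2 O) ρ
  rw [e] at h3
  exact ⟨n, _, by rw [h.inj.extend_apply, h1], fun b hb =>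
    Function.extend_apply' _ _ _ (fun ⟨a, ha⟩ => hb a ha), h3⟩

namespace Frag
variable {ι κ κ' : Type}

/-- Computing a constant, a projection or its successor. -/
def basic [Finite ι] (u : Option (ι × Bool)) : Frag ι (fun v => Prog.val v u) where
  S := Unit
  R := Option ι
  finS := inferInstance
  finR := inferInstance
  T := ⟨fun _ => none, fun _ => none, fun _ => none,
    fun _ a => a.elim (u.map (Prod.map some id)) (fun i => some (some i, false)), fun _ _ _ => none⟩
  start := ()
  inp := some
  inj := Option.some_injective _
  out := none
  spec r := ⟨1, _, by rcases u with _ | ⟨i, b⟩ <;> rfl, fun O => .step (.refl _ _)⟩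

/-- Registers for primitive recursion. -/
inductive RecR (ι A B : Type)
  | arg (i : ι)
  | cnt
  | ctr
  | acc
  | base (a : A)
  | step (b : B)

/-- States for primitive recursion. -/
inductive RecS (A B : Type)
  | entry
  | base (a : A)
  | baseDone
  | probe
  | step (b : B)
  | stepDone

instance {ι A B : Type} [Finite ι] [Finite A] [Finite B] : Finite (RecR ι A B) :=
  Finite.of_surjective (fun x : (ι ⊕ A ⊕ B) ⊕ Fin 3 => match x with
    | .inl (.inl i) => .arg i
    | .inl (.inr (.inl a)) => .base a
    | .inl (.inr (.inr b)) => .step b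
    | .inr 0 => .cnt
    | .inr 1 => .ctr
    | .inr 2 => .acc) (by
    rintro (i | _ | _ | _ | a | b)
    exacts [⟨.inl (.inl i), rfl⟩, ⟨.inr 0, rfl⟩, ⟨.inr 1, rfl⟩, ⟨.inr 2, rfl⟩,
      ⟨.inl (.inr (.inl a)), rfl⟩, ⟨.inl (.inr (.inr b)), rfl⟩])

instance {A B : Type} [Finite A] [Finite B] : Finite (RecS A B) :=
  Finite.of_surjective (fun x : (A ⊕ B) ⊕ Fin 4 => match x with
    | .inl (.inl a) => .base a
    | .inl (.inr b) => .step b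
    | .inr 0 => .entry
    | .inr 1 => .baseDone
    | .inr 2 => .probe
    | .inr 3 => .stepDone) (by
    rintro (_ | a | _ | _ | b | _)
    exacts [⟨.inr 0, rfl⟩, ⟨.inl (.inl a), rfl⟩, ⟨.inr 1, rfl⟩, ⟨.inr 2, rfl⟩,
      ⟨.inl (.inr b), rfl⟩, ⟨.inr 3, rfl⟩])

section recursion
variable {f : (κ → ℕ) → ℕ} {g : (κ' → ℕ) → ℕ} (F : Frag κ f) (G : Frag κ' g) (π : κ → ι)
  (π' : κ' → Option (Option ι)) (c : Option ι)

noncomputable abbrev recT : Table (RecS F.S G.S) (RecR ι F.R G.R) where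
  tA s := match s with
    | .base a => .base (F.T.tA a)
    | .step a => .step (G.T.tA a)
    | _ => .ctr
  tB s := match s with
    | .base a => .base (F.T.tB a)
    | .step a => .step (G.T.tB a)
    | _ => .cnt
  oA s := match s with
    | .base a => .base (F.T.oA a)
    | .step a => .step (G.T.oA a)
    | _ => .ctr
  upd s b := match s, b with
    | .entry, .cnt => c.map (fun i => (.arg i, false))
    | .entry, .ctr => none
    | .entry, .base a =>
        Function.extend F.inp (fun j => some (.arg (π j), false)) (fun a => some (.base a, false)) a
    | .base s, .base a => (F.T.upd s a).map (Prod.map .base id)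
    | .baseDone, .acc => some (.base F.out, false)
    | .baseDone, .cnt => some (.cnt, c.isNone)
    | .probe, .step a => Function.extend G.inp
        (fun j => some ((π' j).elim .ctr (fun o => o.elim .acc .arg), false))
        (fun a => some (.step a, false)) a
    | .step s, .step a => (G.T.upd s a).map (Prod.map .step id)
    | .stepDone, .acc => some (.step G.out, false)
    | .stepDone, .ctr => some (.ctr, true)
    | _, b => some (b, false)
  nxt s β o := match s with
    | .entry => some (.base F.start)
    | .base s => (F.T.nxt s β o).elim (some .baseDone) (fun s => some (.base s))
    | .baseDone => some .probe
    | .probe => if β then none else some (.step G.start)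
    | .step s => (G.T.nxt s β o).elim (some .stepDone) (fun s => some (.step s))
    | .stepDone => some .probe

theorem emb_base : F.T.Emb (recT F G π π' c) .base .base (some .baseDone) where
  inj a b h := by cases h; rfl
  tA _ := rfl
  tB _ := rfl
  oA _ := rfl
  upd _ _ := rfl
  keep s b h := by cases b <;> first | rfl | exact absurd rfl (h _)
  nxt _ _ _ := rfl

theorem emb_step : G.T.Emb (recT F G π π' c) .step .step (some .stepDone) where
  inj a b h := by cases h; rfl
  tA _ := rfl
  tB _ := rfl
  oA _ := rfl
  upd _ _ := rfl
  keep s b h := by cases b <;> first | rfl | exact absurd rfl (h _)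
  nxt _ _ _ := rfl

/-- The function computed by primitive recursion. -/
def recF (f : (κ → ℕ) → ℕ) (g : (κ' → ℕ) → ℕ) (π : κ → ι) (π' : κ' → Option (Option ι))
    (v : ι → ℕ) (n : ℕ) : ℕ :=
  Nat.rec (f (fun j => v (π j))) (fun y IH => g fun j => (π' j).elim y (fun o => o.elim IH v)) n

theorem exec_base (ρ : RecR ι F.R G.R → ℕ) : ∃ n ρ', (∀ i, ρ' (.arg i) = ρ (.arg i)) ∧
    ρ' .ctr = 0 ∧ ρ' .cnt = c.elim 1 (fun i => ρ (.arg i)) ∧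
    ρ' .acc = f (fun j => ρ (.arg (π j))) ∧
    ∀ O, (recT F G π π' c).Exec O n (some .entry) ρ (some .probe) ρ' := by
  let ρ₁ : RecR ι F.R G.R → ℕ := fun a => Prog.val ρ ((recT F G π π' c).upd .entry a)
  obtain ⟨n, r', h1, hx, h3⟩ := F.call (emb_base F G π π' c) ρ₁
  refine ⟨_, _, ?_, ?_, ?_, ?_, fun O => .step ((h3 O).trans (.step (.refl _ _)))⟩
  · intro i
    simp [Prog.val, hx, ρ₁]
  · simp [Prog.val, hx, ρ₁]
  · rcases c with _ | i <;> simp [Prog.val, hx, ρ₁]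
  · simp only [Prog.val, h1, Bool.toNat_false, add_zero]
    simp [ρ₁, F.inj.extend_apply, Prog.val]

theorem exec_step (ρ : RecR ι F.R G.R → ℕ) (hne : ρ .ctr ≠ ρ .cnt) : ∃ n ρ',
    (∀ i, ρ' (.arg i) = ρ (.arg i)) ∧ ρ' .ctr = ρ .ctr + 1 ∧ ρ' .cnt = ρ .cnt ∧
    ρ' .acc = g (fun j => (π' j).elim (ρ .ctr)
      (fun o => o.elim (ρ .acc) (fun i => ρ (.arg i)))) ∧
    ∀ O, (recT F G π π' c).Exec O n (some .probe) ρ (some .probe) ρ' := by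
  let ρ₁ : RecR ι F.R G.R → ℕ := fun a => Prog.val ρ ((recT F G π π' c).upd .probe a)
  obtain ⟨n, r', h1, hx, h3⟩ := G.call (emb_step F G π π' c) ρ₁
  have h4 : ∀ O, (recT F G π π' c).Exec O (n + 1 + 1) (some .probe) ρ (some .probe) fun a =>
      Prog.val r' ((recT F G π π' c).upd .stepDone a) := by
    refine fun O => .step ?_
    simp only [hne, decide_false]
    exact (h3 O).trans (.step (.refl _ _))
  refine ⟨_, _, ?_, ?_, ?_, ?_, h4⟩
  · intro i
    simp [Prog.val, hx, ρ₁]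
  · simp [Prog.val, hx, ρ₁]
  · simp [Prog.val, hx, ρ₁]
  · simp only [Prog.val, h1, Bool.toNat_false, add_zero]
    congr 1
    funext j
    simp only [ρ₁, G.inj.extend_apply, Prog.val]
    rcases π' j with _ | _ | i <;> rfl

/-- Primitive recursion. -/
noncomputable def recursion [Finite ι] :
    Frag ι (fun v => recF f g π π' v (c.elim 1 v)) where
  S := RecS F.S G.S
  R := RecR ι F.R G.R
  finS := inferInstance
  finR := inferInstance
  T := recT F G π π' c
  start := .entry
  inp := .arg
  inj a b h := by cases h; rfl
  out := .acc
  spec ρ := by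
    obtain ⟨n, ρ', h1, h2, h3, h4, h5⟩ := exec_base F G π π' c ρ
    rw [← h3]
    have key : ∀ y ≤ ρ' .cnt, ∃ m ρ₁, (∀ i, ρ₁ (.arg i) = ρ (.arg i)) ∧ ρ₁ .ctr = y ∧
        ρ₁ .cnt = ρ' .cnt ∧ ρ₁ .acc = recF f g π π' (fun i => ρ (.arg i)) y ∧
        ∀ O, (recT F G π π' c).Exec O m (some .entry) ρ (some .probe) ρ₁ := by
      intro y
      induction y with
      | zero => exact fun _ => ⟨n, ρ', h1, h2, rfl, h4, h5⟩
      | succ y ih =>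
        intro hy
        obtain ⟨m, ρ₁, g1, g2, g3, g4, g5⟩ := ih (by omega)
        obtain ⟨m', ρ₂, k1, k2, k3, k4, k5⟩ := exec_step F G π π' c ρ₁ (by omega)
        refine ⟨m + m', ρ₂, fun i => (k1 i).trans (g1 i), by omega, by omega, ?_,
          fun O => (g5 O).trans (k5 O)⟩
        rw [k4, g2, g4]
        simp only [g1]
        rfl
    obtain ⟨m, ρ₁, g1, g2, g3, g4, g5⟩ := key _ le_rfl
    have g6 : ∀ O, (recT F G π π' c).Exec O (0 + 1) (some .probe) ρ₁ none fun a =>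
        Prog.val ρ₁ ((recT F G π π' c).upd .probe a) := by
      refine fun O => .step ?_
      simp only [g2, g3, decide_true, if_true]
      exact .refl _ _
    exact ⟨m + (0 + 1), fun a => Prog.val ρ₁ ((recT F G π π' c).upd .probe a), g4,
      fun O => (g5 O).trans (g6 O)⟩

end recursion
section compile

/-- Functions computed by some table. -/
def Comp {ι : Type} (f : (ι → ℕ) → ℕ) : Prop := Nonempty (Frag ι f)

theorem Comp.of_eq {f g : (ι → ℕ) → ℕ} (hf : Comp f) (h : ∀ v, f v = g v) : Comp g :=
  (funext h : f = g) ▸ hf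

theorem comp_basic [Finite ι] (u : Option (ι × Bool)) : Comp fun v : ι → ℕ => Prog.val v u :=
  ⟨basic u⟩

theorem comp_recursion [Finite ι] {f : (κ → ℕ) → ℕ} (hf : Comp f) {g : (κ' → ℕ) → ℕ} (hg : Comp g)
    (π : κ → ι) (π' : κ' → Option (Option ι)) (c : Option ι) :
    Comp fun v => recF f g π π' v (c.elim 1 v) := by
  obtain ⟨F⟩ := hf
  obtain ⟨G⟩ := hg
  exact ⟨recursion F G π π' c⟩

theorem comp_substitute [Finite ι] {f : (Option ι → ℕ) → ℕ} (hf : Comp f) {g : (ι → ℕ) → ℕ}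
    (hg : Comp g) : Comp fun v => f fun o => o.elim (g v) v := by
  refine (comp_recursion hg hf id (fun o => o.elim (some none) fun i => some (some i)) none).of_eq
    fun v => congrArg f ?_
  funext o
  rcases o with _ | i <;> rfl

theorem comp_reindex [Finite ι] {f : (κ → ℕ) → ℕ} (hf : Comp f) (π : κ → ι) :
    Comp fun v : ι → ℕ => f fun j => v (π j) :=
  (comp_recursion (comp_basic (ι := ι) none) hf id (fun j => some (some (π j))) none).of_eq
    fun _ => rfl

theorem comp_comp {m : ℕ} : ∀ {ι : Type} [Finite ι] {f : (ι ⊕ Fin m → ℕ) → ℕ}, Comp f →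
    ∀ {g : Fin m → (ι → ℕ) → ℕ}, (∀ i, Comp (g i)) →
    Comp fun v => f (Sum.elim v fun i => g i v) := by
  induction m with
  | zero =>
    intro ι _ f hf g _
    refine (comp_reindex hf (Sum.elim id finZeroElim)).of_eq fun v => congrArg f ?_
    funext j
    rcases j with j | j
    · rfl
    · exact j.elim0
  | succ m ih =>
    intro ι _ f hf g hg
    have h1 := comp_reindex hf (ι := Option ι ⊕ Fin m)
      (Sum.elim (fun i => .inl (some i)) (Fin.cases (.inl none) fun i => .inr i))
    have h2 := ih h1 (fun i => comp_reindex (hg i.succ) (some : ι → Option ι))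
    refine (comp_substitute h2 (hg 0)).of_eq fun v => congrArg f ?_
    funext j
    rcases j with j | j
    · rfl
    · refine Fin.cases ?_ (fun i => ?_) j <;> rfl

theorem comp_of_primrec' {n : ℕ} {f : List.Vector ℕ n → ℕ} (hf : Nat.Primrec' f) :
    Comp fun v : Fin n → ℕ => f (List.Vector.ofFn v) := by
  induction hf with
  | zero => exact comp_basic none
  | succ => exact (comp_basic (some (0, true))).of_eq fun v => rfl
  | get i => exact (comp_basic (some (i, false))).of_eq fun v => by simp [Prog.val]
  | @comp m n f g _ _ ihf ihg =>
    exact (comp_comp (comp_reindex ihf (Sum.inr : _ → Fin m ⊕ Fin n)) ihg).of_eq fun v => rfl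
  | @prec n f g _ _ ihf ihg =>
    refine (comp_recursion (ι := Fin (n + 1)) ihf ihg Fin.succ
      (Fin.cons none (Fin.cons (some none) fun i => some (some i.succ))) (some 0)).of_eq fun v => ?_
    rw [List.Vector.ofFn]
    simp only [recF, Option.elim, List.Vector.head_cons, List.Vector.tail_cons]
    rfl

theorem comp_of_primrec {f : ℕ → ℕ} (hf : Primrec f) : Comp fun v : Unit → ℕ => f (v ()) :=
  (comp_reindex (comp_of_primrec' (Nat.Primrec'.prim_iff₁.2 hf)) fun _ => ()).of_eq fun _ => rfl

end compile
end Frag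

namespace Table
variable {S R : Type} (T : Table S R) (start : S)

/-- The program executing a table. -/
def toProg [Finite S] [Finite R] : Prog where
  S := Option S
  finS := inferInstance
  R := R
  finR := inferInstance
  start := some start
  tA s := T.tA (s.getD start)
  tB s := T.tB (s.getD start)
  oA s := T.oA (s.getD start)
  upd s := T.upd (s.getD start)
  nxt s := T.nxt (s.getD start)
  halt s := s = none

variable {T start}

theorem Exec.iterate [Finite S] [Finite R] {O : ℕ → Fin 4} {n : ℕ} {s s' : Option S}
    {r r' : R → ℕ} (h : T.Exec O n s r s' r') :
    (Prog.step (P := T.toProg start) O)^[n] (s, r) = (s', r') := by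
  induction h with
  | refl => rfl
  | step _ ih => exact ih

theorem Exec.ne_none [Finite S] [Finite R] {O : ℕ → Fin 4} {n : ℕ} {s s' : Option S}
    {r r' : R → ℕ} (h : T.Exec O n s r s' r') (hs : s' ≠ none) {m : ℕ} (hm : m ≤ n) :
    ((Prog.step (P := T.toProg start) O)^[m] (s, r)).1 ≠ none := by
  induction h generalizing m with
  | refl => rwa [Nat.le_zero.1 hm]
  | step _ ih =>
    rcases m with _ | m
    · exact Option.some_ne_none _
    · exact ih hs (Nat.succ_le_succ_iff.1 hm)

end Table

namespace Loop
open Frag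

/-- Registers of the main loop. -/
inductive Reg (A B : Type) (C : Fin 4 → Type)
  | x
  | z
  | probe (a : A)
  | addr (b : B)
  | next (d : Fin 4) (c : C d)

/-- States of the main loop. -/
inductive St (A B : Type) (C : Fin 4 → Type)
  | probe (a : A)
  | probeDone
  | addr (b : B)
  | addrDone
  | next (d : Fin 4) (c : C d)
  | nextDone (d : Fin 4)

instance {A B : Type} {C : Fin 4 → Type} [Finite A] [Finite B] [∀ d, Finite (C d)] :
    Finite (Reg A B C) :=
  Finite.of_surjective (fun x : (A ⊕ B ⊕ Σ d, C d) ⊕ Bool => match x with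
    | .inl (.inl a) => .probe a
    | .inl (.inr (.inl a)) => .addr a
    | .inl (.inr (.inr b)) => .next b.1 b.2
    | .inr true => .x
    | .inr false => .z) (by
    rintro (_ | _ | a | a | ⟨d, c⟩)
    exacts [⟨.inr true, rfl⟩, ⟨.inr false, rfl⟩, ⟨.inl (.inl a), rfl⟩, ⟨.inl (.inr (.inl a)), rfl⟩,
      ⟨.inl (.inr (.inr ⟨d, c⟩)), rfl⟩])

instance {A B : Type} {C : Fin 4 → Type} [Finite A] [Finite B] [∀ d, Finite (C d)] :
    Finite (St A B C) :=
  Finite.of_surjective (fun x : (A ⊕ B ⊕ Σ d, C d) ⊕ Bool ⊕ Fin 4 => match x with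
    | .inl (.inl a) => .probe a
    | .inl (.inr (.inl a)) => .addr a
    | .inl (.inr (.inr b)) => .next b.1 b.2
    | .inr (.inl true) => .probeDone
    | .inr (.inl false) => .addrDone
    | .inr (.inr d) => .nextDone d) (by
    rintro (a | _ | a | _ | ⟨d, c⟩ | d)
    exacts [⟨.inl (.inl a), rfl⟩, ⟨.inr (.inl true), rfl⟩, ⟨.inl (.inr (.inl a)), rfl⟩,
      ⟨.inr (.inl false), rfl⟩, ⟨.inl (.inr (.inr ⟨d, c⟩)), rfl⟩, ⟨.inr (.inr d), rfl⟩])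

variable {probe addr : ℕ → ℕ} {next : Fin 4 → ℕ → ℕ}
  (A : Frag Unit fun v => probe (v ())) (B : Frag Unit fun v => addr (v ()))
  (C : ∀ d, Frag Unit fun v => next d (v ()))

/-- The main loop. -/
noncomputable abbrev tbl :
    Table (St A.S B.S fun d => (C d).S) (Reg A.R B.R fun d => (C d).R) where
  tA s := match s with
    | .probe a => .probe (A.T.tA a)
    | .addr a => .addr (B.T.tA a)
    | .next d a => .next d ((C d).T.tA a)
    | _ => .probe A.out
  tB s := match s with
    | .probe a => .probe (A.T.tB a)
    | .addr a => .addr (B.T.tB a)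
    | .next d a => .next d ((C d).T.tB a)
    | _ => .z
  oA s := match s with
    | .probe a => .probe (A.T.oA a)
    | .addr a => .addr (B.T.oA a)
    | .next d a => .next d ((C d).T.oA a)
    | _ => .addr B.out
  upd s b := match s, b with
    | .probe s, .probe a => (A.T.upd s a).map (Prod.map .probe id)
    | .probeDone, .addr a =>
        Function.extend B.inp (fun _ => some (.x, false)) (fun a => some (.addr a, false)) a
    | .addr s, .addr a => (B.T.upd s a).map (Prod.map .addr id)
    | .addrDone, .next d a => Function.extend (C d).inp (fun _ => some (.x, false))
        (fun a => some (.next d a, false)) a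
    | .next d s, .next d' a => if h : d' = d then
        ((C d).T.upd s (h ▸ a)).map (Prod.map (.next d) id) else some (.next d' a, false)
    | .nextDone d, .x => some (.next d (C d).out, false)
    | .nextDone d, .probe a => Function.extend A.inp (fun _ => some (.next d (C d).out, false))
        (fun a => some (.probe a, false)) a
    | _, b => some (b, false)
  nxt s β o := match s with
    | .probe s => (A.T.nxt s β o).elim (some .probeDone) (fun s => some (.probe s))
    | .probeDone => if β then some (.addr B.start) else none
    | .addr s => (B.T.nxt s β o).elim (some .addrDone) (fun s => some (.addr s))
    | .addrDone => some (.next o (C o).start)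
    | .next d s => ((C d).T.nxt s β o).elim (some (.nextDone d)) (fun s => some (.next d s))
    | .nextDone _ => some (.probe A.start)

theorem emb_probe : A.T.Emb (tbl A B C) .probe .probe (some .probeDone) where
  inj a b h := by cases h; rfl
  tA _ := rfl
  tB _ := rfl
  oA _ := rfl
  upd _ _ := rfl
  keep s b h := by cases b <;> first | rfl | exact absurd rfl (h _)
  nxt _ _ _ := rfl

theorem emb_addr : B.T.Emb (tbl A B C) .addr .addr (some .addrDone) where
  inj a b h := by cases h; rfl
  tA _ := rfl
  tB _ := rfl
  oA _ := rfl
  upd _ _ := rfl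
  keep s b h := by cases b <;> first | rfl | exact absurd rfl (h _)
  nxt _ _ _ := rfl

theorem emb_next (d : Fin 4) :
    (C d).T.Emb (tbl A B C) (fun s => .next d s) (fun a => .next d a) (some (.nextDone d)) where
  inj a b h := by cases h; rfl
  tA _ := rfl
  tB _ := rfl
  oA _ := rfl
  upd _ _ := by simp
  keep s b h := by
    rcases b with _ | _ | _ | _ | ⟨d', a⟩
    on_goal 5 =>
      have : d' ≠ d := by rintro rfl; exact h _ rfl
      simp [this]
    all_goals rfl
  nxt _ _ _ := rfl



theorem loop_step {N : ℕ} {ρ : Reg A.R B.R (fun d => (C d).R) → ℕ} (hx : ρ .x = N)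
    (hz : ρ .z = 0) (hi : ρ (.probe (A.inp ())) = N) :
    (probe N ≠ 0 → ∃ n ρ', ∀ O, (tbl A B C).Exec O n (some (.probe A.start)) ρ none ρ') ∧
    (probe N = 0 → ∀ d, ∃ n ρ', ρ' .x = next d N ∧ ρ' .z = 0 ∧ ρ' (.probe (A.inp ())) = next d N ∧
      0 < n ∧ ∀ O, O (addr N) = d →
      (tbl A B C).Exec O n (some (.probe A.start)) ρ (some (.probe A.start)) ρ') := by
  obtain ⟨n₁, ρ₁, h1, h2, h3⟩ := A.call (emb_probe A B C) ρ
  have hx1 : ρ₁ .x = N := (h2 _ (by simp)).trans hx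
  have hz1 : ρ₁ .z = 0 := (h2 _ (by simp)).trans hz
  dsimp only at h1
  rw [hi] at h1
  constructor
  · intro ht
    refine ⟨n₁ + (0 + 1), fun a => Prog.val ρ₁ ((tbl A B C).upd .probeDone a),
      fun O => (h3 O).trans (.step ?_)⟩
    simp only [h1, hz1, ht, decide_false]
    exact .refl _ _
  · intro ht d
    obtain ⟨n₂, ρ₂, k1, k2, k3⟩ := B.call (emb_addr A B C)
      (fun a => Prog.val ρ₁ ((tbl A B C).upd .probeDone a))
    have hx2 : ρ₂ .x = N := (k2 _ (by simp)).trans hx1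
    have hz2 : ρ₂ .z = 0 := (k2 _ (by simp)).trans hz1
    dsimp only at k1
    rw [B.inj.extend_apply, Prog.val, hx1, Bool.toNat_false, add_zero] at k1
    obtain ⟨n₃, ρ₃, l1, l2, l3⟩ := (C d).call (emb_next A B C d)
      (fun a => Prog.val ρ₂ ((tbl A B C).upd .addrDone a))
    have hz3 : ρ₃ .z = 0 := (l2 _ (by simp)).trans hz2
    dsimp only at l1
    rw [(C d).inj.extend_apply, Prog.val, hx2] at l1
    refine ⟨n₁ + ((n₂ + ((n₃ + (0 + 1)) + 1)) + 1),
      fun a => Prog.val ρ₃ ((tbl A B C).upd (.nextDone d) a), l1, hz3, ?_, by omega, fun O hO =>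
      (h3 O).trans (.step ?_)⟩
    · dsimp only
      rw [A.inj.extend_apply]
      exact l1
    · simp only [h1, ht, hz1, decide_true, if_true]
      refine (k3 O).trans (.step ?_)
      have e : O (ρ₂ (.addr B.out)) = d := by rw [k1, hO]
      change (tbl A B C).Exec O _ (some (.next (O (ρ₂ (.addr B.out))) (C _).start)) _ _ _
      rw [e]
      exact (l3 O).trans (.step (.refl _ _))

/-- The sequence of values of the main register. -/
def seq (addr : ℕ → ℕ) (next : Fin 4 → ℕ → ℕ) (O : ℕ → Fin 4) (N : ℕ) : ℕ :=
  Nat.rec 0 (fun _ x => next (O (addr x)) x) N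

theorem loop_seq (N : ℕ) : ∃ K : Set (ℕ × (Reg A.R B.R (fun d => (C d).R) → ℕ)), K.Finite ∧
    ∀ O, (∀ i < N, probe (seq addr next O i) = 0) → ∃ c ∈ K, N ≤ c.1 ∧
      c.2 .x = seq addr next O N ∧ c.2 .z = 0 ∧ c.2 (.probe (A.inp ())) = seq addr next O N ∧
      (tbl A B C).Exec O c.1 (some (.probe A.start)) (fun _ => 0) (some (.probe A.start)) c.2 := by
  induction N with
  | zero => exact ⟨{(0, fun _ => 0)}, Set.finite_singleton _, fun O _ =>
      ⟨_, rfl, le_rfl, rfl, rfl, rfl, .refl _ _⟩⟩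
  | succ N ih =>
    obtain ⟨K, hK, h⟩ := ih
    have key : ∀ c : ℕ × (Reg A.R B.R (fun d => (C d).R) → ℕ), ∀ d,
        ∃ c' : ℕ × (Reg A.R B.R (fun d => (C d).R) → ℕ),
        c.2 .z = 0 → c.2 (.probe (A.inp ())) = c.2 .x → probe (c.2 .x) = 0 →
        c'.2 .x = next d (c.2 .x) ∧ c'.2 .z = 0 ∧ c'.2 (.probe (A.inp ())) = next d (c.2 .x) ∧
        0 < c'.1 ∧ ∀ O, O (addr (c.2 .x)) = d →
        (tbl A B C).Exec O c'.1 (some (.probe A.start)) c.2 (some (.probe A.start)) c'.2 := by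
      intro c d
      by_cases hc : c.2 .z = 0 ∧ c.2 (.probe (A.inp ())) = c.2 .x ∧ probe (c.2 .x) = 0
      · obtain ⟨n, ρ', h1⟩ := (loop_step A B C rfl hc.1 hc.2.1).2 hc.2.2 d
        exact ⟨(n, ρ'), fun _ _ _ => h1⟩
      · exact ⟨(0, fun _ => 0), fun h1 h2 h3 => absurd ⟨h1, h2, h3⟩ hc⟩
    choose φ hφ using key
    refine ⟨Set.image2 (fun c d => (c.1 + (φ c d).1, (φ c d).2)) K Set.univ,
      hK.image2 _ Set.finite_univ, fun O hO => ?_⟩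
    obtain ⟨c, hc, h1, h2, h3, h4, h5⟩ := h O fun i hi => hO i (by omega)
    obtain ⟨g1, g2, g3, g4, g5⟩ := hφ c (O (addr (c.2 .x))) h3 (h4.trans h2.symm)
      (h2 ▸ hO N (by omega))
    refine ⟨_, Set.mem_image2_of_mem hc (Set.mem_univ (O (addr (c.2 .x)))), ?_, ?_, g2, ?_,
      h5.trans (g5 O rfl)⟩
    · dsimp only; omega
    · rw [g1, h2]; rfl
    · rw [g3, h2]; rfl

end Loop

open Loop in
/-- A program running through a sequence of values until a test succeeds. -/
theorem exists_prog {probe addr : ℕ → ℕ} {next : Fin 4 → ℕ → ℕ} (ht : Primrec probe)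
    (ha : Primrec addr) (hn : ∀ d, Primrec (next d)) : ∃ P : Prog,
    (∀ O, (∀ N, probe (seq addr next O N) = 0) → ∀ n, ¬ P.halt (P.conf O n).1) ∧
    ∀ N, ∃ T, ∀ O, probe (seq addr next O N) ≠ 0 → ∃ n ≤ T, P.halt (P.conf O n).1 := by
  obtain ⟨A⟩ := Frag.comp_of_primrec ht
  obtain ⟨B⟩ := Frag.comp_of_primrec ha
  have hC : ∀ d, Nonempty (Frag Unit fun v => next d (v ())) := fun d =>
    Frag.comp_of_primrec (hn d)
  let C := fun d => (hC d).some
  refine ⟨(tbl A B C).toProg (.probe A.start), fun O hO n => ?_, fun N => ?_⟩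
  · obtain ⟨K, -, h⟩ := loop_seq A B C n
    obtain ⟨c, -, h1, -, -, -, h2⟩ := h O fun i _ => hO i
    exact h2.ne_none (Option.some_ne_none _) h1
  · have : ∀ M, ∃ T, ∀ O, (∀ i < M, probe (seq addr next O i) = 0) → probe (seq addr next O M) ≠ 0 →
        ∃ n ≤ T, ((tbl A B C).toProg (.probe A.start)).halt
          (((tbl A B C).toProg (.probe A.start)).conf O n).1 := by
      intro M
      obtain ⟨K, hK, h⟩ := loop_seq A B C M
      have key : ∀ c : ℕ × (Reg A.R B.R (fun d => (C d).R) → ℕ), ∃ n : ℕ, c.2 .z = 0 →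
          c.2 (.probe (A.inp ())) = c.2 .x → probe (c.2 .x) ≠ 0 → ∃ ρ', ∀ O,
          (tbl A B C).Exec O n (some (.probe A.start)) c.2 none ρ' := by
        intro c
        by_cases hc : c.2 .z = 0 ∧ c.2 (.probe (A.inp ())) = c.2 .x ∧ probe (c.2 .x) ≠ 0
        · obtain ⟨n, ρ', h1⟩ := (loop_step A B C rfl hc.1 hc.2.1).1 hc.2.2
          exact ⟨n, fun _ _ _ => ⟨ρ', h1⟩⟩
        · exact ⟨0, fun h1 h2 h3 => absurd ⟨h1, h2, h3⟩ hc⟩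
      choose φ hφ using key
      obtain ⟨T, hT⟩ := (hK.image fun c => c.1 + φ c).bddAbove
      refine ⟨T, fun O hO hM => ?_⟩
      obtain ⟨c, hc, -, h2, h3, h4, h5⟩ := h O hO
      obtain ⟨ρ', g⟩ := hφ c h3 (h4.trans h2.symm) (h2 ▸ hM)
      refine ⟨_, hT (Set.mem_image_of_mem _ hc), ?_⟩
      exact congrArg Prod.fst (h5.trans (g O)).iterate
    choose T hT using this
    refine ⟨∑ M ∈ Finset.range (N + 1), T M, fun O hO => ?_⟩
    classical
    have hex : ∃ M, probe (seq addr next O M) ≠ 0 := ⟨N, hO⟩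
    obtain ⟨n, h1, h2⟩ := hT (Nat.find hex) O
      (fun i hi => not_not.1 (Nat.find_min hex hi)) (Nat.find_spec hex)
    refine ⟨n, h1.trans ?_, h2⟩
    exact Finset.single_le_sum (f := T) (fun _ _ => Nat.zero_le _)
      (Finset.mem_range.2 (Nat.lt_succ_of_le (Nat.find_min' hex hO)))

open Encodable

section rational

/-- The codes of rational numbers as pairs of numerator and denominator. -/
def IsRat (m : ℕ) : Prop := 0 < m.unpair.2 ∧
  Nat.findGreatest (fun e => (m.unpair.1 + 1) / 2 % e = 0 ∧ m.unpair.2 % e = 0) m.unpair.2 = 1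

instance : DecidablePred IsRat := fun m => by unfold IsRat; infer_instance

/-- The code of a rational number as a pair of numerator and denominator. -/
def codeRat (q : ℚ) : ℕ := Nat.pair (encode q.num) q.den

theorem encode_int_natAbs (z : ℤ) : (encode z + 1) / 2 = z.natAbs := by
  rcases z with n | n
  · change (2 * n + 1) / 2 = n
    omega
  · change (2 * n + 1 + 1) / 2 = n + 1
    omega

theorem isRat_iff (m : ℕ) : IsRat m ↔ m ∈ Set.range codeRat := by
  have key : ∀ a b : ℕ, 0 < b →
      (Nat.findGreatest (fun e => a % e = 0 ∧ b % e = 0) b = 1 ↔ Nat.Coprime a b) := by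
    intro a b hb
    rw [Nat.Coprime, Nat.findGreatest_eq_iff]
    simp only [← Nat.dvd_iff_mod_eq_zero]
    constructor
    · rintro ⟨-, -, h⟩
      by_contra hc
      have h1 := Nat.gcd_pos_of_pos_right a hb
      exact h (show 1 < Nat.gcd a b by omega) (Nat.le_of_dvd hb (Nat.gcd_dvd_right a b))
        ⟨Nat.gcd_dvd_left a b, Nat.gcd_dvd_right a b⟩
    · intro h
      refine ⟨hb, fun _ => ⟨one_dvd _, one_dvd _⟩, fun e he _ hd => ?_⟩
      have := Nat.le_of_dvd (by omega) (h ▸ Nat.dvd_gcd hd.1 hd.2)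
      omega
  constructor
  · rintro ⟨h1, h2⟩
    rw [key _ _ h1] at h2
    let z := Denumerable.ofNat ℤ m.unpair.1
    have hz : encode z = m.unpair.1 := Denumerable.encode_ofNat _
    rw [← hz, encode_int_natAbs] at h2
    exact ⟨⟨z, m.unpair.2, h1.ne', h2⟩, by rw [codeRat, hz, Nat.pair_unpair]⟩
  · rintro ⟨q, rfl⟩
    unfold IsRat codeRat
    rw [Nat.unpair_pair, key _ _ q.pos, encode_int_natAbs]
    exact ⟨q.pos, q.reduced⟩

theorem encode_rat (q : ℚ) : @encode ℚ Primcodable.toEncodable q = Nat.count IsRat (codeRat q) := by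
  let := @decidableRangeEncode ℚ Rat.instEncodable
  have : @encode ℚ Primcodable.toEncodable q = (List.range (codeRat q)).countP
    (· ∈ Set.range (@encode ℚ Rat.instEncodable)) := rfl
  rw [this, Nat.count_eq_card_filter_range, List.countP_eq_length_filter]
  refine congrArg List.length (List.filter_congr fun m _ => decide_eq_decide.2 ?_)
  exact (isRat_iff m).symm

theorem primrec_isRat : PrimrecPred IsRat := by
  have h1 : Primrec fun m : ℕ => m.unpair.1 := Primrec.fst.comp Primrec.unpair
  have h2 : Primrec fun m : ℕ => m.unpair.2 := Primrec.snd.comp Primrec.unpair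
  refine (Primrec.nat_lt.comp (Primrec.const 0) h2).and (Primrec.eq.comp
    (Primrec.nat_findGreatest h2 ?_) (Primrec.const 1))
  refine PrimrecPred.and (Primrec.eq.comp (Primrec.nat_mod.comp (Primrec.nat_div.comp
    (Primrec.nat_add.comp (h1.comp Primrec.fst) (Primrec.const 1)) (Primrec.const 2)) Primrec.snd)
    (Primrec.const 0)) (Primrec.eq.comp (Primrec.nat_mod.comp (h2.comp Primrec.fst) Primrec.snd)
    (Primrec.const 0))

theorem primrec_count : Primrec (Nat.count IsRat) := by
  refine (Primrec.nat_rec₁ (f := fun n c => if IsRat n then c + 1 else c) 0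
    (Primrec.ite (primrec_isRat.comp Primrec.fst) (Primrec.succ.comp Primrec.snd)
      Primrec.snd)).of_eq fun n => ?_
  induction n with
  | zero => simp
  | succ n ih =>
    rw [Nat.count_succ, ← ih]
    dsimp only
    split_ifs <;> rfl

theorem computable_codeRat {f : ℕ → ℚ} (hf : Computable f) :
    Computable fun n => codeRat (f n) := by
  have h1 : Computable fun n => Nat.count IsRat (codeRat (f n)) :=
    (Computable.encode.comp hf).of_eq fun n => encode_rat _
  let p : ℕ → ℕ → Bool := fun n m => decide (IsRat m) &&
    decide (Nat.count IsRat m = Nat.count IsRat (codeRat (f n)))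
  have hp : Computable₂ p := by
    refine (Primrec.and.to_comp).comp₂ ?_ ?_
    · exact (primrec_isRat.decide.to_comp).comp₂ Computable.snd
    · exact (Primrec.eq.decide.to_comp).comp₂ (primrec_count.to_comp.comp Computable.snd)
        (h1.comp Computable.fst)
  refine (Partrec.rfind hp.partrec₂).of_eq fun n => ?_
  have h2 : IsRat (codeRat (f n)) := (isRat_iff _).2 ⟨_, rfl⟩
  refine Part.eq_some_iff.2 (Nat.mem_rfind.2 ⟨?_, fun {m} hm => ?_⟩)
  · simp [p, h2]
  · have : ¬ (IsRat m ∧ Nat.count IsRat m = Nat.count IsRat (codeRat (f n))) := fun h =>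
      (Nat.count_strict_mono h.1 hm).ne h.2
    simpa [p] using this

end rational

section approximation

theorem primrec_pow (b : ℕ) : Primrec fun n : ℕ => b ^ n :=
  (Primrec.nat_rec₁ (f := fun _ c => c * b) 1
    (Primrec.nat_mul.comp Primrec.snd (Primrec.const b))).of_eq fun n => by
      induction n with
      | zero => rfl
      | succ n ih => rw [pow_succ, ← ih]

open Nat.Partrec (Code) in
/-- Limits approximated from above by a computable sequence are approximated from above by a
primitive recursive one. -/
theorem exists_primrec_upper {g : ℕ → ℕ} (hg : Computable g) : ∃ U : ℕ → ℕ, Primrec U ∧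
    (∀ θ : ℝ, θ ≤ 1 → (∀ n, θ * 4 ^ n ≤ g n) → ∀ n, θ * 4 ^ n ≤ U n) ∧
    ∀ j, ∃ N, j ≤ N ∧ U N * 4 ^ j ≤ g j * 4 ^ N := by
  obtain ⟨c, hc⟩ := Code.exists_code.1 (Partrec.nat_iff.1 hg.partrec)
  have hmem : ∀ j v, v ∈ c.eval j ↔ v = g j := fun j v => by rw [hc]; simp
  let S : ℕ → ℕ → ℕ → ℕ := fun N j r =>
    min r (4 ^ (N - j) * (Code.evaln N c j).getD r + if (Code.evaln N c j).isSome then 0 else r)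
  let u : ℕ → ℕ → ℕ := fun N j => Nat.rec (4 ^ N) (S N) j
  have hS : ∀ N j r, S N j r =
      ((Code.evaln N c j).map fun v => min r (4 ^ (N - j) * v)).getD r := by
    intro N j r
    dsimp only [S]
    rcases h : Code.evaln N c j with _ | v <;> simp
  have hu : ∀ N j, u N (j + 1) = S N j (u N j) := fun _ _ => rfl
  refine ⟨fun N => u N N, ?_, fun θ h1 h n => ?_, fun j => ?_⟩
  · refine (Primrec.nat_rec' (f := fun N => N) (g := fun N => 4 ^ N)
      (h := fun N p => S N p.1 p.2) Primrec.id (primrec_pow 4) ?_).of_eq fun N => rfl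
    have he : Primrec fun q : ℕ × ℕ × ℕ => Code.evaln q.1 c q.2.1 :=
      Code.primrec_evaln.comp ((Primrec.fst.pair (Primrec.const c)).pair
        (Primrec.fst.comp Primrec.snd))
    have hr : Primrec fun q : ℕ × ℕ × ℕ => q.2.2 := Primrec.snd.comp Primrec.snd
    refine Primrec.nat_min.comp hr (Primrec.nat_add.comp (Primrec.nat_mul.comp
      ((primrec_pow 4).comp (Primrec.nat_sub.comp Primrec.fst (Primrec.fst.comp Primrec.snd)))
      (Primrec.option_getD.comp he hr)) (Primrec.ite ?_ (Primrec.const 0) hr))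
    exact (Primrec.eq.comp (Primrec.option_isSome.comp he) (Primrec.const true))
  · have : ∀ j : ℕ, j ≤ n → θ * 4 ^ n ≤ (Nat.cast (u n j) : ℝ) := by
      intro j
      induction j with
      | zero =>
        intro _
        rw [show u n 0 = 4 ^ n from rfl, Nat.cast_pow, Nat.cast_ofNat]
        exact mul_le_of_le_one_left (by positivity) h1
      | succ j ih =>
        intro hj
        have h2 := ih (by omega)
        rw [hu, hS]
        rcases he : Code.evaln n c j with _ | v
        · simpa using h2
        · have hv := (hmem j v).1 (Code.evaln_sound he)
          simp only [Option.map_some, Option.getD_some, Nat.cast_min, Nat.cast_mul, Nat.cast_pow,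
            Nat.cast_ofNat]
          refine le_min h2 ?_
          have h3 := mul_le_mul_of_nonneg_left (h j) (show (0 : ℝ) ≤ 4 ^ (n - j) by positivity)
          calc θ * 4 ^ n = 4 ^ (n - j) * (θ * 4 ^ j) := by
                rw [mul_left_comm, ← pow_add, Nat.sub_add_cancel (by omega)]
            _ ≤ _ := by rw [hv]; exact h3
    exact this n le_rfl
  · obtain ⟨s, hs⟩ := Code.evaln_complete.1 ((hmem j _).2 rfl)
    refine ⟨s + j + 1, by omega, ?_⟩
    set N := s + j + 1 with hN
    have hanti : Antitone (u N) := antitone_nat_of_succ_le fun i => by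
      rw [hu]; exact min_le_left _ _
    have h1 : u N (j + 1) ≤ 4 ^ (N - j) * g j := by
      rw [hu, hS, Code.evaln_mono (show s ≤ N by omega) hs]
      exact min_le_right _ _
    calc u N N * 4 ^ j ≤ 4 ^ (N - j) * g j * 4 ^ j :=
          Nat.mul_le_mul_right _ ((hanti (show j + 1 ≤ N by omega)).trans h1)
      _ = g j * (4 ^ (N - j) * 4 ^ j) := by ring
      _ = g j * 4 ^ N := by rw [← pow_add, Nat.sub_add_cancel (by omega)]

/-- The number with a given sequence of base four digits. -/
def pref (d : ℕ → Fin 4) : ℕ → ℕ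
  | 0 => 0
  | N + 1 => 4 * pref d N + d N

theorem pref_le (d : ℕ → Fin 4) (N m : ℕ) : pref d (N + m) + 1 ≤ (pref d N + 1) * 4 ^ m := by
  induction m with
  | zero => simp
  | succ m ih => rw [← add_assoc, pref, pow_succ, ← mul_assoc]; have := (d (N + m)).2; omega

theorem exists_pref {θ : ℝ} (h0 : 0 ≤ θ) (h1 : θ ≤ 1) : ∃ d : ℕ → Fin 4, ∀ N,
    (pref d N : ℝ) ≤ θ * 4 ^ N ∧ θ * 4 ^ N ≤ pref d N + 1 := by
  let P : ℕ → ℕ := fun N => ⌈θ * 4 ^ N⌉₊ - 1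
  have hP : ∀ N, (P N : ℝ) ≤ θ * 4 ^ N ∧ θ * 4 ^ N ≤ P N + 1 := by
    intro N
    have h2 : 0 ≤ θ * 4 ^ N := by positivity
    have h3 := Nat.ceil_lt_add_one h2
    have h4 := Nat.le_ceil (θ * 4 ^ N)
    rcases Nat.eq_zero_or_pos ⌈θ * 4 ^ N⌉₊ with h | h
    · simp only [P, h] at h4 ⊢
      norm_num at h4 ⊢
      exact ⟨h0, by linarith⟩
    · have : (P N : ℝ) = ⌈θ * 4 ^ N⌉₊ - 1 := by
        simp only [P]; rw [Nat.cast_sub h, Nat.cast_one]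
      rw [this]
      exact ⟨by linarith, by linarith⟩
  have h4 : ∀ N, 4 * P N ≤ P (N + 1) ∧ P (N + 1) < 4 * P N + 4 := by
    intro N
    have hm : ⌈θ * 4 ^ (N + 1)⌉₊ ≤ 4 * P N + 4 := by
      refine Nat.ceil_le.2 ?_
      push_cast
      rw [pow_succ]
      linarith [(hP N).2]
    refine ⟨?_, by simp only [P] at hm ⊢; omega⟩
    rcases Nat.eq_zero_or_pos (P N) with h | h
    · omega
    · have h5 : P N < θ * 4 ^ N := Nat.lt_ceil.1 (by simp only [P] at h ⊢; omega)
      have : 4 * P N < ⌈θ * 4 ^ (N + 1)⌉₊ := by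
        refine Nat.lt_ceil.2 ?_
        push_cast
        rw [pow_succ]
        linarith
      simp only [P] at this ⊢
      omega
  refine ⟨fun t => Fin.ofNat 4 (P (t + 1) - 4 * P t), fun N => ?_⟩
  suffices pref (fun t => Fin.ofNat 4 (P (t + 1) - 4 * P t)) N = P N by rw [this]; exact hP N
  induction N with
  | zero =>
    have : ⌈θ * 4 ^ 0⌉₊ ≤ 1 := Nat.ceil_le.2 (by simpa using h1)
    simp only [P, pref]; omega
  | succ N ih =>
    rw [pref, ih]
    have := h4 N
    simp only [Fin.val_ofNat]
    omega

/-- A program halting exactly when the digits it reads exceed the limit of a computable upper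
approximation. -/
theorem exists_digit_prog {θ : ℝ} (h0 : 0 ≤ θ) (h1 : θ ≤ 1) {g : ℕ → ℕ} (hg : Computable g)
    (hge : ∀ n, θ * 4 ^ n ≤ g n) (hlim : ∀ ε > 0, ∀ n₀, ∃ n, n₀ ≤ n ∧ (g n : ℝ) ≤ (θ + ε) * 4 ^ n) :
    ∃ P : Prog, (∃ d : ℕ → Fin 4, (∀ O, (∀ t, O (2 ^ t - 1) = d t) → ∀ n, ¬ P.halt (P.conf O n).1) ∧
      ∀ N, θ * 4 ^ N ≤ pref d N + 1) ∧
    ∀ ε > 0, ∀ n₀, ∃ N T, n₀ ≤ N ∧ ∀ (d : ℕ → Fin 4) O, (∀ t, O (2 ^ t - 1) = d t) →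
      (∀ n ≤ T, ¬ P.halt (P.conf O n).1) → (pref d N : ℝ) ≤ (θ + ε) * 4 ^ N := by
  obtain ⟨U, hU, hlow, hup⟩ := exists_primrec_upper hg
  have p1 : Primrec fun x : ℕ => x.unpair.1 := Primrec.fst.comp Primrec.unpair
  have p2 : Primrec fun x : ℕ => x.unpair.2 := Primrec.snd.comp Primrec.unpair
  obtain ⟨P, hP, hP'⟩ := exists_prog (probe := fun x => x.unpair.2 - U x.unpair.1)
    (addr := fun x => 2 ^ x.unpair.1 - 1)
    (next := fun d x => Nat.pair (x.unpair.1 + 1) (4 * x.unpair.2 + d))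
    (Primrec.nat_sub.comp p2 (hU.comp p1))
    (Primrec.nat_sub.comp ((primrec_pow 2).comp p1) (Primrec.const 1))
    (fun d => Primrec₂.natPair.comp (Primrec.succ.comp p1)
      (Primrec.nat_add.comp (Primrec.nat_mul.comp (Primrec.const 4) p2) (Primrec.const (d : ℕ))))
  have hseq : ∀ (d : ℕ → Fin 4) O, (∀ t, O (2 ^ t - 1) = d t) → ∀ N,
      Loop.seq (fun x => 2 ^ x.unpair.1 - 1)
        (fun d x => Nat.pair (x.unpair.1 + 1) (4 * x.unpair.2 + d)) O N =
          Nat.pair N (pref d N) := by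
    intro d O hO N
    induction N with
    | zero => rfl
    | succ N ih =>
      rw [show ∀ a b, Loop.seq a b O (N + 1) = b (O (a (Loop.seq a b O N))) (Loop.seq a b O N)
        from fun _ _ => rfl, ih]
      simp only [Nat.unpair_pair, hO, pref]
  refine ⟨P, ?_, fun ε hε n₀ => ?_⟩
  · obtain ⟨d, hd⟩ := exists_pref h0 h1
    refine ⟨d, fun O hO => hP O fun N => ?_, fun N => (hd N).2⟩
    rw [hseq d O hO, Nat.unpair_pair]
    refine Nat.sub_eq_zero_of_le ?_
    exact_mod_cast (hd N).1.trans (hlow θ h1 hge N)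
  · obtain ⟨j, hj0, hj⟩ := hlim ε hε n₀
    obtain ⟨N, hjN, hN⟩ := hup j
    obtain ⟨T, hT⟩ := hP' N
    refine ⟨N, T, hj0.trans hjN, fun d O hO h => ?_⟩
    have h3 : pref d N ≤ U N := by
      by_contra hc
      obtain ⟨n, hn, hh⟩ := hT O (by rw [hseq d O hO, Nat.unpair_pair]; dsimp only; omega)
      exact h n hn hh
    have h4 : (U N : ℝ) * 4 ^ j ≤ g j * 4 ^ N := by exact_mod_cast hN
    have h5 : (pref d N : ℝ) ≤ U N := by exact_mod_cast h3
    refine h5.trans (le_of_mul_le_mul_right (h4.trans ?_) (show (0 : ℝ) < 4 ^ j by positivity))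
    nlinarith [show (0 : ℝ) < 4 ^ N by positivity]

end approximation

section density

/-- Programs restricting a base four expansion with integer part `c` to numbers at most `2 α`. -/
theorem exists_density_prog {h : ℝ} (f : ℕ → ℚ) (hf : Computable f) (hfa : Antitone f)
    (hlim : Tendsto (fun n => (f n : ℝ)) atTop (nhds h)) (h0 : 0 ≤ h) {a b : ℕ} (hb : 0 < b)
    {α : ℝ} (hα : α * a = h * b) (hα1 : α < 1) (ha : 0 < a) :
    ∃ (c : Bool) (P : Prog), (∃ d : ℕ → Fin 4,
      (∀ O, (∀ t, O (2 ^ t - 1) = d t) → ∀ n, ¬ P.halt (P.conf O n).1) ∧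
      ∀ N, 2 * α * 4 ^ N ≤ (c.toNat * 4 ^ N + pref d N + 1 : ℕ)) ∧
    ∀ ε > 0, ∀ n₀, ∃ N T, n₀ ≤ N ∧ ∀ (d : ℕ → Fin 4) O, (∀ t, O (2 ^ t - 1) = d t) →
      (∀ n ≤ T, ¬ P.halt (P.conf O n).1) →
        ((c.toNat * 4 ^ N + pref d N : ℕ) : ℝ) ≤ (2 * α + ε) * 4 ^ N := by
  have haR : (0 : ℝ) < a := Nat.cast_pos.2 ha
  have hbR : (0 : ℝ) < b := Nat.cast_pos.2 hb
  have hα0 : 0 ≤ α := by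
    by_contra hc
    have := mul_neg_of_neg_of_pos (not_le.1 hc) haR
    have := mul_nonneg h0 hbR.le
    linarith
  have hfh : ∀ n, h ≤ f n := fun n =>
    le_of_tendsto hlim (eventually_atTop.2 ⟨n, fun m hm => Rat.cast_le.2 (hfa hm)⟩)
  obtain ⟨c, hc0, hc1⟩ : ∃ c : Bool, 0 ≤ 2 * α - c.toNat ∧ 2 * α - c.toNat ≤ 1 := by
    rcases le_or_gt (1 / 2) α with h | h
    · exact ⟨true, by simp; linarith, by simp; linarith⟩
    · exact ⟨false, by simp; linarith, by simp; linarith⟩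
  let G : ℕ → ℕ → ℕ := fun n x => 4 ^ n * (2 * ((x.unpair.1 + 1) / 2) * b -
    c.toNat * a * x.unpair.2) / (a * x.unpair.2) + 1
  let g : ℕ → ℕ := fun n => G n (codeRat (f n))
  have hG : Primrec₂ G := by
    have h1 : Primrec fun p : ℕ × ℕ => p.2.unpair.1 := Primrec.fst.comp (Primrec.unpair.comp
      Primrec.snd)
    have h2 : Primrec fun p : ℕ × ℕ => p.2.unpair.2 := Primrec.snd.comp (Primrec.unpair.comp
      Primrec.snd)
    exact Primrec.succ.comp (Primrec.nat_div.comp (Primrec.nat_mul.comp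
      ((primrec_pow 4).comp Primrec.fst) (Primrec.nat_sub.comp (Primrec.nat_mul.comp
      (Primrec.nat_mul.comp (Primrec.const 2) (Primrec.nat_div.comp (Primrec.nat_add.comp h1
      (Primrec.const 1)) (Primrec.const 2))) (Primrec.const b)) (Primrec.nat_mul.comp
      (Primrec.const (c.toNat * a)) h2))) (Primrec.nat_mul.comp (Primrec.const a) h2))
  have hg : Computable g := hG.to_comp.comp Computable.id (computable_codeRat hf)
  have hval : ∀ n, (2 * ((f n : ℝ) * b / a) - c.toNat) * 4 ^ n ≤ g n ∧
      (g n : ℝ) ≤ (2 * ((f n : ℝ) * b / a) - c.toNat) * 4 ^ n + 1 := by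
    intro n
    set q := (f n).den with hq
    set p := (f n).num.natAbs with hp
    have hqR : (0 : ℝ) < q := Nat.cast_pos.2 (f n).pos
    have hfn : (f n : ℝ) = p / q := by
      have h2 : 0 ≤ f n := by exact_mod_cast h0.trans (hfh n)
      have h3 : ((p : ℤ) : ℝ) = (f n).num := by
        rw [hp, Int.natAbs_of_nonneg (Rat.num_nonneg.2 h2)]
      rw [← Int.cast_natCast, h3]
      exact_mod_cast (Rat.num_div_den (f n)).symm
    have hgn : g n = 4 ^ n * (2 * p * b - c.toNat * a * q) / (a * q) + 1 := by
      simp only [g, G, codeRat, Nat.unpair_pair, encode_int_natAbs, hp, hq]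
    have hle : c.toNat * a * q ≤ 2 * p * b := by
      have h2 := hfh n
      rw [hfn, le_div_iff₀ hqR] at h2
      have : (c.toNat * a * q : ℝ) ≤ 2 * p * b := by
        calc (c.toNat * a * q : ℝ) ≤ 2 * α * a * q := by
              have : (0 : ℝ) ≤ a * q := by positivity
              nlinarith
          _ = 2 * (h * q) * b := by rw [mul_assoc 2, hα]; ring
          _ ≤ 2 * p * b := by nlinarith
      exact_mod_cast this
    have hX : ((4 ^ n * (2 * p * b - c.toNat * a * q) : ℕ) : ℝ) / (a * q : ℕ) =
        (2 * ((f n : ℝ) * b / a) - c.toNat) * 4 ^ n := by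
      rw [hfn]
      push_cast [hle]
      field_simp
    rw [← hX, hgn, ← Nat.floor_div_eq_div (K := ℝ), Nat.cast_add, Nat.cast_one]
    exact ⟨(Nat.lt_floor_add_one _).le, by gcongr; exact Nat.floor_le (by positivity)⟩
  have hmono : ∀ x y : ℝ, x ≤ y → x * b / a ≤ y * b / a := fun x y hxy => by gcongr
  have hαe : h * b / a = α := by rw [← hα]; field_simp
  obtain ⟨P, ⟨d, hd1, hd2⟩, hP⟩ := exists_digit_prog hc0 hc1 hg (fun n => by
      refine le_trans ?_ (hval n).1
      have := hmono _ _ (hfh n)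
      rw [hαe] at this
      gcongr) (fun ε hε n₀ => by
      have h1 : Tendsto (fun n => 2 * ((f n : ℝ) * b / a) + (1 / 4 : ℝ) ^ n) atTop
          (nhds (2 * (h * b / a) + 0)) :=
        (((hlim.mul_const _).div_const _).const_mul _).add
          (tendsto_pow_atTop_nhds_zero_of_lt_one (by norm_num) (by norm_num))
      obtain ⟨n, hn, hn₀⟩ := ((h1.eventually_lt_const (show 2 * (h * b / a) + 0 < 2 * α + ε by
        rw [hαe]; linarith)).and (eventually_ge_atTop n₀)).exists
      refine ⟨n, hn₀, (hval n).2.trans ?_⟩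
      have h4 : (0 : ℝ) < 4 ^ n := by positivity
      have h5 : (1 / 4 : ℝ) ^ n * 4 ^ n = 1 := by rw [← mul_pow]; norm_num
      nlinarith)
  refine ⟨c, P, ⟨d, hd1, fun N => ?_⟩, fun ε hε n₀ => ?_⟩
  · push_cast
    nlinarith [hd2 N]
  · obtain ⟨N, T, hN, h⟩ := hP ε hε n₀
    refine ⟨N, T, hN, fun d O h2 h3 => ?_⟩
    push_cast
    nlinarith [h d O h2 h3]

end density

theorem dvd_sub_add_iff {e : ℕ} {l : ℕ} (he : l ≤ e) (i x c : ℤ) :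
    (2 : ℤ) ^ l ∣ i - (x + 2 ^ e * c) ↔ (2 : ℤ) ^ l ∣ i - x := by
  have h : (2 : ℤ) ^ l ∣ 2 ^ e * c := dvd_mul_of_dvd_left (pow_dvd_pow 2 he) c
  rw [← sub_sub]
  exact ⟨fun h' => by simpa using dvd_add h' h, fun h' => dvd_sub h' h⟩

theorem HStr.translate {y : ℤ → ℤ → Sym1} {n : ℕ} {x z : ℤ} (hs : HStr y n x z) (a b : ℤ) :
    HStr y n (x + 2 ^ (n + 1) * a) (z + 2 ^ (n + 1) * b) := by
  have hl : ∀ l < n, ∀ i x a : ℤ, Lev l (i - (x + 2 ^ (n + 1) * a)) ↔ Lev l (i - x) :=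
    fun l hl i x a => by
      rw [Lev, Lev, dvd_sub_add_iff (by omega), dvd_sub_add_iff (by omega)]
  refine ⟨fun i j => ?_, fun l h i j h1 h2 => ?_, fun l h i j h1 h2 => ?_, fun l h i j h1 => ?_⟩
  · have := dvd_sub_add_iff (show 1 ≤ n + 1 by omega) i x a
    rw [pow_one] at this
    rw [this]
    exact hs.par i j
  · exact hs.E l h i j ((hl l h _ _ _).1 h1) ((hl l h _ _ _).1 h2)
  · rw [dvd_sub_add_iff (by omega)] at h2
    rw [hs.C l h i j ((hl l h _ _ _).1 h1) h2]
    simp only [dvd_sub_add_iff (show l + 2 ≤ n + 1 by omega)]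
  · rw [hs.S l h i j ((hl l h _ _ _).1 h1), sub_right_comm, sub_right_comm i (x + _),
      dvd_sub_add_iff (show l + 2 ≤ n + 1 by omega)]

theorem Rule1.exists_str_bounded {y : ℤ → ℤ → Sym1} (h : Rule1 y) (n : ℕ) :
    ∃ x z : Fin (2 ^ (n + 1)), Str y n (x : ℕ) (z : ℕ) := by
  obtain ⟨x, z, hs⟩ := h.exists_str n
  have key : ∀ x : ℤ, ∃ (x' : Fin (2 ^ (n + 1))) (a : ℤ), ((x' : ℕ) : ℤ) = x + 2 ^ (n + 1) * a := by
    intro x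
    have h0 := Int.emod_nonneg x (show (2 : ℤ) ^ (n + 1) ≠ 0 by positivity)
    have h1 := Int.emod_lt_of_pos x (show (0 : ℤ) < 2 ^ (n + 1) by positivity)
    have h2 := Int.emod_add_mul_ediv x (2 ^ (n + 1))
    refine ⟨⟨(x % 2 ^ (n + 1)).toNat, ?_⟩, - (x / 2 ^ (n + 1)), ?_⟩
    · zify; rwa [Int.toNat_of_nonneg h0]
    · dsimp only; rw [Int.toNat_of_nonneg h0]; linarith
  obtain ⟨x', a, hx⟩ := key x
  obtain ⟨z', b, hz⟩ := key z
  exact ⟨x', z', by rw [hx, hz]; exact ⟨hs.hv.translate a b, hs.hh.translate b a⟩⟩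

section patterns
variable {M : Mach}

/-- `a` lies in the half-open range of a board of level `t`. -/
def Cov (t : ℕ) (a : ℤ) : Prop := W t ≤ a % (4 * W t) ∧ a % (4 * W t) < 3 * W t

open scoped Classical in
/-- The sites of a square not lying in a board of level less than `K`. -/
noncomputable def unc (K : ℕ) (x z : ℤ) : Finset (ℤ × ℤ) :=
  (Finset.Ico 0 (W K) ×ˢ Finset.Ico 0 (W K)).filter
    fun p => ∀ t < K, ¬ (Cov t (p.1 - x) ∧ Cov t (p.2 - z))

theorem Valid.eq_canonY {y : ℤ → ℤ → Sym M} (h : Valid y) {n : ℕ} {x z : ℤ}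
    (hs : Str (fun i j => (y i j).s) n x z) {k : ℕ} (hk : 2 * k + 3 ≤ n) {d : ℕ → Fin 4}
    (hd : ∀ t, 2 * t + 1 < n → digits (fun i j => (y i j).s) x z t = d t) {i j : ℤ}
    (hi : Cov k (i - x)) (hj : Cov k (j - z)) : y i j = canonY M d (i - x) (j - z) := by
  have hW := W_pos k
  have key : ∀ a, Cov k a → ∃ (p : ℤ) (s : ℕ), (s : ℤ) < 2 * W k ∧ a = 4 * W k * p + W k + s := by
    rintro a ⟨h0, h1⟩
    refine ⟨a / (4 * W k), (a % (4 * W k) - W k).toNat, ?_, ?_⟩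
    · omega
    · rw [Int.toNat_of_nonneg (by omega)]
      linarith [Int.emod_add_mul_ediv a (4 * W k)]
  obtain ⟨p, s, hs1, hp⟩ := key _ hi
  obtain ⟨q, r, hr1, hq⟩ := key _ hj
  have hi' : ¬ (2 : ℤ) ^ n ∣ i - x := not_two_pow_dvd k hk (p := p) (by omega) (by omega)
  have hj' : ¬ (2 : ℤ) ^ n ∣ j - z := not_two_pow_dvd k hk (p := q) (by omega) (by omega)
  have hl := h.labels hs hk hd (p := p) (q := q) rfl rfl
  have h1 := hl.1 s r hs1 hr1.le
  have h2 := hl.2 s r hs1.le hr1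
  have h3 := hs.eq_canon h.rule1 hi' hj'
  rw [← hp, ← hq, add_sub_cancel, add_sub_cancel] at h1 h2
  have h4 : (y i j).s = canon d (i - x) (j - z) := by
    rw [h3, canon, canon, lineAt_congr hd hi', lineAt_congr hd hj']
  rw [canonY, ← h1, ← h2, ← h4]

theorem covSet_card : ((Finset.range 4 ×ˢ Finset.range 4).filter fun p =>
    ¬ ((p.1 = 1 ∨ p.1 = 2) ∧ (p.2 = 1 ∨ p.2 = 2))).card = 12 := by decide

theorem W_succ (K : ℕ) : W (K + 1) = 4 * W K := by unfold W; ring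

theorem cov_emod {t K : ℕ} (h : t < K) (a : ℤ) : Cov t (a % W K) ↔ Cov t a := by
  rw [Cov, Cov, Int.emod_emod_of_dvd _ (W_dvd h)]

theorem cov_of_lt {K : ℕ} {a : ℤ} (h0 : 0 ≤ a) (h1 : a < 4 * W K) :
    Cov K a ↔ (a / W K).toNat = 1 ∨ (a / W K).toNat = 2 := by
  have hW := W_pos K
  have h2 := Int.emod_add_mul_ediv a (W K)
  have h3 := Int.emod_nonneg a hW.ne'
  have h4 := Int.emod_lt_of_pos a hW
  have h5 := Int.ediv_nonneg h0 hW.le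
  have h6 : a / W K < 4 := Int.ediv_lt_of_lt_mul hW (by linarith)
  rw [Cov, Int.emod_eq_of_lt h0 h1]
  have h7 : a / W K = 0 ∨ a / W K = 1 ∨ a / W K = 2 ∨ a / W K = 3 := by omega
  rcases h7 with h7 | h7 | h7 | h7 <;> rw [h7] at h2 ⊢ <;> norm_num <;> omega

theorem unc_zero_card (K : ℕ) : (unc K 0 0).card ≤ 4 * 12 ^ K := by
  induction K with
  | zero =>
    classical
    refine (Finset.card_le_card fun p hp => (Finset.mem_filter.1 hp).1).trans ?_
    simp [W]
  | succ K ih =>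
    have hW := W_pos K
    rw [pow_succ, ← mul_assoc]
    refine le_trans ?_ (Nat.mul_le_mul ih covSet_card.le)
    rw [← Finset.card_product]
    refine Finset.card_le_card_of_injOn (fun p => ((p.1 % W K, p.2 % W K),
      ((p.1 / W K).toNat, (p.2 / W K).toNat))) ?_ ?_
    · rintro ⟨a, b⟩ hp
      simp only [unc, Finset.coe_filter, Finset.mem_product, Finset.mem_Ico, sub_zero,
        Set.mem_ofPred_eq, W_succ, Finset.coe_product, Set.mem_prod, Finset.mem_range] at hp ⊢
      obtain ⟨⟨⟨a0, a1⟩, b0, b1⟩, hc⟩ := hp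
      refine ⟨⟨⟨⟨Int.emod_nonneg _ hW.ne', Int.emod_lt_of_pos _ hW⟩, Int.emod_nonneg _ hW.ne',
        Int.emod_lt_of_pos _ hW⟩, fun t ht => ?_⟩, ⟨?_, ?_⟩, ?_⟩
      · rw [cov_emod ht, cov_emod ht]
        exact hc t (by omega)
      · have := Int.ediv_lt_of_lt_mul hW (a := a) (b := 4) (by linarith); omega
      · have := Int.ediv_lt_of_lt_mul hW (a := b) (b := 4) (by linarith); omega
      · rw [← cov_of_lt a0 a1, ← cov_of_lt b0 b1]
        exact hc K (by omega)
    · rintro ⟨a, b⟩ hp ⟨a', b'⟩ hp' h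
      simp only [unc, Finset.coe_filter, Finset.mem_product, Finset.mem_Ico,
        Set.mem_ofPred_eq, Prod.mk.injEq] at hp hp' h ⊢
      have key : ∀ a a' : ℤ, 0 ≤ a → 0 ≤ a' → a % W K = a' % W K →
          (a / W K).toNat = (a' / W K).toNat → a = a' := by
        intro a a' h0 h0' h1 h2
        have h3 := Int.ediv_nonneg h0 hW.le
        have h4 := Int.ediv_nonneg h0' hW.le
        rw [← Int.emod_add_mul_ediv a (W K), ← Int.emod_add_mul_ediv a' (W K), h1,
          show a / W K = a' / W K by omega]
      exact ⟨key _ _ hp.1.1.1 hp'.1.1.1 h.1.1 h.2.1, key _ _ hp.1.2.1 hp'.1.2.1 h.1.2 h.2.2⟩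

theorem unc_card (K : ℕ) (x z : ℤ) : (unc K x z).card ≤ 4 * 12 ^ K := by
  have hW := W_pos K
  refine le_trans ?_ (unc_zero_card K)
  refine Finset.card_le_card_of_injOn (fun p => ((p.1 - x) % W K, (p.2 - z) % W K)) ?_ ?_
  · rintro ⟨a, b⟩ hp
    simp only [unc, Finset.coe_filter, Finset.mem_product, Finset.mem_Ico, sub_zero,
      Set.mem_ofPred_eq] at hp ⊢
    refine ⟨⟨⟨Int.emod_nonneg _ hW.ne', Int.emod_lt_of_pos _ hW⟩, Int.emod_nonneg _ hW.ne',
        Int.emod_lt_of_pos _ hW⟩, fun t ht => ?_⟩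
    rw [cov_emod ht, cov_emod ht]
    exact hp.2 t ht
  · rintro ⟨a, b⟩ hp ⟨a', b'⟩ hp' h
    simp only [unc, Finset.coe_filter, Finset.mem_product, Finset.mem_Ico,
      Set.mem_ofPred_eq, Prod.mk.injEq] at hp hp' h ⊢
    have key : ∀ a a' x : ℤ, 0 ≤ a → 0 ≤ a' → a < W K → a' < W K →
        (a - x) % W K = (a' - x) % W K → a = a' := by
      intro a a' x h0 h0' h1 h1' h2
      have h3 := (Int.emod_emod_of_dvd (a - x) (dvd_refl (W K)))
      have h4 : a % W K = a' % W K := by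
        have := congrArg (fun c => (c + x) % W K) h2
        simpa using this
      rwa [Int.emod_eq_of_lt h0 h1, Int.emod_eq_of_lt h0' h1'] at h4
    exact ⟨key _ _ _ hp.1.1.1 hp'.1.1.1 hp.1.1.2 hp'.1.1.2 h.1,
      key _ _ _ hp.1.2.1 hp'.1.2.1 hp.1.2.2 hp'.1.2.2 h.2⟩

/-- The patterns occurring on `[0, m) ^ 2`. -/
def pats {A : Type*} (Y : Set (ℤ → ℤ → A)) (m : ℕ) : Set (Fin m → Fin m → A) :=
  {p | ∃ y ∈ Y, ∀ i j : Fin m, y (i : ℕ) (j : ℕ) = p i j}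

theorem card_pats_le (K : ℕ) : Nat.card (pats {y : ℤ → ℤ → Sym M | Valid y} (2 * 4 ^ K)) ≤
    2 ^ (2 * K + 4) * 2 ^ (2 * K + 4) * 4 ^ (K + 1) * Nat.card (Sym M) ^ (4 * 12 ^ K) := by
  have hWK : ((2 * 4 ^ K : ℕ) : ℤ) = W K := by
    unfold W; push_cast; rw [pow_succ, pow_mul]; norm_num [mul_comm]
  let Key := Fin (2 ^ (2 * K + 3 + 1)) × Fin (2 ^ (2 * K + 3 + 1)) × (Fin (K + 1) → Fin 4)
  have hex : ∀ p : pats {y : ℤ → ℤ → Sym M | Valid y} (2 * 4 ^ K), ∃ (y : ℤ → ℤ → Sym M) (κ : Key),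
      Valid y ∧ (∀ i j : Fin (2 * 4 ^ K), y (i : ℕ) (j : ℕ) = p.1 i j) ∧
      Str (fun i j => (y i j).s) (2 * K + 3) (κ.1 : ℕ) (κ.2.1 : ℕ) ∧
      ∀ t : Fin (K + 1), digits (fun i j => (y i j).s) (κ.1 : ℕ) (κ.2.1 : ℕ) t = κ.2.2 t := by
    rintro ⟨p, y, hy, hp⟩
    obtain ⟨x, z, hs⟩ := hy.rule1.exists_str_bounded (2 * K + 3)
    exact ⟨y, ⟨x, z, fun t => digits (fun i j => (y i j).s) (x : ℕ) (z : ℕ) t⟩, hy, hp, hs,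
      fun t => rfl⟩
  choose y κ hy hp hs hd using hex
  let Φ : pats {y : ℤ → ℤ → Sym M | Valid y} (2 * 4 ^ K) →
      (Σ k : Key, (unc K (k.1 : ℕ) (k.2.1 : ℕ) → Sym M)) :=
    fun p => ⟨κ p, fun q => y p q.1.1 q.1.2⟩
  have hΦ : Function.Injective Φ := by
    intro p p' h
    obtain ⟨h1, h2⟩ := Sigma.mk.inj_iff.1 h
    have hdp := hd p
    have hsp := hs p
    have hdp' := hd p'
    have hsp' := hs p'
    rw [← h1] at hdp' hsp'
    have h3 : ∀ q ∈ unc K ((κ p).1 : ℕ) ((κ p).2.1 : ℕ), y p q.1 q.2 = y p' q.1 q.2 := by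
      generalize κ p = k at h1 h2
      subst h1
      exact fun q hq => congrFun (eq_of_heq h2) ⟨q, hq⟩
    apply Subtype.ext
    funext i j
    rw [← hp, ← hp]
    by_cases hu : ((i : ℤ), (j : ℤ)) ∈ unc K ((κ p).1 : ℕ) ((κ p).2.1 : ℕ)
    · exact h3 _ hu
    · have hi : ((i : ℕ) : ℤ) < W K := by rw [← hWK]; exact_mod_cast i.2
      have hj : ((j : ℕ) : ℤ) < W K := by rw [← hWK]; exact_mod_cast j.2
      simp only [unc, Finset.mem_filter, Finset.mem_product, Finset.mem_Ico, not_and, not_forall,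
        not_not] at hu
      obtain ⟨t, ht, hc1, hc2⟩ := hu ⟨⟨by omega, hi⟩, by omega, hj⟩
      let d : ℕ → Fin 4 := fun t => if h : t < K + 1 then (κ p).2.2 ⟨t, h⟩ else 0
      have hdd : ∀ t, 2 * t + 1 < 2 * K + 3 → ∃ h : t < K + 1, d t = (κ p).2.2 ⟨t, h⟩ :=
        fun t ht => ⟨by omega, dif_pos (by omega)⟩
      rw [(hy p).eq_canonY hsp (k := t) (by omega) (d := d) (fun t ht => by
          obtain ⟨h, e⟩ := hdd t ht; rw [e]; exact hdp ⟨t, h⟩) hc1 hc2,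
        (hy p').eq_canonY hsp' (k := t) (by omega) (d := d) (fun t ht => by
          obtain ⟨h, e⟩ := hdd t ht; rw [e]; exact hdp' ⟨t, h⟩) hc1 hc2]
  refine (Nat.card_le_card_of_injective Φ hΦ).trans ?_
  rw [Nat.card_sigma]
  have hne : Nonempty (Sym M) := ⟨canonY M (fun _ => 0) 0 0⟩
  refine (Finset.sum_le_card_nsmul _ _ (Nat.card (Sym M) ^ (4 * 12 ^ K)) fun k _ => ?_).trans ?_
  · rw [Nat.card_fun, Nat.card_eq_fintype_card (α := unc _ _ _), Fintype.card_coe]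
    exact Nat.pow_le_pow_right Nat.card_pos (unc_card _ _ _)
  · simp [Key, mul_assoc]

end patterns

section marks

/-- Marked sites; `c` tells whether the sites of odd abscissa are marked. -/
def Sym1.mark (c : Bool) (s : Sym1) : Bool :=
  if s.pX then c else if s.V.red then decide (2 ≤ s.V.dig.val) else decide (s.V.dig.val % 2 = 1)

/-- The marks of the columns of a given level. -/
def bitOf (c : Bool) (d : ℕ → Fin 4) : ℕ → Bool
  | 0 => c
  | l + 1 => if l % 2 = 0 then decide (2 ≤ (d (l / 2)).val) else decide ((d (l / 2)).val % 2 = 1)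

theorem mark_of_lineAt {c : Bool} {d : ℕ → Fin 4} {a b : ℤ} {s : Sym1} (ha : a ≠ 0)
    (hp : s.pX = true ↔ ¬ (2 : ℤ) ∣ a) (hv : s.V = lineAt d a b) :
    s.mark c = bitOf c d (lev a) := by
  rw [← lev_eq_zero_iff ha] at hp
  rw [Sym1.mark, hv, lineAt, if_neg ha]
  rcases h : lev a with _ | l
  · rw [if_pos (hp.2 h), bitOf]
  · rw [if_neg (by rw [hp, h]; simp)]
    have : (l + 1) % 2 = 1 ↔ l % 2 = 0 := by omega
    simp only [bitOf, digOf, this, decide_eq_true_eq]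
    split_ifs <;> rfl

theorem Str.mark {y : ℤ → ℤ → Sym1} {n : ℕ} {x z : ℤ} (hs : Str y n x z) (h : Rule1 y) (c : Bool)
    {i j : ℤ} (hi : ¬ (2 : ℤ) ^ n ∣ i - x) :
    (y i j).mark c = bitOf c (digits y x z) (lev (i - x)) :=
  mark_of_lineAt (fun h0 => hi (h0 ▸ dvd_zero _)) (hs.hv.par i j) (hs.lineV h hi)

theorem canon_mark (c : Bool) (d : ℕ → Fin 4) {a : ℤ} (b : ℤ) (ha : a ≠ 0) :
    (canon d a b).mark c = bitOf c d (lev a) :=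
  mark_of_lineAt ha (by simp [canon]) rfl

/-- The number of marks of level less than `n` in a window of length `2 ^ n`. -/
def markCount (c : Bool) (d : ℕ → Fin 4) : ℕ → ℕ
  | 0 => 0
  | n + 1 => 2 * markCount c d n + (bitOf c d n).toNat

theorem markCount_eq (c : Bool) (d : ℕ → Fin 4) (K : ℕ) :
    markCount c d (2 * K + 1) = c.toNat * 4 ^ K + pref d K := by
  induction K with
  | zero => simp [markCount, bitOf, pref]
  | succ K ih =>
    rw [show 2 * (K + 1) + 1 = (2 * K + 1) + 1 + 1 by ring, markCount, markCount, ih, pref,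
      pow_succ]
    simp only [bitOf, show (2 * K) % 2 = 0 by omega, show (2 * K + 1) % 2 = 1 by omega,
      show 2 * K / 2 = K by omega, show (2 * K + 1) / 2 = K by omega]
    generalize d K = e
    have : ((if 0 = 0 then decide (2 ≤ e.val) else decide (e.val % 2 = 1)).toNat) * 2 +
      (if 1 = 0 then decide (2 ≤ e.val) else decide (e.val % 2 = 1)).toNat = e.val := by
      revert e; decide
    linarith

theorem sum_dvd (n : ℕ) (a : ℤ) :
    ∑ i ∈ Finset.range (2 ^ n), (if (2 : ℤ) ^ n ∣ a + i then 1 else 0) = 1 := by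
  have h0 : (0 : ℤ) < 2 ^ n := by positivity
  have h1 := Int.emod_nonneg (-a) h0.ne'
  have h2 := Int.emod_lt_of_pos (-a) h0
  have h3 := Int.emod_add_mul_ediv (-a) (2 ^ n)
  have h4 : (((-a % 2 ^ n).toNat : ℕ) : ℤ) = -a % 2 ^ n := Int.toNat_of_nonneg h1
  rw [Finset.sum_eq_single (-a % 2 ^ n).toNat, if_pos]
  · rw [h4]; exact ⟨-(-a / 2 ^ n), by linarith⟩
  · intro i hi hne
    rw [if_neg]
    rintro ⟨q, hq⟩
    apply hne
    have hi' : (i : ℤ) < 2 ^ n := by exact_mod_cast Finset.mem_range.1 hi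
    have : -a % 2 ^ n = i := by
      rw [show -a = i + 2 ^ n * (-q) by linarith, Int.add_mul_emod_self_left,
        Int.emod_eq_of_lt (by omega) hi']
    omega
  · intro h
    exact absurd (Finset.mem_range.2 (by zify; rw [h4]; exact h2)) h

theorem sum_range_two_pow_succ (f : ℤ → ℕ) (n : ℕ) (a : ℤ) :
    ∑ i ∈ Finset.range (2 ^ (n + 1)), f (a + i) = ∑ i ∈ Finset.range (2 ^ n), f (a + i) +
      ∑ i ∈ Finset.range (2 ^ n), f (a + 2 ^ n + i) := by
  rw [pow_succ, mul_two, Finset.sum_range_add]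
  push_cast [← add_assoc]
  rfl

theorem sum_bitOf (c : Bool) (d : ℕ → Fin 4) (n : ℕ) (a : ℤ) : ∑ i ∈ Finset.range (2 ^ n),
    (if ¬ (2 : ℤ) ^ n ∣ a + i then (bitOf c d (lev (a + i))).toNat else 0) = markCount c d n := by
  induction n generalizing a with
  | zero => simp [markCount]
  | succ n ih =>
    have key : ∀ b : ℤ, ((if ¬ (2 : ℤ) ^ (n + 1) ∣ b then (bitOf c d (lev b)).toNat else 0) : ℕ) +
        (if (2 : ℤ) ^ (n + 1) ∣ b then 1 else 0) * (bitOf c d n).toNat =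
        (if ¬ (2 : ℤ) ^ n ∣ b then (bitOf c d (lev b)).toNat else 0) +
        (if (2 : ℤ) ^ n ∣ b then 1 else 0) * (bitOf c d n).toNat := by
      intro b
      by_cases h1 : (2 : ℤ) ^ (n + 1) ∣ b
      · simp [h1, (pow_dvd_pow 2 (Nat.le_succ n)).trans h1]
      · by_cases h2 : (2 : ℤ) ^ n ∣ b
        · simp [h1, h2, Lev.lev_eq ⟨h2, h1⟩]
        · simp [h1, h2]
    have h1 := Finset.sum_congr rfl fun i (_ : i ∈ Finset.range (2 ^ (n + 1))) => key (a + i)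
    simp only [Finset.sum_add_distrib, ← Finset.sum_mul, sum_dvd] at h1
    rw [sum_range_two_pow_succ fun b => if ¬ (2 : ℤ) ^ n ∣ b then (bitOf c d (lev b)).toNat else 0,
      sum_range_two_pow_succ fun b => if (2 : ℤ) ^ n ∣ b then 1 else 0] at h1
    simp only [ih, sum_dvd] at h1
    rw [markCount]
    linarith

theorem sum_marks {c : Bool} {d : ℕ → Fin 4} {n m : ℕ} (hm : m = 2 ^ n) {x : ℤ} {b : ℤ → Bool}
    (hb : ∀ i, ¬ (2 : ℤ) ^ n ∣ i - x → b i = bitOf c d (lev (i - x))) :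
    markCount c d n ≤ ∑ i : Fin m, (b (i : ℕ)).toNat ∧
      ∑ i : Fin m, (b (i : ℕ)).toNat ≤ markCount c d n + 1 := by
  subst hm
  rw [Fin.sum_univ_eq_sum_range (fun i => (b (i : ℕ)).toNat)]
  have h1 := sum_bitOf c d n (-x)
  have h2 := sum_dvd n (-x)
  constructor
  · rw [← h1]
    refine Finset.sum_le_sum fun i _ => ?_
    split_ifs with h
    · exact Nat.zero_le _
    · rw [hb _ (by rwa [sub_eq_neg_add]), sub_eq_neg_add]
  · rw [← h1, ← h2, ← Finset.sum_add_distrib]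
    refine Finset.sum_le_sum fun i _ => ?_
    by_cases h : (2 : ℤ) ^ n ∣ -x + i
    · simp only [h, not_true_eq_false, if_true, if_false]
      have := Bool.toNat_le (b i); omega
    · rw [if_pos h, hb _ (by rwa [sub_eq_neg_add]), sub_eq_neg_add]
      exact Nat.le_add_right _ _

end marks

section layer

/-- A condition on planar configurations depending only on the sites around the origin. -/
def IsLocal {A : Type*} (R : (ℤ → ℤ → A) → Prop) : Prop :=
  ∀ y y', (∀ a b, -1 ≤ a → a ≤ 1 → -1 ≤ b → b ≤ 1 → y a b = y' a b) → R y → R y'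

/-- The configurations satisfying a condition around every site. -/
def everywhere {A : Type*} (R : (ℤ → ℤ → A) → Prop) : Set (ℤ → ℤ → A) :=
  {y | ∀ i j, R fun a b => y (i + a) (j + b)}

/-- The number of marked sites of `[0, m) ^ 2`. -/
def marks {A : Type*} (mark : A → Bool) (y : ℤ → ℤ → A) (m : ℕ) : ℕ :=
  ∑ j : Fin m, ∑ i : Fin m, (mark (y (i : ℕ) (j : ℕ))).toNat

theorem isLocal_ruleAt (M : Mach) : IsLocal fun y : ℤ → ℤ → Sym M => RuleAt y 0 0 :=
  fun y y' he h => h.congr fun a b h1 h2 h3 h4 => by simpa using he a b h1 h2 h3 h4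

theorem everywhere_ruleAt (M : Mach) :
    everywhere (fun y : ℤ → ℤ → Sym M => RuleAt y 0 0) = {y | Valid y} := by
  ext y
  refine forall₂_congr fun i j => ⟨fun h => h.congr fun a b _ _ _ _ => ?_,
    fun h => h.congr fun a b _ _ _ _ => ?_⟩ <;> simp

theorem marks_bounds {A : Type*} {mark : A → Bool} {y : ℤ → ℤ → A} {c : Bool} {d : ℕ → Fin 4}
    {K : ℕ} {x : ℤ} (h : ∀ i j, ¬ (2 : ℤ) ^ (2 * K + 1) ∣ i - x →
      mark (y i j) = bitOf c d (lev (i - x))) :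
    2 * 4 ^ K * (c.toNat * 4 ^ K + pref d K) ≤ marks mark y (2 * 4 ^ K) ∧
      marks mark y (2 * 4 ^ K) ≤ 2 * 4 ^ K * (c.toNat * 4 ^ K + pref d K + 1) := by
  have key : ∀ j : Fin (2 * 4 ^ K), _ := fun j => sum_marks (n := 2 * K + 1) (m := 2 * 4 ^ K)
    (by rw [pow_succ, pow_mul]; norm_num [mul_comm]) (b := fun i => mark (y i (j : ℕ)))
    fun i hi => h i _ hi
  simp only [markCount_eq] at key
  constructor
  · simpa [marks] using Finset.card_nsmul_le_sum Finset.univ _ _ fun j _ => (key j).1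
  · simpa [marks] using Finset.sum_le_card_nsmul Finset.univ _ _ fun j _ => (key j).2

theorem logb_card_pats_le (M : Mach) {ε : ℝ} (hε : 0 < ε) : ∀ᶠ K in atTop,
    Real.logb 2 (Nat.card (pats {y : ℤ → ℤ → Sym M | Valid y} (2 * 4 ^ K))) ≤
      ε * ((2 * 4 ^ K : ℕ) : ℝ) ^ 2 := by
  set L := Real.logb 2 (Nat.card (Sym M)) with hL
  have h1 : Tendsto (fun K : ℕ => 6 * ((K : ℝ) ^ 1 / 16 ^ K) + 10 * ((K : ℝ) ^ 0 / 16 ^ K) +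
      4 * L * (12 / 16 : ℝ) ^ K) atTop (nhds (6 * 0 + 10 * 0 + 4 * L * 0)) :=
    (((tendsto_pow_const_div_const_pow_of_one_lt 1 (by norm_num)).const_mul _).add
      ((tendsto_pow_const_div_const_pow_of_one_lt 0 (by norm_num)).const_mul _)).add
      ((tendsto_pow_atTop_nhds_zero_of_lt_one (by norm_num) (by norm_num)).const_mul _)
  filter_upwards [h1.eventually_lt_const (show _ < 4 * ε by simpa using hε)] with K hK
  have hc := card_pats_le (M := M) K
  have hne : Nonempty (Sym M) := ⟨canonY M (fun _ => 0) 0 0⟩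
  have hSM : (0 : ℝ) < Nat.card (Sym M) := Nat.cast_pos.2 Nat.card_pos
  have hle : Real.logb 2 (Nat.card (pats {y : ℤ → ℤ → Sym M | Valid y} (2 * 4 ^ K))) ≤
      6 * K + 10 + 4 * L * 12 ^ K := by
    rcases Nat.eq_zero_or_pos (Nat.card (pats {y : ℤ → ℤ → Sym M | Valid y} (2 * 4 ^ K)))
      with h0 | h0
    · rw [h0]
      have : 0 ≤ L := Real.logb_nonneg (by norm_num) (Nat.one_le_cast.2 Nat.card_pos)
      simp; positivity
    · refine (Real.logb_le_logb_of_le (by norm_num) (Nat.cast_pos.2 h0) (Nat.cast_le.2 hc)).trans ?_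
      have h4 : (4 : ℝ) = 2 ^ 2 := by norm_num
      push_cast
      rw [h4, Real.logb_mul (by positivity) (by positivity), Real.logb_mul (by positivity)
        (by positivity), Real.logb_mul (by positivity) (by positivity), Real.logb_pow,
        Real.logb_pow, Real.logb_pow, Real.logb_pow, Real.logb_self_eq_one (by norm_num), ← hL]
      push_cast
      linarith
  refine hle.trans ?_
  have h16 : (0 : ℝ) < 16 ^ K := by positivity
  have e1 : ((2 * 4 ^ K : ℕ) : ℝ) ^ 2 = 4 * 16 ^ K := by
    push_cast; rw [mul_pow, ← pow_mul, mul_comm K, pow_mul]; norm_num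
  have e2 : 6 * (K : ℝ) + 10 + 4 * L * 12 ^ K = (6 * ((K : ℝ) ^ 1 / 16 ^ K) +
      10 * ((K : ℝ) ^ 0 / 16 ^ K) + 4 * L * (12 / 16 : ℝ) ^ K) * 16 ^ K := by
    rw [div_pow]; field_simp
  rw [e1, e2]
  nlinarith

/-- A planar subshift of finite type with few patterns and prescribed density of marks. -/
theorem exists_layer {h : ℝ} (hh : Pi1Computable h) (h0 : 0 ≤ h) {a b : ℕ} (hb : 0 < b)
    {α : ℝ} (hα : α * a = h * b) (hα1 : α < 1) (ha : 0 < a) :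
    ∃ (A : Type) (_ : Finite A) (_ : Nonempty A) (R : (ℤ → ℤ → A) → Prop) (mark : A → Bool),
      IsLocal R ∧ ∀ ε > 0, ∀ᶠ K in atTop,
        (∃ y ∈ everywhere R, (α - ε) * ((2 * 4 ^ K : ℕ) : ℝ) ^ 2 ≤ marks mark y (2 * 4 ^ K)) ∧
        (∀ y ∈ everywhere R, (marks mark y (2 * 4 ^ K) : ℝ) ≤ (α + ε) * ((2 * 4 ^ K : ℕ) : ℝ) ^ 2) ∧
        Real.logb 2 (Nat.card (pats (everywhere R) (2 * 4 ^ K))) ≤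
          ε * ((2 * 4 ^ K : ℕ) : ℝ) ^ 2 := by
  obtain ⟨f, hf, hfa, hlim⟩ := hh
  obtain ⟨c, P, ⟨d, hd1, hd2⟩, hP⟩ := exists_density_prog f hf hfa hlim h0 hb hα hα1 ha
  refine ⟨Sym P.toMach, inferInstance, ⟨canonY _ (fun _ => 0) 0 0⟩, fun y => RuleAt y 0 0,
    fun s => s.s.mark c, isLocal_ruleAt _, fun ε hε => ?_⟩
  rw [everywhere_ruleAt]
  have h4 : Tendsto (fun K : ℕ => (4 : ℝ) ^ K) atTop atTop :=
    tendsto_pow_atTop_atTop_of_one_lt (by norm_num)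
  obtain ⟨n₀, hn₀⟩ := (h4.eventually_ge_atTop (1 / ε)).exists
  obtain ⟨N, T, hN, hNT⟩ := hP ε hε n₀
  filter_upwards [logb_card_pats_le P.toMach hε, h4.eventually_ge_atTop (1 / (2 * ε)),
    eventually_ge_atTop N, eventually_ge_atTop T] with K hK1 hK2 hK3 hK4
  have hpos : (0 : ℝ) < 4 ^ K := by positivity
  have hposN : (0 : ℝ) < 4 ^ N := by positivity
  refine ⟨⟨canonY P.toMach d, ?_, ?_⟩, fun y hy => ?_, hK1⟩
  · refine valid_canonY d (fun k x y hx hy => ?_) ?_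
    · obtain ⟨O, hO, h⟩ := P.board_halt d hx hy
      exact h.2 fun n _ => hd1 O hO n
    · obtain ⟨O, hO, -⟩ := P.board_halt d (k := 0) (x := W 0) (y := W 0) (by decide) (by decide)
      exact hd1 O hO 0
  · have h1 := (marks_bounds (K := K) (x := 0) (c := c) (d := d)
      (mark := fun s : Sym P.toMach => s.s.mark c) (y := canonY P.toMach d) fun i j hi => by
        rw [sub_zero] at hi ⊢
        exact canon_mark c d j fun h0 => hi (h0 ▸ dvd_zero _)).1
    refine le_trans ?_ (Nat.cast_le.2 h1)
    have h2 := hd2 K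
    push_cast at h2 ⊢
    rw [div_le_iff₀ (by positivity)] at hK2
    nlinarith
  · obtain ⟨x, z, hs⟩ := hy.rule1.exists_str (2 * K + 3)
    set e := digits (fun i j => (y i j).s) x z with he
    have h1 := (marks_bounds (K := K) (x := x) (c := c) (d := e)
      (mark := fun s : Sym P.toMach => s.s.mark c) (y := y) fun i j hi =>
        (hs.mono (show 2 * K + 1 ≤ 2 * K + 3 by omega)).mark hy.rule1 c hi).2
    have hWm : W K % (4 * W K) = W K := Int.emod_eq_of_lt (W_pos K).le (by linarith [W_pos K])
    obtain ⟨O, hO, h⟩ := P.board_halt e hWm hWm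
    have h2 := hNT e O hO fun n hn => h.1 (hy.not_halt hs le_rfl) n
      (hn.trans (hK4.trans Nat.lt_two_pow_self.le))
    have h3 := pref_le e N (K - N)
    rw [Nat.add_sub_cancel' hK3] at h3
    have h5 : (4 : ℝ) ^ K = 4 ^ N * 4 ^ (K - N) := by rw [← pow_add, Nat.add_sub_cancel' hK3]
    have h6 : (pref e K + 1 : ℝ) ≤ (pref e N + 1) * 4 ^ (K - N) := by exact_mod_cast h3
    have h7 : (c.toNat * 4 ^ K + pref e K + 1 : ℝ) ≤ (2 * α + 2 * ε) * 4 ^ K := by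
      have h8 : (4 : ℝ) ^ n₀ ≤ 4 ^ N := pow_le_pow_right₀ (by norm_num) hN
      have h9 : 1 ≤ 4 ^ N * ε := by
        rw [div_le_iff₀ hε] at hn₀; nlinarith
      push_cast at h2
      have h10 : (0 : ℝ) < 4 ^ (K - N) := by positivity
      rw [h5]
      nlinarith
    refine (Nat.cast_le.2 h1).trans ?_
    push_cast
    nlinarith

end layer

section payload

/-- The patterns on `[0, m) ^ 2` number about `2 ^ (β * m ^ 2)`, for arbitrarily large `m`. -/
def HasEntropy {A : Type*} (Y : Set (ℤ → ℤ → A)) (β : ℝ) : Prop :=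
  ∀ ε > 0, ∀ m₀ : ℕ, ∃ m ≥ m₀, (β - ε) * (m : ℝ) ^ 2 ≤ Real.logb 2 (Nat.card (pats Y m)) ∧
    Real.logb 2 (Nat.card (pats Y m)) ≤ (β + ε) * (m : ℝ) ^ 2

/-- Every marked site carries a free payload, the other sites a trivial one. -/
def Loaded {A : Type*} (R : (ℤ → ℤ → A) → Prop) (mark : A → Bool) (r : ℕ)
    (y : ℤ → ℤ → A × Fin (2 ^ r)) : Prop :=
  R (fun i j => (y i j).1) ∧ (mark (y 0 0).1 = false → (y 0 0).2 = 0)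

variable {A : Type*} {R : (ℤ → ℤ → A) → Prop} {mark : A → Bool} {r : ℕ}

theorem IsLocal.loaded (h : IsLocal R) : IsLocal (Loaded R mark r) := fun y y' he hy =>
  ⟨h _ _ (fun a b h1 h2 h3 h4 => congrArg Prod.fst (he a b h1 h2 h3 h4)) hy.1, by
    rw [← he 0 0 (by omega) (by omega) (by omega) (by omega)]; exact hy.2⟩

theorem mem_everywhere_loaded {y : ℤ → ℤ → A × Fin (2 ^ r)} : y ∈ everywhere (Loaded R mark r) ↔
    (fun i j => (y i j).1) ∈ everywhere R ∧ ∀ i j, mark (y i j).1 = false → (y i j).2 = 0 := by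
  simp only [everywhere, Loaded, Set.mem_ofPred_eq, forall_and, add_zero]

/-- The payloads compatible with a pattern. -/
abbrev Loads (mark : A → Bool) (r : ℕ) {m : ℕ} (q : Fin m → Fin m → A) : Type :=
  ∀ j i, {t : Fin (2 ^ r) // mark (q i j) = false → t = 0}

theorem card_loads {m : ℕ} (q : Fin m → Fin m → A) :
    Nat.card (Loads mark r q) = 2 ^ (r * ∑ j, ∑ i, (mark (q i j)).toNat) := by
  have key : ∀ b : Bool, Nat.card {t : Fin (2 ^ r) // b = false → t = 0} = 2 ^ (r * b.toNat) := by
    rintro (_ | _) <;> simp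
  simp only [Nat.card_pi, key, Finset.prod_pow_eq_pow_sum, ← Finset.mul_sum]

theorem card_pats_loaded [Finite A] (m : ℕ) [Fintype (pats (everywhere R) m)] :
    Nat.card (pats (everywhere (Loaded R mark r)) m) =
      ∑ q : pats (everywhere R) m, 2 ^ (r * ∑ j, ∑ i, (mark (q.1 i j)).toNat) := by
  simp only [← card_loads]
  rw [← Nat.card_sigma]
  refine Nat.card_congr ⟨fun p => ⟨⟨fun i j => (p.1 i j).1, ?_⟩, fun j i => ⟨(p.1 i j).2, ?_⟩⟩,
    fun s => ⟨fun i j => (s.1.1 i j, s.2 j i), ?_⟩, fun p => rfl, fun s => rfl⟩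
  · obtain ⟨p, y, hy, hp⟩ := p
    exact ⟨fun i j => (y i j).1, (mem_everywhere_loaded.1 hy).1,
      fun i j => congrArg Prod.fst (hp i j)⟩
  · obtain ⟨p, y, hy, hp⟩ := p
    dsimp only
    rw [← hp]
    exact (mem_everywhere_loaded.1 hy).2 _ _
  · obtain ⟨⟨q, y, hy, hq⟩, t⟩ := s
    classical
    refine ⟨fun i j => (y i j, if h : ∃ a b : Fin m, i = (a : ℕ) ∧ j = (b : ℕ) then
      t h.choose_spec.choose h.choose else 0), mem_everywhere_loaded.2 ⟨hy, fun i j hm => ?_⟩,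
      fun i j => ?_⟩
    · dsimp only at hm ⊢
      split_ifs with h
      · refine (t h.choose_spec.choose h.choose).2 ?_
        dsimp only
        have key : ∀ a b : Fin m, i = (a : ℕ) → j = (b : ℕ) → mark (q a b) = false := by
          rintro a b rfl rfl
          rwa [hq] at hm
        exact key _ _ h.choose_spec.choose_spec.1 h.choose_spec.choose_spec.2
      · rfl
    · have h : ∃ a b : Fin m, ((i : ℕ) : ℤ) = (a : ℕ) ∧ ((j : ℕ) : ℤ) = (b : ℕ) := ⟨i, j, rfl, rfl⟩
      have h1 : h.choose = i := Fin.ext (by exact_mod_cast h.choose_spec.choose_spec.1.symm)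
      have h2 : h.choose_spec.choose = j :=
        Fin.ext (by exact_mod_cast h.choose_spec.choose_spec.2.symm)
      have h3 : ∀ a b, a = i → b = j → (t b a).1 = (t j i).1 := by rintro _ _ rfl rfl; rfl
      simp only [dif_pos h, hq, h3 _ _ h1 h2]

/-- Planar subshifts of finite type of prescribed entropy on small enough alphabets. -/
theorem exists_hasEntropy {h : ℝ} (hh : Pi1Computable h) (h0 : 0 ≤ h) {a b : ℕ} (hb : 0 < b)
    {α : ℝ} (hα : α * a = h * b) (hα1 : α < 1) (ha : 0 < a) :
    ∃ C : ℕ, ∀ r : ℕ, ∃ (A : Type) (_ : Finite A) (_ : Nonempty A) (R : (ℤ → ℤ → A) → Prop),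
      Nat.card A = C * 2 ^ r ∧ IsLocal R ∧ (everywhere R).Nonempty ∧
        HasEntropy (everywhere R) (r * α) := by
  obtain ⟨A, _, _, R, mark, hR, hev⟩ := exists_layer hh h0 hb hα hα1 ha
  refine ⟨Nat.card A, fun r => ⟨A × Fin (2 ^ r), inferInstance, inferInstance, Loaded R mark r,
    by simp, hR.loaded, ?_, fun ε hε m₀ => ?_⟩⟩
  · obtain ⟨K, ⟨y, hy, -⟩, -⟩ := (hev 1 one_pos).exists
    exact ⟨fun i j => (y i j, 0), mem_everywhere_loaded.2 ⟨hy, fun _ _ _ => rfl⟩⟩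
  have hε' : 0 < ε / (r + 1) := by positivity
  obtain ⟨K, ⟨⟨y, hy, hy1⟩, hmax, hpats⟩, hK⟩ := ((hev _ hε').and (eventually_ge_atTop m₀)).exists
  set m := 2 * 4 ^ K with hm
  have hm₀ : m₀ ≤ m := hK.trans (by
    have := Nat.lt_pow_self (n := K) (show 1 < 4 by norm_num); omega)
  set e := ε / (r + 1) with he
  have hee : ε = (r + 1) * e := by rw [he]; field_simp
  have := Fintype.ofFinite (pats (everywhere R) m)
  have hm2 : (0 : ℝ) ≤ (m : ℝ) ^ 2 := by positivity
  have hr : (0 : ℝ) ≤ r := Nat.cast_nonneg r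
  refine ⟨m, hm₀, ?_, ?_⟩
  · have h1 : 2 ^ (r * marks mark y m) ≤ Nat.card (pats (everywhere (Loaded R mark r)) m) := by
      rw [card_pats_loaded]
      exact Finset.single_le_sum (f := fun q : pats (everywhere R) m =>
        2 ^ (r * ∑ j, ∑ i, (mark (q.1 i j)).toNat)) (fun _ _ => Nat.zero_le _)
        (Finset.mem_univ ⟨fun i j => y (i : ℕ) (j : ℕ), y, hy, fun _ _ => rfl⟩)
    have h2 := Real.logb_le_logb_of_le (b := 2) (by norm_num) (by positivity)
      (Nat.cast_le (α := ℝ).2 h1)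
    push_cast at h2
    rw [Real.logb_pow, Real.logb_self_eq_one (by norm_num)] at h2
    push_cast at h2
    refine le_trans ?_ h2
    nlinarith [mul_le_mul_of_nonneg_left hy1 hr, mul_nonneg hε'.le hm2]
  · have h1 : Nat.card (pats (everywhere (Loaded R mark r)) m) ≤
        Nat.card (pats (everywhere R) m) * 2 ^ (r * ⌊(α + e) * (m : ℝ) ^ 2⌋₊) := by
      rw [card_pats_loaded]
      refine (Finset.sum_le_card_nsmul _ _ (2 ^ (r * ⌊(α + e) * (m : ℝ) ^ 2⌋₊)) ?_).trans ?_
      · rintro ⟨q, z, hz, hq⟩ -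
        refine Nat.pow_le_pow_right (by norm_num) (Nat.mul_le_mul_left _ (Nat.le_floor ?_))
        refine le_trans (le_of_eq ?_) (hmax z hz)
        simp only [marks, hq]
      · simp
    have hpos : 0 < Nat.card (pats (everywhere (Loaded R mark r)) m) := by
      have : Nonempty (pats (everywhere (Loaded R mark r)) m) :=
        ⟨fun i j => (y (i : ℕ) (j : ℕ), 0), fun i j => (y i j, 0),
          mem_everywhere_loaded.2 ⟨hy, fun _ _ _ => rfl⟩, fun _ _ => rfl⟩
      exact Nat.card_pos
    have hpos' : 0 < Nat.card (pats (everywhere R) m) := by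
      have : Nonempty (pats (everywhere R) m) :=
        ⟨fun i j => y (i : ℕ) (j : ℕ), y, hy, fun _ _ => rfl⟩
      exact Nat.card_pos
    have h2 := Real.logb_le_logb_of_le (b := 2) (by norm_num) (Nat.cast_pos.2 hpos)
      (Nat.cast_le (α := ℝ).2 h1)
    push_cast at h2
    rw [Real.logb_mul (by positivity) (by positivity), Real.logb_pow,
      Real.logb_self_eq_one (by norm_num)] at h2
    push_cast at h2
    have h3 := Nat.floor_le ((Nat.cast_nonneg _).trans (hmax y hy))
    refine h2.trans ?_
    nlinarith [mul_le_mul_of_nonneg_left h3 hr]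

end payload

section blocks
variable {A B : Type*}

/-- A coding of letters by `N × N` blocks whose position can be read off locally: a row of `w₁`
below a column of `w₀`, with a row of `w₁` to the right of the lowest `w₀`. -/
structure IsCode (N : ℕ) (w₀ w₁ : B) (code : A → ℕ → ℕ → B) : Prop where
  two_le : 2 ≤ N
  ne : w₀ ≠ w₁
  row_zero : ∀ s p, p < N → code s p 0 = w₁
  col_zero : ∀ s q, 1 ≤ q → q < N → code s 0 q = w₀
  row_one : ∀ s p, 1 ≤ p → p < N → code s p 1 = w₁
  inj : ∀ s t, (∀ p < N, ∀ q < N, code s p q = code t p q) → s = t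

theorem exists_isCode [Finite A] [Finite B] {w₀ w₁ : B} (h : w₀ ≠ w₁) {n : ℕ}
    (hc : Nat.card A ≤ Nat.card B ^ ((n + 1) * n)) :
    ∃ code : A → ℕ → ℕ → B, IsCode (n + 2) w₀ w₁ code := by
  have := Fintype.ofFinite A
  have := Fintype.ofFinite B
  obtain ⟨f⟩ : Nonempty (A ↪ (Fin (n + 1) × Fin n → B)) :=
    Function.Embedding.nonempty_of_card_le (by simpa [Nat.card_eq_fintype_card] using hc)
  refine ⟨fun s p q => if q = 0 then w₁ else if p = 0 then w₀ else if q = 1 then w₁ else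
    if hh : p - 1 < n + 1 ∧ q - 2 < n then f s (⟨p - 1, hh.1⟩, ⟨q - 2, hh.2⟩) else w₀,
    by omega, h, ?_, ?_, ?_, ?_⟩
  · intros; simp
  · intro s q h1 h2; simp; omega
  · intro s p h1 h2; simp; omega
  · intro s t hst
    apply f.injective
    funext ⟨p, q⟩
    have := hst (p + 1) (by omega) (q + 2) (by omega)
    simpa [Nat.lt_succ_iff.1 p.2] using this

/-- The block of lower left corner `(i, j)` codes `s`. -/
def Blk (code : A → ℕ → ℕ → B) (N : ℕ) (s : A) (z : ℤ → ℤ → B) (i j : ℤ) : Prop :=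
  ∀ p < N, ∀ q < N, z (i + p) (j + q) = code s p q

/-- The nine blocks around `(i, j)` code letters satisfying the local condition `R`. -/
def Good (R : (ℤ → ℤ → A) → Prop) (code : A → ℕ → ℕ → B) (N : ℕ) (z : ℤ → ℤ → B) (i j : ℤ) :
    Prop :=
  ∃ s : ℤ → ℤ → A, R s ∧ ∀ a b, -1 ≤ a → a ≤ 1 → -1 ≤ b → b ≤ 1 →
    Blk code N (s a b) z (i + N * a) (j + N * b)

/-- The configurations coding a configuration satisfying `R` everywhere. -/
def coded (R : (ℤ → ℤ → A) → Prop) (code : A → ℕ → ℕ → B) (N : ℕ) : Set (ℤ → ℤ → B) :=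
  {z | ∀ i j, ∃ p < N, ∃ q < N, Good R code N z (i + p) (j + q)}

variable {R : (ℤ → ℤ → A) → Prop} {code : A → ℕ → ℕ → B} {N : ℕ} {w₀ w₁ : B} {z : ℤ → ℤ → B}

theorem IsCode.sync (hC : IsCode N w₀ w₁ code) {i j : ℤ}
    (h : ∀ a < 2, ∀ b < 2, ∃ s, Blk code N s z (i + N * (a : ℕ)) (j + N * (b : ℕ))) {u v : ℕ}
    (hu : u ≤ N) (hv : v ≤ N) {t : A} (ht : Blk code N t z (i + u) (j + v)) :
    (u = 0 ∨ u = N) ∧ (v = 0 ∨ v = N) := by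
  have hN := hC.two_le
  have hval : ∀ p < 2 * N, ∀ q < 2 * N, ∃ s, z (i + (p : ℕ)) (j + (q : ℕ)) =
      code s (p % N) (q % N) := by
    intro p hp q hq
    obtain ⟨s, hs⟩ := h (p / N) (Nat.div_lt_of_lt_mul (by linarith)) (q / N)
      (Nat.div_lt_of_lt_mul (by linarith))
    refine ⟨s, ?_⟩
    rw [← hs _ (Nat.mod_lt _ (by omega)) _ (Nat.mod_lt _ (by omega)), add_assoc, add_assoc]
    norm_cast
    rw [Nat.div_add_mod, Nat.div_add_mod]
  have hv' : v = 0 ∨ v = N := by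
    by_contra hc
    obtain ⟨p, hp, hup⟩ : ∃ p < N, (u + p) % N = 0 ∧ u + p < 2 * N := by
      by_cases hu' : u = 0 ∨ u = N
      · refine ⟨0, by omega, ?_, by omega⟩
        rcases hu' with rfl | rfl <;> simp
      · exact ⟨N - u, by omega, by rw [Nat.add_sub_cancel' hu, Nat.mod_self], by omega⟩
    obtain ⟨s, hs⟩ := hval (u + p) hup.2 v (by omega)
    rw [hup.1, Nat.mod_eq_of_lt (by omega), hC.col_zero s v (by omega) (by omega)] at hs
    have h1 := ht p hp 0 (by omega)
    rw [hC.row_zero t p hp] at h1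
    push_cast at hs
    rw [← add_assoc] at hs
    rw [Nat.cast_zero, add_zero] at h1
    exact hC.ne (hs.symm.trans h1)
  refine ⟨?_, hv'⟩
  by_contra hc
  obtain ⟨s, hs⟩ := hval u (by omega) (v + 1) (by omega)
  have h2 : (v + 1) % N = 1 := by
    rcases hv' with rfl | rfl
    · exact Nat.mod_eq_of_lt (by omega)
    · rw [Nat.add_mod_left]; exact Nat.mod_eq_of_lt (by omega)
  rw [h2, Nat.mod_eq_of_lt (by omega), hC.row_one s u (by omega) (by omega)] at hs
  have h1 := ht 0 (by omega) 1 (by omega)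
  rw [hC.col_zero t 1 le_rfl (by omega)] at h1
  push_cast at hs h1
  rw [← add_assoc] at hs
  rw [add_zero] at h1
  exact hC.ne (h1.symm.trans hs)

theorem Good.blk (h : Good R code N z i j) : ∃ s, Blk code N s z i j := by
  obtain ⟨s, -, h⟩ := h
  exact ⟨s 0 0, by simpa using h 0 0 (by omega) (by omega) (by omega) (by omega)⟩

theorem Good.sync (hC : IsCode N w₀ w₁ code) {i j : ℤ} (h : Good R code N z i j) {a b : ℤ}
    (ha : a = -1 ∨ a = 0) (hb : b = -1 ∨ b = 0) {u v : ℕ} (hu : u ≤ N) (hv : v ≤ N)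
    (ht : Good R code N z (i + N * a + u) (j + N * b + v)) :
    (u = 0 ∨ u = N) ∧ (v = 0 ∨ v = N) := by
  obtain ⟨t, ht⟩ := ht.blk
  obtain ⟨s, -, h⟩ := h
  refine hC.sync (fun a' ha' b' hb' => ⟨s (a + a') (b + b'), ?_⟩) hu hv ht
  have := h (a + a') (b + b') (by omega) (by omega) (by omega) (by omega)
  rwa [mul_add, mul_add, ← add_assoc, ← add_assoc] at this

theorem Good.all (hC : IsCode N w₀ w₁ code) (hz : z ∈ coded R code N) {i j : ℤ}
    (h : Good R code N z i j) (a b : ℤ) : Good R code N z (i + N * a) (j + N * b) := by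
  have hN := hC.two_le
  have right : ∀ i j, Good R code N z i j → Good R code N z (i + N) j := by
    intro i j h
    obtain ⟨p, hp, q, hq, hg⟩ := hz (i + 1) j
    have := h.sync hC (a := 0) (b := 0) (u := p + 1) (v := q) (Or.inr rfl) (Or.inr rfl) hp hq.le
      (by convert hg using 1 <;> push_cast <;> ring)
    convert hg using 1 <;> omega
  have up : ∀ i j, Good R code N z i j → Good R code N z i (j + N) := by
    intro i j h
    obtain ⟨p, hp, q, hq, hg⟩ := hz i (j + 1)
    have := h.sync hC (a := 0) (b := 0) (u := p) (v := q + 1) (Or.inr rfl) (Or.inr rfl) hp.le hq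
      (by convert hg using 1 <;> push_cast <;> ring)
    convert hg using 1 <;> omega
  have left : ∀ i j, Good R code N z i j → Good R code N z (i - N) j := by
    intro i j h
    obtain ⟨p, hp, q, hq, hg⟩ := hz (i - N) j
    have := h.sync hC (a := -1) (b := 0) (u := p) (v := q) (Or.inl rfl) (Or.inr rfl) hp.le hq.le
      (by convert hg using 1 <;> ring)
    convert hg using 1 <;> omega
  have down : ∀ i j, Good R code N z i j → Good R code N z i (j - N) := by
    intro i j h
    obtain ⟨p, hp, q, hq, hg⟩ := hz i (j - N)
    have := h.sync hC (a := 0) (b := -1) (u := p) (v := q) (Or.inr rfl) (Or.inl rfl) hp.le hq.le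
      (by convert hg using 1 <;> ring)
    convert hg using 1 <;> omega
  have h1 : Good R code N z (i + N * a) j := by
    induction a with
    | zero => simpa using h
    | succ a ih => convert right _ _ ih using 1; ring
    | pred a ih => convert left _ _ ih using 1; ring
  induction b with
  | zero => simpa using h1
  | succ a ih => convert up _ _ ih using 1; ring
  | pred a ih => convert down _ _ ih using 1; ring

theorem exists_decode (hR : IsLocal R) (hC : IsCode N w₀ w₁ code) (hz : z ∈ coded R code N) :
    ∃ (p q : Fin N), ∃ y ∈ everywhere R,
      ∀ a b : ℤ, Blk code N (y a b) z (N * a - (p : ℕ)) (N * b - (q : ℕ)) := by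
  obtain ⟨p, hp, q, hq, hg⟩ := hz (1 - N) (1 - N)
  choose s hs hblk using hg.all hC hz
  refine ⟨⟨N - 1 - p, by omega⟩, ⟨N - 1 - q, by omega⟩, fun a b => s a b 0 0, fun a b => ?_,
    fun a b => ?_⟩
  · refine hR _ _ (fun a' b' h1 h2 h3 h4 => ?_) (hs a b)
    refine hC.inj _ _ fun p' hp' q' hq' => ?_
    rw [← hblk a b a' b' h1 h2 h3 h4 p' hp' q' hq',
      ← hblk (a + a') (b + b') 0 0 (by omega) (by omega) (by omega) (by omega) p' hp' q' hq']
    congr 1 <;> ring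
  · convert hblk a b 0 0 (by omega) (by omega) (by omega) (by omega) using 1 <;>
    · push_cast [show p ≤ N - 1 by omega, show q ≤ N - 1 by omega, show 1 ≤ N by omega]
      ring

/-- The configuration coding `y`. -/
def encode (code : A → ℕ → ℕ → B) (N : ℕ) (y : ℤ → ℤ → A) (i j : ℤ) : B :=
  code (y (i / N) (j / N)) (i % N).toNat (j % N).toNat

theorem encode_blk (y : ℤ → ℤ → A) (a b : ℤ) :
    Blk code N (y a b) (encode code N y) (N * a) (N * b) := by
  intro p hp q hq
  have key : ∀ (a : ℤ) (p : ℕ), p < N → (N * a + p) / N = a ∧ ((N * a + p) % N).toNat = p := by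
    intro a p hp
    have h1 : ((p : ℤ) / N) = 0 := Int.ediv_eq_zero_of_lt (by omega) (by omega)
    have h2 : ((p : ℤ) % N) = p := Int.emod_eq_of_lt (by omega) (by omega)
    rw [Int.add_comm, Int.add_mul_ediv_left _ _ (by omega), h1, Int.add_mul_emod_self_left, h2]
    simp
  rw [encode, (key a p hp).1, (key a p hp).2, (key b q hq).1, (key b q hq).2]

theorem encode_mem (hN : 0 < N) {y : ℤ → ℤ → A} (hy : y ∈ everywhere R) :
    encode code N y ∈ coded R code N := by
  have key : ∀ i : ℤ, ∃ p < N, ∃ a, i + (p : ℕ) = N * a := by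
    intro i
    have h1 := Int.emod_nonneg (-i) (b := N) (by omega)
    have h2 := Int.emod_lt_of_pos (-i) (b := N) (by omega)
    have h3 := Int.emod_add_mul_ediv (-i) N
    refine ⟨(-i % N).toNat, by omega, -(-i / N), ?_⟩
    rw [Int.toNat_of_nonneg h1]; linarith
  intro i j
  obtain ⟨p, hp, a, ha⟩ := key i
  obtain ⟨q, hq, b, hb⟩ := key j
  refine ⟨p, hp, q, hq, fun a' b' => y (a + a') (b + b'), hy a b, fun a' b' _ _ _ _ => ?_⟩
  rw [ha, hb, ← mul_add, ← mul_add]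
  exact encode_blk y _ _

theorem card_pats_coded_le [Finite A] [Finite B] (hR : IsLocal R) (hC : IsCode N w₀ w₁ code)
    (m : ℕ) : Nat.card (pats (coded R code N) (N * m)) ≤
      N * N * Nat.card (pats (everywhere R) (m + 1)) := by
  have hN := hC.two_le
  have hex : ∀ P : pats (coded R code N) (N * m), ∃ (p q : Fin N), ∃ y ∈ everywhere R,
      ∀ i j : Fin (N * m), P.1 i j = code (y ((i + p : ℕ) / N : ℕ) ((j + q : ℕ) / N : ℕ))
        ((i + p) % N) ((j + q) % N) := by
    rintro ⟨P, z, hz, hP⟩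
    obtain ⟨p, q, y, hy, hyz⟩ := exists_decode hR hC hz
    refine ⟨p, q, y, hy, fun i j => ?_⟩
    dsimp only
    have key : ∀ i p : ℕ, (N : ℤ) * ((i + p) / N : ℕ) - p + ((i + p) % N : ℕ) = i := by
      intro i p
      have := congrArg (Nat.cast (R := ℤ)) (Nat.div_add_mod (i + p) N)
      push_cast at this ⊢
      linarith
    rw [← hP, ← hyz _ _ _ (Nat.mod_lt _ (by omega)) _ (Nat.mod_lt _ (by omega)), key, key]
  choose p q y hy hP using hex
  let Φ : pats (coded R code N) (N * m) → (Fin N × Fin N) × pats (everywhere R) (m + 1) :=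
    fun P => ((p P, q P), ⟨fun i j => y P (i : ℕ) (j : ℕ), y P, hy P, fun _ _ => rfl⟩)
  have hΦ : Function.Injective Φ := by
    intro P P' h
    have h1 : p P = p P' := congrArg (fun t => t.1.1) h
    have h2 : q P = q P' := congrArg (fun t => t.1.2) h
    have h3 : (fun i j : Fin (m + 1) => y P (i : ℕ) (j : ℕ)) =
        fun i j : Fin (m + 1) => y P' (i : ℕ) (j : ℕ) := congrArg (fun t => t.2.1) h
    apply Subtype.ext
    funext i j
    have hlt : ∀ (i : Fin (N * m)) (p : Fin N), (i + p : ℕ) / N < m + 1 := fun i p =>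
      Nat.div_lt_of_lt_mul (by have := i.2; have := p.2; rw [mul_add]; omega)
    rw [hP, hP, h1, h2]
    exact congrArg (fun s => code s _ _)
      (congrFun (congrFun h3 ⟨_, hlt i (p P')⟩) ⟨_, hlt j (q P')⟩)
  refine (Nat.card_le_card_of_injective Φ hΦ).trans ?_
  rw [Nat.card_prod, Nat.card_prod, Nat.card_fin]

theorem card_pats_le_coded [Finite B] (hC : IsCode N w₀ w₁ code) (m : ℕ) :
    Nat.card (pats (everywhere R) m) ≤ Nat.card (pats (coded R code N) (N * m)) := by
  have hN := hC.two_le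
  choose y hy hP using fun P : pats (everywhere R) m => P.2
  refine Nat.card_le_card_of_injective (fun P => ⟨fun i j => encode code N (y P) (i : ℕ) (j : ℕ),
    _, encode_mem (by omega) (hy P), fun _ _ => rfl⟩) fun P P' h => ?_
  replace h : (fun i j : Fin (N * m) => encode code N (y P) (i : ℕ) (j : ℕ)) =
      fun i j : Fin (N * m) => encode code N (y P') (i : ℕ) (j : ℕ) := congrArg Subtype.val h
  apply Subtype.ext
  funext i j
  rw [← hP, ← hP]
  refine hC.inj _ _ fun p hp q hq => ?_
  rw [← encode_blk (code := code) (N := N) (y P) _ _ p hp q hq,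
    ← encode_blk (code := code) (N := N) (y P') _ _ p hp q hq]
  have hlt : ∀ i : Fin m, ∀ p < N, N * i + p < N * m := fun i p hp =>
    calc N * i + p < N * (i + 1) := by rw [mul_add]; omega
      _ ≤ N * m := Nat.mul_le_mul_left _ i.2
  have := congrFun (congrFun h ⟨_, hlt i p hp⟩) ⟨_, hlt j q hq⟩
  exact_mod_cast this

theorem coded_translate (hz : z ∈ coded R code N) (a b : ℤ) :
    (fun i j => z (a + i) (b + j)) ∈ coded R code N := by
  intro i j
  obtain ⟨p, hp, q, hq, s, hs, h⟩ := hz (a + i) (b + j)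
  refine ⟨p, hp, q, hq, s, hs, fun a' b' h1 h2 h3 h4 p' hp' q' hq' => ?_⟩
  rw [← h a' b' h1 h2 h3 h4 p' hp' q' hq']
  simp only [add_assoc]

theorem card_pats_coded_le_pow [Finite B] {L n M : ℕ} (h : L ≤ n * M) :
    Nat.card (pats (coded R code N) L) ≤ Nat.card (pats (coded R code N) n) ^ (M * M) := by
  choose z hz hP using fun P : pats (coded R code N) L => P.2
  let Φ : pats (coded R code N) L → (Fin M × Fin M → pats (coded R code N) n) := fun P ab =>
    ⟨fun i j => z P ((n * ab.1 : ℕ) + (i : ℕ)) ((n * ab.2 : ℕ) + (j : ℕ)), _,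
      coded_translate (hz P) _ _, fun _ _ => rfl⟩
  have hΦ : Function.Injective Φ := by
    intro P P' hPP
    apply Subtype.ext
    funext i j
    have hd : ∀ i : Fin L, (i : ℕ) / n < M := fun i => Nat.div_lt_of_lt_mul (i.2.trans_le h)
    have hn : 0 < n := by
      rcases Nat.eq_zero_or_pos n with rfl | h0
      · exact absurd (i.2.trans_le h) (by simp)
      · exact h0
    have := congrFun (congrFun (congrArg Subtype.val (congrFun hPP (⟨_, hd i⟩, ⟨_, hd j⟩)))
      ⟨_, Nat.mod_lt i hn⟩) ⟨_, Nat.mod_lt j hn⟩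
    dsimp only [Φ] at this
    norm_cast at this
    simp only [Nat.div_add_mod] at this
    rwa [hP, hP] at this
  refine (Nat.card_le_card_of_injective Φ hΦ).trans ?_
  rw [Nat.card_fun, Nat.card_prod, Nat.card_fin]

end blocks

section entropy
variable {A B : Type*} {R : (ℤ → ℤ → A) → Prop} {code : A → ℕ → ℕ → B} {N : ℕ} {w₀ w₁ : B}

theorem card_pats_pos [Finite B] {Z : Set (ℤ → ℤ → B)} (h : Z.Nonempty) (n : ℕ) :
    0 < Nat.card (pats Z n) := by
  obtain ⟨z, hz⟩ := h
  have : Nonempty (pats Z n) := ⟨⟨fun i j => z (i : ℕ) (j : ℕ), z, hz, fun _ _ => rfl⟩⟩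
  exact Nat.card_pos

theorem iInf_logb_coded [Finite A] [Finite B] (hR : IsLocal R) (hC : IsCode N w₀ w₁ code)
    (hne : (everywhere R).Nonempty) {β : ℝ} (hE : HasEntropy (everywhere R) β) :
    ⨅ n : ℕ, Real.logb 2 (Nat.card (pats (coded R code N) (n + 1))) / ((n : ℝ) + 1) ^ 2 =
      β / (N : ℝ) ^ 2 := by
  have hN := hC.two_le
  have hN0 : (0 : ℝ) < N := by exact_mod_cast (by omega : 0 < N)
  have hpos : ∀ n, (0 : ℝ) < Nat.card (pats (coded R code N) n) := fun n => by
    obtain ⟨y, hy⟩ := hne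
    exact_mod_cast card_pats_pos ⟨_, encode_mem (by omega) hy⟩ n
  have hlog : ∀ n, 0 ≤ Real.logb 2 (Nat.card (pats (coded R code N) n)) := fun n =>
    Real.logb_nonneg (by norm_num) (by exact_mod_cast Nat.succ_le_of_lt (Nat.cast_pos.1 (hpos n)))
  apply le_antisymm
  · set I := ⨅ n : ℕ, Real.logb 2 (Nat.card (pats (coded R code N) (n + 1))) / ((n : ℝ) + 1) ^ 2
      with hI
    rw [le_div_iff₀ (by positivity)]
    by_contra! hlt
    have hI' : ∀ n : ℕ, 0 < n →
        I * (n : ℝ) ^ 2 ≤ Real.logb 2 (Nat.card (pats (coded R code N) n)) := by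
      intro n hn
      rw [← le_div_iff₀ (by positivity)]
      have : BddBelow (Set.range fun n : ℕ =>
          Real.logb 2 (Nat.card (pats (coded R code N) (n + 1))) / ((n : ℝ) + 1) ^ 2) :=
        ⟨0, by rintro _ ⟨n, rfl⟩; exact div_nonneg (hlog _) (by positivity)⟩
      have := ciInf_le this (n - 1)
      rwa [Nat.sub_add_cancel hn, ← Nat.cast_add_one, Nat.sub_add_cancel hn] at this
    set ε := (I * (N : ℝ) ^ 2 - β) / 2 with hε
    have hlim : Tendsto (fun m : ℕ => I * (N : ℝ) ^ 2 * (1 - 1 / (m : ℝ)) ^ 2 -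
        2 * Real.logb 2 N * (1 / (m : ℝ)) ^ 2) atTop
        (nhds (I * (N : ℝ) ^ 2 * (1 - 0) ^ 2 - 2 * Real.logb 2 N * 0 ^ 2)) :=
      ((tendsto_const_nhds.sub tendsto_one_div_atTop_nhds_zero_nat).pow 2 |>.const_mul _).sub
        ((tendsto_one_div_atTop_nhds_zero_nat.pow 2).const_mul _)
    obtain ⟨m₀, hm₀⟩ := eventually_atTop.1 (hlim.eventually_const_lt
      (u := β + ε) (by rw [hε]; norm_num; linarith))
    obtain ⟨m, hm, -, h2⟩ := hE ε (by rw [hε]; linarith) (max m₀ 2)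
    obtain ⟨m, rfl⟩ : ∃ m', m = m' + 1 := ⟨m - 1, by omega⟩
    have h3 := hm₀ (m + 1) (by omega)
    have h4 := hI' (N * m) (Nat.mul_pos (by omega) (by omega))
    have h5 : Real.logb 2 (Nat.card (pats (coded R code N) (N * m))) ≤
        2 * Real.logb 2 N + Real.logb 2 (Nat.card (pats (everywhere R) (m + 1))) := by
      have hp : (0 : ℝ) < Nat.card (pats (everywhere R) (m + 1)) := by
        exact_mod_cast card_pats_pos hne _
      rw [two_mul, ← Real.logb_mul hN0.ne' hN0.ne', ← Real.logb_mul (by positivity) hp.ne']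
      exact Real.logb_le_logb_of_le (by norm_num) (hpos _)
        (by exact_mod_cast card_pats_coded_le hR hC m)
    have hm1 : (0 : ℝ) < ((m + 1 : ℕ) : ℝ) := by positivity
    have h6 := mul_lt_mul_of_pos_right h3 (pow_pos hm1 2)
    have h7 : (I * (N : ℝ) ^ 2 * (1 - 1 / ((m + 1 : ℕ) : ℝ)) ^ 2 -
        2 * Real.logb 2 N * (1 / ((m + 1 : ℕ) : ℝ)) ^ 2) * ((m + 1 : ℕ) : ℝ) ^ 2 =
        I * ((N * m : ℕ) : ℝ) ^ 2 - 2 * Real.logb 2 N := by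
      push_cast at hm1 ⊢
      field_simp
      ring
    rw [h7] at h6
    linarith
  · refine le_ciInf fun n => ?_
    set ℓ := Real.logb 2 (Nat.card (pats (coded R code N) (n + 1))) / ((n : ℝ) + 1) ^ 2 with hℓ
    rw [div_le_iff₀ (by positivity)]
    by_contra! hlt
    set ε := (β - ℓ * (N : ℝ) ^ 2) / 2 with hε
    have hlim : Tendsto (fun m : ℕ => ((N : ℝ) + (n + 1) * (1 / (m : ℝ))) ^ 2 * ℓ) atTop
        (nhds (((N : ℝ) + (n + 1) * 0) ^ 2 * ℓ)) :=
      ((tendsto_one_div_atTop_nhds_zero_nat.const_mul _).const_add _ |>.pow 2).mul_const _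
    obtain ⟨m₀, hm₀⟩ := eventually_atTop.1 (hlim.eventually_lt_const
      (u := β - ε) (by rw [hε, mul_zero, add_zero]; linarith))
    obtain ⟨m, hm, h1, -⟩ := hE ε (by rw [hε]; linarith) (max m₀ 1)
    have h3 := hm₀ m (by omega)
    set M := N * m / (n + 1) + 1 with hM
    have hM1 : N * m ≤ (n + 1) * M := by
      have := Nat.lt_mul_div_succ (N * m) (Nat.succ_pos n)
      exact this.le
    have hM2 : (n + 1) * M ≤ N * m + (n + 1) := by
      rw [hM, mul_add, mul_one]
      exact Nat.add_le_add_right (Nat.mul_div_le _ _) _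
    have h4 : Real.logb 2 (Nat.card (pats (everywhere R) m)) ≤
        (M * M : ℕ) * Real.logb 2 (Nat.card (pats (coded R code N) (n + 1))) := by
      rw [← Real.logb_pow]
      refine Real.logb_le_logb_of_le (by norm_num) (by exact_mod_cast card_pats_pos hne _) ?_
      exact_mod_cast (card_pats_le_coded hC m).trans (card_pats_coded_le_pow hM1)
    have hm1 : (0 : ℝ) < m := by exact_mod_cast (by omega : 0 < m)
    have h5 : (M * M : ℕ) * Real.logb 2 (Nat.card (pats (coded R code N) (n + 1))) =
        (((n + 1) * M : ℕ) : ℝ) ^ 2 * ℓ := by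
      rw [hℓ]; push_cast; field_simp
    have h6 : (((n + 1) * M : ℕ) : ℝ) ^ 2 * ℓ ≤ ((N * m + (n + 1) : ℕ) : ℝ) ^ 2 * ℓ := by
      have : 0 ≤ ℓ := div_nonneg (hlog _) (by positivity)
      gcongr
    have h7 := mul_lt_mul_of_pos_right h3 (pow_pos hm1 2)
    have h8 : ((N : ℝ) + (n + 1) * (1 / (m : ℝ))) ^ 2 * ℓ * (m : ℝ) ^ 2 =
        ((N * m + (n + 1) : ℕ) : ℝ) ^ 2 * ℓ := by
      push_cast; field_simp
    linarith

end entropy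

section multidim
variable {A : Type*}

theorem exists_SFTD_eq [Finite A] [Nonempty A] {d : ℕ} (S : Finset (Fin d → ℤ))
    (Q : ((Fin d → ℤ) → A) → Prop) (hQ : ∀ x y, (∀ u ∈ S, x u = y u) → Q x → Q y) :
    ∃ F : Finset (PatternD d A), SFTD F = {x | ∀ v, Q fun u => x (u + v)} := by
  classical
  let extd : (S → A) → (Fin d → ℤ) → A := fun g u =>
    if h : u ∈ S then g ⟨u, h⟩ else Classical.arbitrary A
  have hfin : ((fun g => (⟨S, extd g⟩ : PatternD d A)) '' {g | ¬ Q (extd g)}).Finite :=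
    (Set.toFinite _).image _
  refine ⟨hfin.toFinset, Set.ext fun x => ?_⟩
  simp only [SFTD, Set.Finite.mem_toFinset, Set.forall_mem_image, PatternD.OccursIn,
    Set.mem_ofPred_eq, not_exists]
  constructor
  · intro h v
    by_contra hc
    have key : ∀ u ∈ S, extd (fun u => x (u + v)) u = x (u + v) := fun u hu => by simp [extd, hu]
    exact h (x := fun u : S => x (u + v)) (fun hq => hc (hQ _ _ key hq)) v
      fun u hu => (key u hu).symm
  · intro h g hg v hv
    exact hg (hQ _ _ hv (h v))

/-- The planar slices of a configuration. -/
def slice {e : ℕ} (x : (Fin (e + 2) → ℤ) → A) (w : Fin e → ℤ) (i j : ℤ) : A :=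
  x (Fin.cons i (Fin.cons j w : Fin (e + 1) → ℤ))

/-- The configurations all of whose planar slices belong to `Z`. -/
def sliced (e : ℕ) (Z : Set (ℤ → ℤ → A)) : Set ((Fin (e + 2) → ℤ) → A) :=
  {x | ∀ w, slice x w ∈ Z}

/-- The configuration with given planar slices. -/
def unslice {e : ℕ} (y : (Fin e → ℤ) → ℤ → ℤ → A) (u : Fin (e + 2) → ℤ) : A :=
  y (Fin.tail (Fin.tail u)) (u 0) (u 1)

theorem slice_unslice {e : ℕ} (y : (Fin e → ℤ) → ℤ → ℤ → A) (w : Fin e → ℤ) :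
    slice (unslice y) w = y w := by
  funext i j
  rfl

theorem sliced_nonempty {e : ℕ} {Z : Set (ℤ → ℤ → A)} (h : Z.Nonempty) :
    (sliced e Z).Nonempty := by
  obtain ⟨z, hz⟩ := h
  exact ⟨unslice fun _ => z, fun w => by rwa [slice_unslice]⟩

theorem patCountD_sliced {e : ℕ} {Z : Set (ℤ → ℤ → A)} (h : Z.Nonempty) (n : ℕ) :
    patCountD (sliced e Z) n = Nat.card (pats Z n) ^ n ^ e := by
  have hc : Nat.card ((Fin e → Fin n) → pats Z n) = Nat.card (pats Z n) ^ n ^ e := by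
    rw [Nat.card_fun, Nat.card_fun, Nat.card_fin, Nat.card_fin]
  rw [← hc, patCountD, ← Nat.card_coe_set_eq]
  refine Nat.card_congr (Equiv.ofBijective (fun p w => ⟨fun i j => p.1 (Fin.cons i
    (Fin.cons j w : Fin (e + 1) → Fin n)), ?_⟩) ⟨?_, ?_⟩)
  · obtain ⟨p, x, hx, hp⟩ := p
    refine ⟨slice x fun i => (w i : ℕ), hx _, fun i j => ?_⟩
    dsimp only
    rw [← hp, slice]
    congr 1
    funext a
    refine Fin.cases rfl (fun a => Fin.cases rfl (fun a => rfl) a) a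
  · intro p p' h
    apply Subtype.ext
    funext u
    have := congrFun (congrFun (congrArg Subtype.val (congrFun h (Fin.tail (Fin.tail u)))) (u 0))
      (Fin.tail u 0)
    dsimp only at this
    rwa [Fin.cons_self_tail, Fin.cons_self_tail] at this
  · intro g
    obtain ⟨z₀, hz₀⟩ := h
    choose z hz hg using fun w => (g w).2
    let c : (Fin e → Fin n) → Fin e → ℤ := fun w i => (w i : ℕ)
    have hc : Function.Injective c := fun w w' h => funext fun i => Fin.ext <|
      Int.ofNat_inj.1 (congrFun h i)
    refine ⟨⟨fun u => (g (Fin.tail (Fin.tail u))).1 (u 0) (u 1),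
      unslice (Function.extend c z fun _ => z₀), fun w => ?_, fun u => ?_⟩, ?_⟩
    · rw [slice_unslice]
      by_cases hw : ∃ w', c w' = w
      · obtain ⟨w', rfl⟩ := hw
        rw [hc.extend_apply]
        exact hz w'
      · rwa [Function.extend_apply' _ _ _ hw]
    · refine Eq.trans ?_ (hg _ _ _)
      exact congrFun (congrFun (hc.extend_apply z _ (Fin.tail (Fin.tail u))) _) _
    · rfl

theorem entropyD_sliced [Finite A] {e : ℕ} {Z : Set (ℤ → ℤ → A)} (h : Z.Nonempty) :
    entropyD (sliced e Z) =
      ⨅ n : ℕ, Real.logb 2 (Nat.card (pats Z (n + 1))) / ((n : ℝ) + 1) ^ 2 := by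
  refine iInf_congr fun n => ?_
  rw [patCountD_sliced h, Nat.cast_pow, Real.logb_pow]
  push_cast
  rw [pow_add]
  field_simp

end multidim

theorem exists_SFTD_eq_sliced {A B : Type*} [Finite B] [Nonempty B] (R : (ℤ → ℤ → A) → Prop)
    (code : A → ℕ → ℕ → B) (N e : ℕ) :
    ∃ F : Finset (PatternD (e + 2) B), SFTD F = sliced e (coded R code N) := by
  classical
  obtain ⟨F, hF⟩ := exists_SFTD_eq
    ((Finset.Icc (-(N : ℤ)) (3 * N) ×ˢ Finset.Icc (-(N : ℤ)) (3 * N)).image fun c =>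
      (Fin.cons c.1 (Fin.cons c.2 0 : Fin (e + 1) → ℤ) : Fin (e + 2) → ℤ))
    (fun x : (Fin (e + 2) → ℤ) → B =>
      ∃ p < N, ∃ q < N, Good R code N (slice x 0) (p : ℕ) (q : ℕ)) (by
    rintro x y hxy ⟨p, hp, q, hq, s, hs, h⟩
    refine ⟨p, hp, q, hq, s, hs, fun a b h1 h2 h3 h4 p' hp' q' hq' => ?_⟩
    rw [← h a b h1 h2 h3 h4 p' hp' q' hq']
    refine (hxy _ (Finset.mem_image.2 ⟨(_, _), ?_, rfl⟩)).symm
    simp only [Finset.mem_product, Finset.mem_Icc]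
    have h5 : (N : ℤ) * (-1) ≤ N * a := by gcongr
    have h6 : (N : ℤ) * a ≤ N * 1 := by gcongr
    have h7 : (N : ℤ) * (-1) ≤ N * b := by gcongr
    have h8 : (N : ℤ) * b ≤ N * 1 := by gcongr
    omega)
  refine ⟨F, hF.trans (Set.ext fun x => ?_)⟩
  have key : ∀ v i j, slice (fun u => x (u + v)) 0 i j =
      slice x (Fin.tail (Fin.tail v)) (v 0 + i) (v 1 + j) := by
    intro v i j
    refine congrArg x (funext fun a => ?_)
    refine Fin.cases (add_comm _ _) (fun a => Fin.cases (add_comm _ _) (fun a => ?_) a) a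
    exact zero_add _
  have key2 : ∀ v (p q : ℕ), Good R code N (slice (fun u => x (u + v)) 0) p q ↔
      Good R code N (slice x (Fin.tail (Fin.tail v))) (v 0 + p) (v 1 + q) := by
    intro v p q
    simp only [Good, Blk, key, add_assoc]
  simp only [Set.mem_ofPred_eq, key2]
  constructor
  · intro h w i j
    exact h (Fin.cons i (Fin.cons j w : Fin (e + 1) → ℤ))
  · intro h v
    exact h _ _ _

theorem entropyD_SFTD_empty {d k : ℕ} (hk : 0 < k) :
    entropyD (SFTD (∅ : Finset (PatternD d (Fin k)))) = Real.logb 2 k := by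
  have h : ∀ n, patCountD (SFTD (∅ : Finset (PatternD d (Fin k)))) n = k ^ n ^ d := by
    intro n
    have h1 : {p : (Fin d → Fin n) → Fin k | ∃ x ∈ SFTD (∅ : Finset (PatternD d (Fin k))),
        ∀ u : Fin d → Fin n, x (fun i => (u i : ℤ)) = p u} = Set.univ := by
      refine Set.eq_univ_of_forall fun p => ?_
      have hc : Function.Injective fun (u : Fin d → Fin n) (i : Fin d) => (u i : ℤ) :=
        fun u u' h => funext fun i => Fin.ext <| Int.ofNat_inj.1 (congrFun h i)
      exact ⟨Function.extend _ p fun _ => ⟨0, hk⟩, by simp [SFTD], fun u => hc.extend_apply p _ u⟩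
    rw [patCountD, h1, Set.ncard_univ, Nat.card_fun, Nat.card_fun, Nat.card_fin, Nat.card_fin,
      Nat.card_fin]
  refine Eq.trans (iInf_congr fun n => ?_) (ciInf_const (ι := ℕ))
  rw [h, Nat.cast_pow, Real.logb_pow]
  push_cast
  field_simp

/-- The block size can be chosen so that the blocks accommodate the letters. -/
theorem exists_block_size {k a b : ℕ} (hk : 1 < k) (hb : 0 < b)
    (h : (a : ℝ) / b < Real.logb 2 k) (C : ℕ) :
    ∃ s n : ℕ, b * s = n + 2 ∧ C * 2 ^ (a * b * s ^ 2) ≤ k ^ ((n + 1) * n) := by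
  set L := Real.logb 2 k with hL
  have hL0 : 0 ≤ L := Real.logb_nonneg (by norm_num) (by exact_mod_cast hk.le)
  obtain ⟨s, hs⟩ := exists_nat_gt ((3 * L + C) / (L - a / b) + 2)
  have hb1 : (1 : ℝ) ≤ b := by exact_mod_cast hb
  have hd : 0 < L - a / b := by linarith
  have hq : 0 ≤ (3 * L + C) / (L - a / b) := by positivity
  have hs2 : 2 ≤ s := by
    have : (2 : ℝ) < s := by linarith
    exact_mod_cast this.le
  obtain ⟨n, hn⟩ : ∃ n, b * s = n + 2 := ⟨b * s - 2, by have := Nat.mul_le_mul hb hs2; omega⟩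
  refine ⟨s, n, hn, ?_⟩
  have hn' : (b : ℝ) * s = n + 2 := by exact_mod_cast hn
  have hsn : (s : ℝ) ≤ n + 2 := by rw [← hn']; nlinarith [(Nat.cast_nonneg s : (0 : ℝ) ≤ s)]
  have h1 : 3 * L + C ≤ (L - a / b) * (n + 2) := by
    rw [← div_le_iff₀' hd]; linarith
  have h2 : ((C + a * b * s ^ 2 : ℕ) : ℝ) ≤ L * ((n + 1) * n : ℕ) := by
    have h3 : ((a * b * s ^ 2 : ℕ) : ℝ) = a / b * (n + 2) ^ 2 := by
      rw [← hn']; push_cast; field_simp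
    rw [Nat.cast_add, h3]
    push_cast
    have hC : (0 : ℝ) ≤ C := Nat.cast_nonneg _
    have hn0 : (0 : ℝ) ≤ n := Nat.cast_nonneg _
    nlinarith [mul_le_mul_of_nonneg_right h1 (by linarith : (0 : ℝ) ≤ n + 2)]
  have h3 : C * 2 ^ (a * b * s ^ 2) ≤ 2 ^ (C + a * b * s ^ 2) := by
    rw [pow_add]
    exact Nat.mul_le_mul_right _ Nat.lt_two_pow_self.le
  refine h3.trans ?_
  have hk0 : (0 : ℝ) < k := by exact_mod_cast (by omega : 0 < k)
  have h4 : (2 : ℝ) ^ (C + a * b * s ^ 2) ≤ (k : ℝ) ^ ((n + 1) * n) := by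
    rw [← Real.rpow_natCast 2, ← Real.rpow_natCast (k : ℝ),
      ← Real.rpow_logb (b := 2) (by norm_num) (by norm_num) hk0, ← Real.rpow_mul (by norm_num)]
    exact Real.rpow_le_rpow_of_exponent_le (by norm_num) h2
  exact_mod_cast h4

end SFTEntropy

open SFTEntropy

/-- every Π₁-computable real in `[0, log₂ k]` is the entropy of a nonempty
`d`-dimensional SFT on the alphabet `Fin k` (for `d ≥ 2`). -/
theorem stmt8 (k d : ℕ) (hk : 1 ≤ k) (hd : 2 ≤ d) (h : ℝ)
    (hh : Pi1Computable h) (h0 : 0 ≤ h) (h1 : h ≤ Real.logb 2 k) :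
    ∃ F : Finset (PatternD d (Fin k)), (SFTD F).Nonempty ∧ entropyD (SFTD F) = h := by
  have : Nonempty (Fin k) := ⟨⟨0, hk⟩⟩
  rcases h1.eq_or_lt with rfl | h1
  · exact ⟨∅, ⟨fun _ => ⟨0, hk⟩, by simp [SFTD]⟩, entropyD_SFTD_empty hk⟩
  obtain ⟨e, rfl⟩ : ∃ e, d = e + 2 := ⟨d - 2, by omega⟩
  have hk1 : 1 < k := by
    by_contra hc
    obtain rfl : k = 1 := by omega
    simp at h1
    linarith
  obtain ⟨κ, hκ0, hκ1⟩ := exists_rat_btwn h1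
  have hκ : 0 < κ := by exact_mod_cast h0.trans_lt hκ0
  obtain ⟨a, ha⟩ : ∃ a : ℕ, (a : ℤ) = κ.num := ⟨κ.num.toNat, Int.toNat_of_nonneg (by positivity)⟩
  have hab : (κ : ℝ) = a / κ.den := by
    rw [Rat.cast_def, ← ha]; simp
  have ha0 : 0 < a := by exact_mod_cast ha ▸ Rat.num_pos.2 hκ
  have hb0 := κ.den_pos
  generalize κ.den = b at hab hb0
  have ha' : (0 : ℝ) < a := by exact_mod_cast ha0
  have hb' : (0 : ℝ) < b := by exact_mod_cast hb0
  rw [hab] at hκ0 hκ1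
  obtain ⟨C, hC⟩ := exists_hasEntropy hh h0 hb0 (α := h * b / a) (by field_simp)
    (by rw [div_lt_one ha']; rwa [lt_div_iff₀ hb'] at hκ0) ha0
  obtain ⟨s, n, hsn, hcard⟩ := exists_block_size hk1 hb0 hκ1 C
  obtain ⟨A, _, _, R, hA, hR, hne, hE⟩ := hC (a * b * s ^ 2)
  obtain ⟨code, hcode⟩ := exists_isCode (A := A) (B := Fin k) (w₀ := ⟨0, hk⟩) (w₁ := ⟨1, hk1⟩)
    (by simp) (n := n) (by rwa [hA, Nat.card_fin])
  obtain ⟨y, hy⟩ := hne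
  have hZ : (coded R code (n + 2)).Nonempty := ⟨_, encode_mem (by omega) hy⟩
  obtain ⟨F, hF⟩ := exists_SFTD_eq_sliced R code (n + 2) e
  refine ⟨F, hF ▸ sliced_nonempty hZ, ?_⟩
  have hs : (s : ℝ) ≠ 0 := by
    rintro hs
    rw [Nat.cast_eq_zero.1 hs] at hsn
    omega
  rw [hF, entropyD_sliced hZ, iInf_logb_coded hR hcode ⟨y, hy⟩ hE, ← hsn]
  push_cast
  field_simp
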